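/- Let f : ℝ_{>0} → ℝ_{>0} be an increasing function and fix an integer 2 ≤ j ≤ d, where d = m + n. Then ∑_{k=1}^∞ 1/f(k) < ∞ if and only if for almost every m×n real matrix B there exists R₀ > 0 such that for all R ≥ R₀ one has λ_j(A_R U_B ℤ^d) < (f(log R))^{1/(d(d−j+1))}. -/

import Mathlib

open MeasureTheory
open scoped ENNReal

/-- The `L^p` norm of a vector in `ℝ^ι`, for `p ∈ [1,∞]` (junk values otherwise). -/
noncomputable def lpNorm (p : ℝ≥0∞) {ι : Type*} [Fintype ι] (x : ι → ℝ) : ℝ :=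
  ‖(WithLp.equiv p (ι → ℝ)).symm x‖

/-- The Euclidean (`L²`) norm of a vector. -/
noncomputable def euclNorm {ι : Type*} [Fintype ι] (x : ι → ℝ) : ℝ :=
  Real.sqrt (∑ i, x i ^ 2)

/-- `cone(S) = {c • u : u ∈ S, c > 0}`. -/
def cone {m : ℕ} (S : Set (Fin m → ℝ)) : Set (Fin m → ℝ) :=
  {y | ∃ u ∈ S, ∃ c : ℝ, 0 < c ∧ y = c • u}

/-- `S` is an open subset of the unit (Euclidean) sphere of `ℝ^m`. -/
def IsOpenSubsetOfSphere {m : ℕ} (S : Set (Fin m → ℝ)) : Prop :=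
  ∃ U : Set (Fin m → ℝ), IsOpen U ∧ S = U ∩ {u | euclNorm u = 1}

/-- Matrix-vector multiplication, with the matrix given as `Fin m → Fin n → ℝ`. -/
def matVec {m n : ℕ} (B : Fin m → Fin n → ℝ) (x : Fin n → ℝ) : Fin m → ℝ :=
  fun i => ∑ j, B i j * x j

/-- The block matrix `U_B = [[Id_n, 0], [B, Id_m]]`, indexed by `Fin n ⊕ Fin m`. -/
def UB {m n : ℕ} (B : Fin m → Fin n → ℝ) :
    Matrix (Fin n ⊕ Fin m) (Fin n ⊕ Fin m) ℝ :=
  Matrix.fromBlocks 1 0 (Matrix.of B) 1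

/-- The diagonal matrix `A_Q = diag(Q^{-1/n} Id_n, Q^{1/m} Id_m)`. -/
noncomputable def AQ (m n : ℕ) (Q : ℝ) :
    Matrix (Fin n ⊕ Fin m) (Fin n ⊕ Fin m) ℝ :=
  Matrix.diagonal
    (Sum.elim (fun _ : Fin n => Q ^ (-(n : ℝ)⁻¹)) (fun _ : Fin m => Q ^ ((m : ℝ)⁻¹)))

/-- The lattice `Mℤ^d` generated by the columns of `M`. -/
def colLattice {ι : Type*} [Fintype ι] (M : Matrix ι ι ℝ) : Submodule ℤ (ι → ℝ) :=
  Submodule.span ℤ (Set.range fun j => fun i => M i j)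

/-- The `i`-th successive minimum of a lattice `L ⊆ ℝ^ι`: the least `r > 0` such that `L`
contains `i` linearly independent vectors of Euclidean norm at most `r`. -/
noncomputable def succMin {ι : Type*} [Fintype ι] (L : Submodule ℤ (ι → ℝ)) (i : ℕ) : ℝ :=
  sInf {r : ℝ | 0 < r ∧ ∃ v : Fin i → (ι → ℝ), (∀ j, v j ∈ L) ∧
    LinearIndependent ℝ v ∧ ∀ j, euclNorm (v j) ≤ r}

open MeasureTheory
open scoped ENNReal

set_option linter.unusedSectionVars false
set_option linter.unusedVariables false
namespace KM
open InnerProductSpace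

section GS
variable {E : Type*} [NormedAddCommGroup E] [InnerProductSpace ℝ E]

/-- Gram-Schmidt vectors of a sequence. -/
noncomputable def gs (b : ℕ → E) (k : ℕ) : E := gramSchmidt ℝ b k
/-- Gram-Schmidt norms. -/
noncomputable def rr (b : ℕ → E) (k : ℕ) : ℝ := ‖gs b k‖
/-- partial products of Gram-Schmidt norms. -/
noncomputable def PP (b : ℕ → E) (k : ℕ) : ℝ := ∏ l ∈ Finset.range k, rr b l

lemma rr_nonneg (b : ℕ → E) (k : ℕ) : 0 ≤ rr b k := norm_nonneg _

lemma PP_succ (b : ℕ → E) (k : ℕ) : PP b (k+1) = PP b k * rr b k := Finset.prod_range_succ _ _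

lemma gs_eq (b : ℕ → E) (k : ℕ) :
    b k = gs b k + ∑ j ∈ Finset.range k, (inner ℝ (gs b j) (b k) / rr b j ^ 2) • gs b j := by
  have := gramSchmidt_def'' ℝ b k
  rw [Nat.Iio_eq_range] at this
  exact this

lemma gs_eq' (b : ℕ → E) (k : ℕ) :
    gs b k = b k - ∑ j ∈ Finset.range k, (inner ℝ (gs b j) (b k) / rr b j ^ 2) • gs b j :=
  eq_sub_of_add_eq (gs_eq b k).symm

lemma gs_congr {b b' : ℕ → E} : ∀ k, (∀ j ≤ k, b j = b' j) → gs b k = gs b' k := by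
  intro k
  induction k using Nat.strong_induction_on with
  | _ k ih =>
    intro h
    rw [gs_eq', gs_eq' b', h k le_rfl]
    congr 1
    apply Finset.sum_congr rfl
    intro j hj
    have hj := Finset.mem_range.1 hj
    have : gs b j = gs b' j := ih j hj (fun i hi => h i (by omega))
    simp only [rr, this]

lemma gs_orth (b : ℕ → E) {j k : ℕ} (h : j ≠ k) : inner ℝ (gs b j) (gs b k) = 0 :=
  gramSchmidt_orthogonal ℝ b h

lemma inner_gs_lt (b : ℕ → E) {J k : ℕ} (h : k < J) : inner ℝ (gs b J) (b k) = 0 := by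
  rw [gs_eq b k, inner_add_right, gs_orth b (by omega), inner_sum]
  simp only [inner_smul_right, zero_add]
  apply Finset.sum_eq_zero
  intro j hj
  have hj := Finset.mem_range.1 hj
  rw [gs_orth b (by omega), mul_zero]

lemma inner_gs_self (b : ℕ → E) (J : ℕ) : inner ℝ (gs b J) (b J) = rr b J ^ 2 := by
  conv_lhs => rw [gs_eq b J]
  rw [inner_add_right, inner_sum]
  simp only [inner_smul_right]
  rw [Finset.sum_eq_zero, add_zero, real_inner_self_eq_norm_sq]; rfl
  intro j hj
  have hj := Finset.mem_range.1 hj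
  rw [gs_orth b (by omega), mul_zero]

/-- real span of the first `k` vectors -/
def spn (b : ℕ → E) (k : ℕ) : Submodule ℝ E := Submodule.span ℝ (b '' Set.Iio k)

lemma gs_mem (b : ℕ → E) {j k : ℕ} (h : j < k) : gs b j ∈ spn b k := by
  have : gs b j ∈ Submodule.span ℝ (gramSchmidt ℝ b '' Set.Iio k) :=
    Submodule.subset_span ⟨j, h, rfl⟩
  rw [span_gramSchmidt_Iio] at this
  exact this

lemma inner_gs_spn (b : ℕ → E) {k : ℕ} {x : E} (hx : x ∈ spn b k) {J : ℕ} (hJ : k ≤ J) :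
    inner ℝ (gs b J) x = 0 := by
  induction hx using Submodule.span_induction with
  | mem x h => obtain ⟨j, hj, rfl⟩ := h; exact inner_gs_lt b (lt_of_lt_of_le hj hJ)
  | zero => simp
  | add x y _ _ hx hy => rw [inner_add_right, hx, hy, add_zero]
  | smul a x _ hx => rw [inner_smul_right, hx, mul_zero]

lemma sub_gs_mem (b : ℕ → E) (k : ℕ) : b k - gs b k ∈ spn b k := by
  rw [gs_eq' b k, sub_sub_cancel]
  exact Submodule.sum_mem _ fun j hj => Submodule.smul_mem _ _ (gs_mem b (Finset.mem_range.1 hj))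

lemma mul_rr_le (b : ℕ → E) (k : ℕ) (a : ℝ) (x : E) (h : inner ℝ (gs b k) x = a * rr b k ^ 2) :
    |a| * rr b k ≤ ‖x‖ := by
  rcases (rr_nonneg b k).eq_or_lt with h0 | h0
  · rw [← h0]; simp
  have := abs_real_inner_le_norm (gs b k) x
  rw [h, abs_mul, abs_of_nonneg (sq_nonneg (rr b k))] at this
  change _ ≤ rr b k * _ at this
  have : rr b k * (|a| * rr b k) ≤ rr b k * ‖x‖ := by linarith [this]
  exact le_of_mul_le_mul_left this h0

lemma rr_le (b : ℕ → E) (k : ℕ) {x : E} (hx : x ∈ spn b k) : rr b k ≤ ‖b k - x‖ := by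
  have := mul_rr_le b k 1 (b k - x) (by
    rw [inner_sub_right, inner_gs_self, inner_gs_spn b hx le_rfl]; ring)
  simpa using this

lemma rr_ne_zero {b : ℕ → E} {d : ℕ} (h : LinearIndependent ℝ (fun k : Fin d => b k)) {k : ℕ}
    (hk : k < d) : rr b k ≠ 0 := by
  rw [rr, norm_ne_zero_iff]
  apply gramSchmidt_ne_zero_coe
  exact h.comp (fun j : Set.Iic k => (⟨j.1, lt_of_le_of_lt j.2 hk⟩ : Fin d))
    (fun x y hxy => by simpa [Subtype.ext_iff] using hxy)

lemma rr_pos {b : ℕ → E} {d : ℕ} (h : LinearIndependent ℝ (fun k : Fin d => b k)) {k : ℕ}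
    (hk : k < d) : 0 < rr b k := lt_of_le_of_ne (rr_nonneg b k) (rr_ne_zero h hk).symm

/-- integer combination -/
noncomputable def lc (d : ℕ) (b : ℕ → E) (z : Fin d → ℤ) : E := ∑ k, (z k) • b k

lemma inner_gs_lc {d : ℕ} (b : ℕ → E) (z : Fin d → ℤ) (k : Fin d) :
    inner ℝ (gs b k) (lc d b z) =
      z k * rr b k ^ 2 + ∑ j ∈ Finset.univ.filter (fun j => k < j), z j * inner ℝ (gs b k) (b j) := by
  rw [lc, inner_sum]
  simp only [← Int.cast_smul_eq_zsmul ℝ, inner_smul_right]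
  rw [← Finset.add_sum_erase _ _ (Finset.mem_univ k), inner_gs_self]
  congr 1
  symm
  apply Finset.sum_subset
  · intro j hj; simp at hj ⊢; exact hj.ne'
  · intro j hj hj2
    simp at hj hj2
    rw [inner_gs_lt, mul_zero]
    exact lt_of_le_of_ne hj2 (Fin.val_ne_of_ne hj)

lemma lc_top {d : ℕ} (b : ℕ → E) (z : Fin d → ℤ) (k : Fin d) (hz : ∀ j, k < j → z j = 0) :
    inner ℝ (gs b k) (lc d b z) = z k * rr b k ^ 2 := by
  rw [inner_gs_lc, Finset.sum_eq_zero, add_zero]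
  intro j hj
  rw [hz j (by simpa using hj)]; simp

lemma exists_top {d : ℕ} (z : Fin d → ℤ) (hz : z ≠ 0) :
    ∃ k, z k ≠ 0 ∧ ∀ j, k < j → z j = 0 := by
  obtain ⟨k0, hk0⟩ := Function.ne_iff.1 hz
  obtain ⟨k, hk, hm⟩ := (Finset.univ.filter (fun k => z k ≠ 0)).exists_maximal ⟨k0, by simpa using hk0⟩
  refine ⟨k, by simpa using hk, fun j hj => ?_⟩
  by_contra h
  exact absurd (hm (by simpa using h) hj.le) (not_le.2 hj)

lemma rr_le_lc {d : ℕ} (b : ℕ → E) (z : Fin d → ℤ) (k : Fin d) (hzk : z k ≠ 0)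
    (hz : ∀ j, k < j → z j = 0) : rr b k ≤ ‖lc d b z‖ := by
  have h := mul_rr_le b k (z k) _ (lc_top b z k hz)
  have h1 : (1:ℝ) ≤ |(z k : ℝ)| := by
    exact_mod_cast Int.one_le_abs hzk
  nlinarith [rr_nonneg b k]

/-- lattice spanned by the first d vectors -/
def lat (d : ℕ) (b : ℕ → E) : Submodule ℤ E := Submodule.span ℤ (Set.range fun k : Fin d => b k)

lemma mem_lat {d : ℕ} {b : ℕ → E} {x : E} : x ∈ lat d b ↔ ∃ z, lc d b z = x := by
  rw [lat, Submodule.mem_span_range_iff_exists_fun]; rfl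

lemma mem_lat_of_lt {d : ℕ} (b : ℕ → E) {k : ℕ} (hk : k < d) : b k ∈ lat d b :=
  Submodule.subset_span ⟨⟨k, hk⟩, rfl⟩

lemma lat_li {d : ℕ} {b b' : ℕ → E} (h : lat d b = lat d b')
    (hb : LinearIndependent ℝ (fun k : Fin d => b k)) :
    LinearIndependent ℝ (fun k : Fin d => b' k) := by
  rw [linearIndependent_iff_card_eq_finrank_span] at hb ⊢
  rw [hb]
  unfold Set.finrank
  have key : ∀ c : ℕ → E, Submodule.span ℝ (Set.range fun k : Fin d => c k)
      = Submodule.span ℝ (lat d c : Set E) := by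
    intro c
    rw [lat, Submodule.span_span_of_tower]
  rw [key, key, h]

lemma lat_eq_of {d : ℕ} {b b' : ℕ → E} (h1 : ∀ k < d, b k ∈ lat d b')
    (h2 : ∀ k < d, b' k ∈ lat d b) : lat d b = lat d b' := by
  apply le_antisymm <;> rw [lat, Submodule.span_le] <;> rintro _ ⟨k, rfl⟩
  · exact h1 k k.2
  · exact h2 k k.2

end GS
end KM

open MeasureTheory
open scoped ENNReal
set_option linter.unusedSectionVars false
namespace KM
open InnerProductSpace

section Red
variable {E : Type*} [NormedAddCommGroup E] [InnerProductSpace ℝ E]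

/-- greedy lower bound -/
lemma rr_lower {d : ℕ} {b b' : ℕ → E} (hl : lat d b = lat d b')
    (hb : LinearIndependent ℝ (fun k : Fin d => b k)) {k : ℕ} (hk : k < d)
    (hag : ∀ j < k, b j = b' j) {δ : ℝ} (hδ : ∀ j < d, δ ≤ rr b j) : δ ≤ rr b' k := by
  have hb' := lat_li hl hb
  have hmem : b' k ∈ lat d b := hl ▸ mem_lat_of_lt b' hk
  obtain ⟨z, hz⟩ := mem_lat.1 hmem
  have hsp : spn b k = spn b' k := by
    unfold spn; congr 1; apply Set.image_congr; intro j hj; exact hag j hj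
  have hsub := sub_gs_mem b' k
  have hz0 : z ≠ 0 := by
    rintro rfl
    have : b' k = 0 := by rw [← hz]; simp [lc]
    exact hb'.ne_zero ⟨k, hk⟩ this
  obtain ⟨J, hJ, hJ2⟩ := exists_top z hz0
  have hJk : k ≤ J := by
    by_contra hlt
    push Not at hlt
    have : b' k ∈ spn b' k := by
      rw [← hsp, ← hz, lc]
      apply Submodule.sum_mem
      intro j _
      by_cases hj : J < j
      · rw [hJ2 j hj]; simp
      · rw [← Int.cast_smul_eq_zsmul ℝ]
        apply Submodule.smul_mem
        apply Submodule.subset_span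
        exact ⟨j, lt_of_le_of_lt (Fin.le_def.1 (not_lt.1 hj)) hlt, rfl⟩
    have h1 := rr_le b' k this
    rw [sub_self, norm_zero] at h1
    exact absurd (rr_pos hb' hk) (not_lt.2 h1)
  have h1 : inner ℝ (gs b J) (gs b' k) = z J * rr b J ^ 2 := by
    have h0 : inner ℝ (gs b J) (b' k - gs b' k) = 0 := inner_gs_spn b (hsp.symm ▸ hsub) hJk
    rw [inner_sub_right, ← hz, lc_top b z J hJ2] at h0
    linarith
  have h2 := mul_rr_le b J (z J) _ h1
  have h3 : (1:ℝ) ≤ |(z J : ℝ)| := by exact_mod_cast Int.one_le_abs hJ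
  have h4 := hδ J J.2
  change _ ≤ rr b' k at h2
  nlinarith [rr_nonneg b J]

/-- greedy step -/
lemma greedy_step {d : ℕ} {b : ℕ → E}
    (hb : LinearIndependent ℝ (fun k : Fin d => b k)) {k : ℕ} (hk : k < d) :
    ∃ b' : ℕ → E, lat d b = lat d b' ∧ (∀ j < k, b j = b' j) ∧
      ∀ b'' : ℕ → E, lat d b' = lat d b'' → (∀ j < k, b' j = b'' j) → rr b' k ≤ 1.2 * rr b'' k := by
  obtain ⟨δ, hδ0, hδ⟩ : ∃ δ > 0, ∀ j < d, δ ≤ rr b j := by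
    obtain ⟨j0, hj0, hm⟩ := (Finset.range d).exists_min_image (rr b) ⟨k, by simpa using hk⟩
    exact ⟨rr b j0, rr_pos hb (by simpa using hj0), fun j hj => hm j (by simpa using hj)⟩
  let S : Set ℝ := {r | ∃ b' : ℕ → E, lat d b = lat d b' ∧ (∀ j < k, b j = b' j) ∧ r = rr b' k}
  have hbdd : BddBelow S := ⟨0, by rintro _ ⟨b', _, _, rfl⟩; exact rr_nonneg _ _⟩
  have hne : S.Nonempty := ⟨_, b, rfl, fun _ _ => rfl, rfl⟩
  have hpos : 0 < sInf S := lt_of_lt_of_le hδ0 (le_csInf hne (by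
    rintro _ ⟨b', h1, h2, rfl⟩; exact rr_lower h1 hb hk h2 hδ))
  obtain ⟨_, ⟨b', h1, h2, rfl⟩, h3⟩ := exists_lt_of_csInf_lt hne (show sInf S < 1.2 * sInf S by linarith)
  refine ⟨b', h1, h2, fun b'' h4 h5 => ?_⟩
  have : sInf S ≤ rr b'' k := csInf_le hbdd ⟨b'', h1.trans h4, fun j hj => (h2 j hj).trans (h5 j hj), rfl⟩
  linarith

lemma greedy {d : ℕ} {b : ℕ → E} (hb : LinearIndependent ℝ (fun k : Fin d => b k)) (K : ℕ) (hK : K ≤ d) :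
    ∃ b' : ℕ → E, lat d b = lat d b' ∧ ∀ k < K,
      ∀ b'' : ℕ → E, lat d b' = lat d b'' → (∀ j < k, b' j = b'' j) → rr b' k ≤ 1.2 * rr b'' k := by
  induction K with
  | zero => exact ⟨b, rfl, by simp⟩
  | succ K ih =>
    obtain ⟨b1, h1, h2⟩ := ih (by omega)
    obtain ⟨b2, h3, h4, h5⟩ := greedy_step (lat_li h1 hb) (show K < d by omega)
    refine ⟨b2, h1.trans h3, fun k hk b'' h6 h7 => ?_⟩
    rcases Nat.lt_succ_iff_lt_or_eq.1 hk with h | rfl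
    · have : rr b2 k = rr b1 k ∨ True := Or.inr trivial
      have e : rr b1 k = rr b2 k := by
        unfold rr; rw [gs_congr k (fun j hj => h4 j (by omega))]
      rw [← e]
      exact h2 k h b'' (h3.trans h6) (fun j hj => (h4 j (by omega)).trans (h7 j hj))
    · exact h5 b'' h6 h7

lemma greedy_ratio {d : ℕ} {b : ℕ → E} (hb : LinearIndependent ℝ (fun k : Fin d => b k))
    {k : ℕ} (hk : k + 1 < d)
    (h : ∀ b'' : ℕ → E, lat d b = lat d b'' → (∀ j < k, b j = b'' j) → rr b k ≤ 1.2 * rr b'' k) :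
    rr b k ≤ 2 * rr b (k+1) := by
  have hr : 0 < rr b k := rr_pos hb (by omega)
  set μ : ℝ := inner ℝ (gs b k) (b (k+1)) / rr b k ^ 2 with hμ
  set c : ℤ := round μ with hc
  let b'' : ℕ → E := Function.update (Function.update b (k+1) (b k)) k (b (k+1) - c • b k)
  have e1 : b'' k = b (k+1) - c • b k := by simp [b'']
  have e2 : b'' (k+1) = b k := by simp [b'']
  have e3 : ∀ j, j ≠ k → j ≠ k+1 → b'' j = b j := by
    intro j h1 h2; simp [b'', Function.update_of_ne h1, Function.update_of_ne h2]
  have hl : lat d b = lat d b'' := by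
    apply lat_eq_of
    · intro j hj
      by_cases h1 : j = k
      · subst h1; rw [← e2]; exact mem_lat_of_lt _ hk
      by_cases h2 : j = k+1
      · subst h2
        have : b (k+1) = b'' k + c • b'' (k+1) := by rw [e1, e2]; abel
        rw [this]
        exact add_mem (mem_lat_of_lt _ (by omega)) (Submodule.smul_mem _ _ (mem_lat_of_lt _ hk))
      · rw [← e3 j h1 h2]; exact mem_lat_of_lt _ hj
    · intro j hj
      by_cases h1 : j = k
      · subst h1; rw [e1]
        exact sub_mem (mem_lat_of_lt _ hk) (Submodule.smul_mem _ _ (mem_lat_of_lt _ (by omega)))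
      by_cases h2 : j = k+1
      · subst h2; rw [e2]; exact mem_lat_of_lt _ (by omega)
      · rw [e3 j h1 h2]; exact mem_lat_of_lt _ hj
  have hag : ∀ j < k, b j = b'' j := fun j hj => (e3 j (by omega) (by omega)).symm
  have h1 := h b'' hl hag
  have hsp : spn b k = spn b'' k := by
    unfold spn; congr 1; apply Set.image_congr; intro j hj; exact hag j hj
  -- the vector
  have hv : b'' k - (gs b (k+1) + (μ - c) • gs b k) ∈ spn b'' k := by
    rw [e1, ← hsp]
    have h2 := gs_eq b (k+1)
    rw [Finset.sum_range_succ] at h2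
    have h3 : b k = gs b k + (b k - gs b k) := by abel
    have : b (k+1) - c • b k - (gs b (k+1) + (μ - c) • gs b k) =
      (∑ x ∈ Finset.range k, (inner ℝ (gs b x) (b (k + 1)) / rr b x ^ 2) • gs b x)
        - (c:ℝ) • (b k - gs b k) := by
      conv_lhs => rw [h2]
      rw [← hμ, ← Int.cast_smul_eq_zsmul ℝ]
      module
    rw [this]
    exact sub_mem (Submodule.sum_mem _ fun j hj => Submodule.smul_mem _ _ (gs_mem b (Finset.mem_range.1 hj)))
      (Submodule.smul_mem _ _ (sub_gs_mem b k))
  have h2 := rr_le b'' k hv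
  rw [sub_sub_cancel] at h2
  have h3 : ‖gs b (k+1) + (μ - c) • gs b k‖ ^ 2 = rr b (k+1) ^ 2 + (μ - c)^2 * rr b k ^ 2 := by
    rw [norm_add_sq_real, inner_smul_right, gs_orth b (by omega), norm_smul, mul_pow]
    simp [rr]
  have h4 : (μ - c)^2 ≤ 1/4 := by
    have := abs_sub_round μ
    rw [← hc] at this
    nlinarith [abs_nonneg (μ - c), sq_abs (μ - c)]
  have h5 : rr b k ^ 2 ≤ 1.44 * (rr b (k+1) ^ 2 + 1/4 * rr b k ^ 2) := by
    have h6 : rr b k ≤ 1.2 * ‖gs b (k+1) + (μ - c) • gs b k‖ := by linarith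
    have h7 : rr b k ^ 2 ≤ (1.2 * ‖gs b (k+1) + (μ - c) • gs b k‖)^2 := by
      gcongr
    rw [mul_pow, h3] at h7
    have := mul_le_mul_of_nonneg_right h4 (sq_nonneg (rr b k))
    nlinarith
  have h6 := rr_nonneg b (k+1)
  by_contra hcon
  push Not at hcon
  nlinarith

/-- size reduction of a single vector -/
lemma size_red {b : ℕ → E} (k : ℕ) (hr : ∀ l < k, rr b l ≠ 0) (x : E) :
    ∃ y ∈ Submodule.span ℤ (b '' Set.Iio k), ∀ l < k, |inner ℝ (gs b l) (x - y)| ≤ 1/2 * rr b l ^ 2 := by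
  induction k generalizing x with
  | zero => exact ⟨0, zero_mem _, by simp⟩
  | succ k ih =>
    set c : ℤ := round (inner ℝ (gs b k) x / rr b k ^ 2) with hc
    obtain ⟨y, hy, h⟩ := ih (fun l hl => hr l (by omega)) (x - c • b k)
    have hyR : y ∈ spn b k := by
      have : Submodule.span ℤ (b '' Set.Iio k) ≤ (spn b k).restrictScalars ℤ := by
        rw [Submodule.span_le]; exact Submodule.subset_span
      exact this hy
    refine ⟨c • b k + y, add_mem (Submodule.smul_mem _ _ (Submodule.subset_span ⟨k, by simp, rfl⟩))
      (Submodule.span_mono (Set.image_mono (Set.Iio_subset_Iio (by omega))) hy), fun l hl => ?_⟩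
    rcases Nat.lt_succ_iff_lt_or_eq.1 hl with h1 | rfl
    · rw [← sub_sub]; exact h l h1
    · rw [← sub_sub, inner_sub_right, inner_gs_spn b hyR le_rfl, inner_sub_right,
        ← Int.cast_smul_eq_zsmul ℝ, inner_smul_right, inner_gs_self, sub_zero]
      have h0 := hr l (by omega)
      have h1 := abs_sub_round (inner ℝ (gs b l) x / rr b l ^ 2)
      rw [← hc] at h1
      have : inner ℝ (gs b l) x - c * rr b l ^ 2 = (inner ℝ (gs b l) x / rr b l ^ 2 - c) * rr b l ^ 2 := by
        field_simp
      rw [this, abs_mul, abs_of_nonneg (sq_nonneg (rr b l))]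
      exact mul_le_mul_of_nonneg_right h1 (sq_nonneg _)

lemma spn_eq_of {b b' : ℕ → E} (k : ℕ) (h : ∀ j < k, b' j - b j ∈ spn b j) : spn b' k = spn b k := by
  induction k with
  | zero => simp [spn]
  | succ k ih =>
    have ih := ih (fun j hj => h j (by omega))
    have key : ∀ c : ℕ → E, spn c (k+1) = spn c k ⊔ Submodule.span ℝ {c k} := by
      intro c
      rw [spn, spn, ← Submodule.span_union]
      congr 1
      have : Set.Iio (k+1) = Set.Iio k ∪ {k} := by
        ext j; simp only [Set.mem_Iio, Set.mem_union, Set.mem_singleton_iff]; omega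
      rw [this, Set.image_union, Set.image_singleton]
    have hk := h k (by omega)
    rw [key, key, ih]
    apply le_antisymm
    · refine sup_le le_sup_left ?_
      rw [Submodule.span_singleton_le_iff_mem]
      have : b' k = (b' k - b k) + b k := by abel
      rw [this]
      exact Submodule.add_mem_sup hk (Submodule.mem_span_singleton_self _)
    · refine sup_le le_sup_left ?_
      rw [Submodule.span_singleton_le_iff_mem]
      have : b k = -(b' k - b k) + b' k := by abel
      rw [this]
      exact Submodule.add_mem_sup (neg_mem hk) (Submodule.mem_span_singleton_self _)

lemma gs_unique (b : ℕ → E) (k : ℕ) (x : E) (hx : b k - x ∈ spn b k)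
    (ho : ∀ y ∈ spn b k, inner ℝ x y = 0) : gs b k = x := by
  have h1 := sub_gs_mem b k
  have h2 : gs b k - x ∈ spn b k := by
    have := sub_mem hx h1
    simpa using this
  have h3 : inner ℝ (gs b k - x) (gs b k - x) = (0:ℝ) := by
    rw [inner_sub_left, inner_gs_spn b h2 le_rfl, ho _ h2, sub_zero]
  rw [inner_self_eq_zero, sub_eq_zero] at h3
  exact h3

lemma gs_eq_of {b b' : ℕ → E} (k : ℕ) (h : ∀ j ≤ k, b' j - b j ∈ spn b j) : gs b' k = gs b k := by
  have hs := spn_eq_of k (fun j hj => h j (by omega))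
  apply gs_unique
  · rw [hs]
    have : b' k - gs b k = (b' k - b k) + (b k - gs b k) := by abel
    rw [this]
    exact add_mem (h k le_rfl) (sub_gs_mem b k)
  · rw [hs]; intro y hy; exact inner_gs_spn b hy le_rfl

/-- reduced bases -/
structure IsRed (d : ℕ) (b : ℕ → E) : Prop where
  pos : ∀ k < d, 0 < rr b k
  size : ∀ k < d, ∀ l < k, |inner ℝ (gs b l) (b k)| ≤ 1/2 * rr b l ^ 2
  ratio : ∀ k, k + 1 < d → rr b k ≤ 2 * rr b (k+1)

theorem exists_red {d : ℕ} {b : ℕ → E} (hb : LinearIndependent ℝ (fun k : Fin d => b k)) :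
    ∃ b' : ℕ → E, lat d b = lat d b' ∧ IsRed d b' := by
  obtain ⟨b1, h1, h2⟩ := greedy hb d le_rfl
  have hb1 := lat_li h1 hb
  choose y hy hy2 using fun k : Fin d => size_red (b := b1) k.1
    (fun l hl => rr_ne_zero hb1 (hl.trans k.2)) (b1 k)
  let b2 : ℕ → E := fun k => if h : k < d then b1 k - y ⟨k, h⟩ else b1 k
  have e2 : ∀ k (h : k < d), b2 k = b1 k - y ⟨k, h⟩ := fun k h => by simp [b2, h]
  have hyR : ∀ k : Fin d, y k ∈ spn b1 k := by
    intro k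
    have : Submodule.span ℤ (b1 '' Set.Iio k.1) ≤ (spn b1 k).restrictScalars ℤ := by
      rw [Submodule.span_le]; exact Submodule.subset_span
    exact this (hy k)
  have hsub : ∀ k < d, b2 k - b1 k ∈ spn b1 k := by
    intro k hk
    rw [e2 k hk, sub_sub_cancel_left]
    exact (spn b1 k).neg_mem (hyR ⟨k, hk⟩)
  have hgs : ∀ k < d, gs b2 k = gs b1 k := fun k hk => gs_eq_of k (fun j hj => hsub j (by omega))
  have hrr : ∀ k < d, rr b2 k = rr b1 k := fun k hk => by rw [rr, rr, hgs k hk]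
  have hl : lat d b1 = lat d b2 := by
    apply lat_eq_of
    · intro k
      induction k using Nat.strong_induction_on with
      | _ k ih =>
        intro hk
        have : b1 k = b2 k + y ⟨k, hk⟩ := by rw [e2 k hk]; abel
        rw [this]
        refine add_mem (mem_lat_of_lt _ hk) ?_
        have h3 : Submodule.span ℤ (b1 '' Set.Iio k) ≤ lat d b2 := by
          rw [Submodule.span_le]; rintro _ ⟨j, hj, rfl⟩; exact ih j hj (lt_trans hj hk)
        exact h3 (hy ⟨k, hk⟩)
    · intro k hk
      rw [e2 k hk]
      refine sub_mem (mem_lat_of_lt _ hk) ?_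
      have h3 : Submodule.span ℤ (b1 '' Set.Iio k) ≤ lat d b1 := by
          rw [Submodule.span_le]; rintro _ ⟨j, hj, rfl⟩; exact mem_lat_of_lt _ (lt_trans hj hk)
      exact h3 (hy ⟨k, hk⟩)
  refine ⟨b2, h1.trans hl, ?_, ?_, ?_⟩
  · intro k hk; rw [hrr k hk]; exact rr_pos hb1 hk
  · intro k hk l hlk
    rw [hrr l (by omega), hgs l (by omega), e2 k hk]
    exact hy2 ⟨k, hk⟩ l hlk
  · intro k hk
    rw [hrr k (by omega), hrr (k+1) hk]
    exact greedy_ratio hb1 hk (h2 k (by omega))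

end Red
end KM

open MeasureTheory
open scoped ENNReal
set_option linter.unusedSectionVars false
namespace KM
open InnerProductSpace

section Cons
variable {E : Type*} [NormedAddCommGroup E] [InnerProductSpace ℝ E]

lemma IsRed.mono {d : ℕ} {b : ℕ → E} (h : IsRed d b) {l k : ℕ} (hlk : l ≤ k) (hk : k < d) :
    rr b l ≤ 2 ^ d * rr b k := by
  have key : ∀ s, l + s < d → rr b l ≤ 2 ^ s * rr b (l + s) := by
    intro s
    induction s with
    | zero => intro _; simp
    | succ s ih =>
      intro hs
      have h1 := ih (by omega)
      have h2 := h.ratio (l+s) (by omega)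
      have h3 : (0:ℝ) < 2 ^ s := by positivity
      rw [pow_succ, ← add_assoc]
      nlinarith
  have h1 := key (k - l) (by omega)
  rw [Nat.add_sub_cancel' hlk] at h1
  refine h1.trans ?_
  apply mul_le_mul_of_nonneg_right _ (rr_nonneg _ _)
  exact pow_le_pow_right₀ (by norm_num) (by omega)

lemma IsRed.norm_le {d : ℕ} {b : ℕ → E} (h : IsRed d b) {k : ℕ} (hk : k < d) :
    ‖b k‖ ≤ (1 + d * 2 ^ d) * rr b k := by
  rw [gs_eq b k]
  have h1 : ∀ j ∈ Finset.range k, ‖(inner ℝ (gs b j) (b k) / rr b j ^ 2) • gs b j‖ ≤ 2 ^ d * rr b k := by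
    intro j hj
    have hj := Finset.mem_range.1 hj
    have hp := h.pos j (by omega)
    have hs := h.size k hk j hj
    have hm := h.mono hj.le hk
    rw [norm_smul, Real.norm_eq_abs, abs_div, abs_of_nonneg (sq_nonneg (rr b j))]
    have : |inner ℝ (gs b j) (b k)| / rr b j ^ 2 ≤ 1/2 := by
      rw [div_le_iff₀ (by positivity)]; exact hs
    change _ * rr b j ≤ _
    nlinarith
  have h2 := norm_sum_le_of_le _ h1
  simp only [Finset.sum_const, Finset.card_range, nsmul_eq_mul] at h2
  have h3 := norm_add_le (gs b k) (∑ j ∈ Finset.range k, (inner ℝ (gs b j) (b k) / rr b j ^ 2) • gs b j)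
  have h4 : (k:ℝ) * (2 ^ d * rr b k) ≤ d * (2 ^ d * rr b k) := by
    apply mul_le_mul_of_nonneg_right
    · exact_mod_cast hk.le
    · have := h.pos k hk; positivity
  change _ ≤ rr b k + _ at h3
  linarith

lemma finrank_spn_le (b : ℕ → E) (k : ℕ) : Module.finrank ℝ (spn b k) ≤ k := by
  classical
  have : spn b k = Submodule.span ℝ ((Finset.range k).image b : Set E) := by
    rw [spn]; congr 1; ext; simp
  rw [this]
  exact (finrank_span_finset_le_card _).trans (Finset.card_image_le.trans (by simp))

instance (b : ℕ → E) (k : ℕ) : FiniteDimensional ℝ (spn b k) :=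
  FiniteDimensional.span_of_finite ℝ ((Set.finite_Iio k).image b)

/-- among `s+1` independent lattice vectors some has large norm. -/
lemma exists_large {d : ℕ} (b : ℕ → E) (s : ℕ) (v : Fin (s+1) → E) (hv : ∀ a, v a ∈ lat d b)
    (hi : LinearIndependent ℝ v) : ∃ a, ∃ J, s ≤ J ∧ J < d ∧ rr b J ≤ ‖v a‖ := by
  by_contra hcon
  push Not at hcon
  have : ∀ a, v a ∈ spn b s := by
    intro a
    obtain ⟨z, hz⟩ := mem_lat.1 (hv a)
    by_cases h0 : z = 0
    · rw [← hz, h0]; simp [lc]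
    obtain ⟨J, h1, h2⟩ := exists_top z h0
    have h3 := rr_le_lc b z J h1 h2
    rw [hz] at h3
    by_cases hJ : s ≤ J
    · exact absurd h3 (not_le.2 (hcon a J hJ J.2))
    rw [← hz, lc]
    apply Submodule.sum_mem
    intro j _
    by_cases hj : J < j
    · rw [h2 j hj]; simp
    · rw [← Int.cast_smul_eq_zsmul ℝ]
      apply Submodule.smul_mem
      apply Submodule.subset_span
      exact ⟨j, lt_of_le_of_lt (Fin.le_def.1 (not_lt.1 hj)) (not_le.1 hJ), rfl⟩
  have h1 : LinearIndependent ℝ (fun a => (⟨v a, this a⟩ : spn b s)) :=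
    LinearIndependent.of_comp (spn b s).subtype hi
  have h2 := h1.fintype_card_le_finrank
  have h3 := finrank_spn_le b s
  simp at h2
  omega

lemma IsRed.short {d : ℕ} {b : ℕ → E} (h : IsRed d b) {i : ℕ} (v : Fin i → E)
    (hv : ∀ a, v a ∈ lat d b) (hi : LinearIndependent ℝ v) {ρ : ℝ} (hρ : ∀ a, ‖v a‖ ≤ ρ)
    {k : ℕ} (hk : k < i) : rr b k ≤ 2 ^ d * ρ := by
  obtain ⟨s, rfl⟩ : ∃ s, i = s + 1 := ⟨i - 1, by omega⟩
  obtain ⟨a, J, h1, h2, h3⟩ := exists_large b s v hv hi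
  calc rr b k ≤ 2 ^ d * rr b J := h.mono (by omega) h2
    _ ≤ _ := by gcongr; exact h3.trans (hρ a)

lemma li_of_rr {d : ℕ} {b : ℕ → E} (h : ∀ k < d, 0 < rr b k) :
    LinearIndependent ℝ (fun k : Fin d => b k) := by
  rw [Fintype.linearIndependent_iff]
  intro g hg
  by_contra hcon
  push Not at hcon
  obtain ⟨k0, hk0⟩ := hcon
  obtain ⟨k, hk, hm⟩ := (Finset.univ.filter (fun k => g k ≠ 0)).exists_maximal ⟨k0, by simpa using hk0⟩
  have hk : g k ≠ 0 := by simpa using hk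
  have h1 : inner ℝ (gs b k) (∑ i : Fin d, g i • b i) = g k * rr b k ^ 2 := by
    rw [inner_sum, Finset.sum_eq_single k]
    · rw [inner_smul_right, inner_gs_self]
    · intro j _ hj
      rw [inner_smul_right]
      rcases lt_or_gt_of_ne hj with h2 | h2
      · rw [inner_gs_lt b (Fin.lt_def.1 h2), mul_zero]
      · have : g j = 0 := by
          by_contra h3
          exact absurd (hm (by simpa using h3) h2.le) (not_le.2 h2)
        rw [this, zero_mul]
    · simp
  rw [hg, inner_zero_right] at h1
  have := h k k.2
  have h2 : g k * rr b k ^ 2 ≠ 0 := by positivity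
  exact h2 h1.symm

/-- counting lemma -/
lemma card_le {d : ℕ} {b : ℕ → E} (h : ∀ k < d, 0 < rr b k) {ρ : ℝ} (hρ : 0 ≤ ρ)
    (S : Finset (Fin d → ℤ)) (hS : ∀ z ∈ S, ‖lc d b z‖ ≤ ρ) :
    (S.card : ℝ) ≤ ∏ k : Fin d, (1 + 2 * ρ / rr b k) := by
  let s : (Fin d → ℤ) → Fin d → ℝ := fun z k =>
    (∑ j ∈ Finset.univ.filter (fun j => k < j), z j * inner ℝ (gs b k) (b j)) / rr b k ^ 2
  let y : Fin d → ℝ := fun k => ρ / rr b k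
  let φ : (Fin d → ℤ) → Fin d → ℤ := fun z k => z k - ⌈- s z k - y k⌉
  have hφ : ∀ z ∈ S, ∀ k, 0 ≤ φ z k ∧ φ z k ≤ ⌊2 * y k⌋ := by
    intro z hz k
    have hp := h k k.2
    have h1 := inner_gs_lc b z k
    have h2 : inner ℝ (gs b k) (lc d b z) = (z k + s z k) * rr b k ^ 2 := by
      rw [h1]; simp only [s]; field_simp
    have h3 := mul_rr_le b k _ _ h2
    have h4 : |z k + s z k| ≤ y k := by
      simp only [y]; rw [le_div_iff₀ hp]; exact h3.trans (hS z hz)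
    rw [abs_le] at h4
    constructor
    · simp only [φ, sub_nonneg]
      rw [Int.ceil_le]; linarith
    · rw [Int.le_floor]
      simp only [φ]; push_cast
      have := Int.le_ceil (- s z k - y k)
      linarith
  let T : Finset (Fin d → ℤ) := Fintype.piFinset fun k => Finset.Icc 0 ⌊2 * y k⌋
  have hcard : S.card ≤ T.card := by
    apply Finset.card_le_card_of_injOn φ
    · intro z hz
      simp only [T, Finset.mem_coe, Fintype.mem_piFinset, Finset.mem_Icc]
      exact hφ z hz
    · intro z hz w hw hzw
      have key : ∀ t : ℕ, ∀ k : Fin d, d - k.1 ≤ t → z k = w k := by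
        intro t
        induction t with
        | zero => intro k hk; omega
        | succ t ih =>
          intro k hk
          have e : s z k = s w k := by
            simp only [s]; congr 1
            apply Finset.sum_congr rfl
            intro j hj
            have hj : k < j := by simpa using hj
            rw [ih j (by have := Fin.lt_def.1 hj; omega)]
          have := congrFun hzw k
          simp only [φ, e] at this
          omega
      funext k
      exact key d k (by omega)
  have hT : (T.card : ℝ) ≤ ∏ k : Fin d, (1 + 2 * ρ / rr b k) := by
    simp only [T, Fintype.card_piFinset]
    push_cast
    apply Finset.prod_le_prod
    · intros; positivity
    · intro k _
      have hy : 0 ≤ 2 * y k := by have := h k k.2; positivity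
      rw [Int.card_Icc]
      have h0 : 0 ≤ ⌊2 * y k⌋ := Int.floor_nonneg.2 hy
      have h1 : (((⌊2 * y k⌋ + 1 - 0).toNat : ℕ) : ℝ) = ⌊2 * y k⌋ + 1 := by
        have : (((⌊2 * y k⌋ + 1 - 0).toNat : ℕ) : ℤ) = ⌊2 * y k⌋ + 1 := by
          rw [Int.toNat_of_nonneg (by omega)]; ring
        exact_mod_cast this
      rw [h1]
      have := Int.floor_le (2 * y k)
      have e : 2 * ρ / rr b k = 2 * y k := by simp only [y]; ring
      rw [e]; linarith
  exact le_trans (by exact_mod_cast hcard) hT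

/-- perturbation: a linear map with norm bound changes the GS norms by a bounded factor -/
lemma rr_map_le (T : E →ₗ[ℝ] E) {C : ℝ} (hT : ∀ v, ‖T v‖ ≤ C * ‖v‖) (b : ℕ → E) (k : ℕ) :
    rr (fun j => T (b j)) k ≤ C * rr b k := by
  have h1 : T (b k - gs b k) ∈ spn (fun j => T (b j)) k := by
    have h2 := Submodule.mem_map_of_mem (f := T) (sub_gs_mem b k)
    rw [spn, Submodule.map_span, ← Set.image_comp] at h2
    exact h2
  have h2 := rr_le _ k h1
  simp only [map_sub, sub_sub_cancel] at h2
  exact h2.trans (hT _)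

end Cons
end KM

open MeasureTheory
open scoped ENNReal
set_option linter.unusedSectionVars false
namespace KM
open InnerProductSpace

section Det
variable {E : Type*} [NormedAddCommGroup E] [InnerProductSpace ℝ E]

lemma det_gram (d : ℕ) (b : ℕ → E) :
    (Matrix.of fun k l : Fin d => inner ℝ (b k) (b l)).det = PP b d ^ 2 := by
  let μ : Matrix (Fin d) (Fin d) ℝ := Matrix.of fun j k =>
    if j = k then 1 else if j < k then inner ℝ (gs b j) (b k) / rr b j ^ 2 else 0
  have hb : ∀ k : Fin d, b k = ∑ j : Fin d, μ j k • gs b j := by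
    intro k
    conv_lhs => rw [gs_eq b k]
    rw [← Finset.add_sum_erase _ _ (Finset.mem_univ k)]
    congr 1
    · simp [μ]
    · have : ∑ j ∈ Finset.univ.erase k, μ j k • gs b j
        = ∑ j ∈ Finset.univ.filter (fun j => j < k), μ j k • gs b j := by
        symm
        apply Finset.sum_subset
        · intro j hj; simp at hj ⊢; exact hj.ne
        · intro j hj hj2
          have h1 : j ≠ k := by simpa using hj
          have h2 : ¬ j < k := by simpa using hj2
          simp only [μ, Matrix.of_apply, if_neg h1, if_neg h2, zero_smul]
      rw [this]
      symm
      apply Finset.sum_bij (fun j _ => j.1)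
      · intro j hj; simpa using hj
      · intro j _ j' _ h; exact Fin.ext h
      · intro j hj
        have hj := Finset.mem_range.1 hj
        exact ⟨⟨j, hj.trans k.2⟩, by simp only [Finset.mem_filter, Finset.mem_univ, true_and]; exact hj, rfl⟩
      · intro j hj
        have hj : j < k := by simpa using hj
        simp only [μ, Matrix.of_apply, if_neg hj.ne, if_pos hj]
  have hG : (Matrix.of fun k l : Fin d => inner ℝ (b k) (b l)) =
      μ.transpose * Matrix.diagonal (fun j : Fin d => rr b j ^ 2) * μ := by
    ext k l
    rw [Matrix.of_apply, hb k, hb l, Matrix.mul_apply, sum_inner]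
    apply Finset.sum_congr rfl
    intro j _
    rw [Matrix.mul_diagonal, inner_sum, Finset.sum_eq_single j]
    · rw [inner_smul_left, inner_smul_right, real_inner_self_eq_norm_sq, Matrix.transpose_apply]
      simp [rr]; ring
    · intro j' _ hj'
      rw [inner_smul_left, inner_smul_right, gs_orth b (by simpa [Fin.ext_iff] using Ne.symm hj')]; simp
    · simp
  have hμ : μ.det = 1 := by
    rw [Matrix.det_of_isUpperTriangular]
    · simp [μ]
    · intro i j hij
      have hij : j < i := hij
      simp [μ, hij.ne', hij.le]
  rw [hG, Matrix.det_mul, Matrix.det_mul, Matrix.det_transpose, hμ, Matrix.det_diagonal, PP,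
    ← Fin.prod_univ_eq_prod_range, ← Finset.prod_pow]
  ring

end Det
end KM

open MeasureTheory
open scoped ENNReal
set_option linter.unusedSectionVars false
namespace KM
open InnerProductSpace

lemma dyadic {X : Type*} [MeasurableSpace X] (μ : Measure X) {S : Set X} (hS : MeasurableSet S)
    {f : X → ℝ} (hf : Measurable f) (hpos : ∀ x ∈ S, 0 < f x) {a : ℝ} (ha : 0 < a)
    (hle : ∀ x ∈ S, f x ≤ a) (q : ℕ) {K : ℝ} (hK : 0 ≤ K)
    (hM : ∀ t : ℕ, μ (S ∩ {x | f x ≤ a * 2⁻¹ ^ t}) ≤ ENNReal.ofReal (K * (2⁻¹ ^ t) ^ (q+1))) :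
    ∫⁻ x in S, ENNReal.ofReal ((f x)⁻¹ ^ q) ∂μ ≤ ENNReal.ofReal (2 ^ (q+1) * K * a⁻¹ ^ q) := by
  let A : ℕ → Set X := fun t => S ∩ {x | f x ≤ a * 2⁻¹ ^ t}
  have hA : ∀ t, MeasurableSet (A t) := fun t => hS.inter (hf measurableSet_Iic)
  let w : ℕ → ℝ≥0∞ := fun t => ENNReal.ofReal ((a * 2⁻¹ ^ (t+1))⁻¹ ^ q)
  rw [← lintegral_indicator hS]
  have h1 : ∀ x, S.indicator (fun x => ENNReal.ofReal ((f x)⁻¹ ^ q)) x ≤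
      ∑' t, (A t).indicator (fun _ => w t) x := by
    intro x
    by_cases hx : x ∈ S
    · rw [Set.indicator_of_mem hx]
      have hfx := hpos x hx
      obtain ⟨t, ht⟩ := exists_nat_pow_near_of_lt_one (x := f x / a) (y := (2⁻¹:ℝ)) (by positivity)
        (by rw [div_le_one ha]; exact hle x hx) (by norm_num) (by norm_num)
      have h2 : x ∈ A t := ⟨hx, by
        have := ht.2; rw [div_le_iff₀ ha] at this; simp only [Set.mem_setOf_eq]; linarith⟩
      refine le_trans ?_ (ENNReal.le_tsum t)
      rw [Set.indicator_of_mem h2]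
      apply ENNReal.ofReal_le_ofReal
      apply pow_le_pow_left₀ (by positivity)
      have h3 := ht.1
      rw [lt_div_iff₀ ha] at h3
      apply inv_anti₀ (by positivity)
      linarith
    · rw [Set.indicator_of_notMem hx]; exact zero_le
  refine (lintegral_mono h1).trans ?_
  rw [lintegral_tsum (fun t => (measurable_const.indicator (hA t)).aemeasurable)]
  have h2 : ∀ t, ∫⁻ x, (A t).indicator (fun _ => w t) x ∂μ ≤
      ENNReal.ofReal (2 ^ q * K * a⁻¹ ^ q * (1/2) ^ t) := by
    intro t
    rw [lintegral_indicator_const (hA t)]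
    refine (mul_le_mul_right (hM t) _).trans ?_
    rw [← ENNReal.ofReal_mul (by positivity)]
    apply ENNReal.ofReal_le_ofReal
    apply le_of_eq
    have : (2:ℝ)⁻¹ ^ t ≠ 0 := by positivity
    have h5 : ((2:ℝ)⁻¹ ^ t)⁻¹ ^ q * (2⁻¹ ^ t) ^ q = 1 := by
      rw [← mul_pow, inv_mul_cancel₀ this, one_pow]
    rw [mul_inv, mul_pow, pow_succ (2⁻¹:ℝ) t, mul_inv, mul_pow, inv_inv, pow_succ _ q, one_div]
    linear_combination (a⁻¹ ^ q * 2 ^ q * K * (2:ℝ)⁻¹ ^ t) * h5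
  refine (ENNReal.tsum_le_tsum h2).trans ?_
  rw [← ENNReal.ofReal_tsum_of_nonneg (by intro t; positivity)
    (summable_geometric_two.mul_left _)]
  apply ENNReal.ofReal_le_ofReal
  rw [tsum_mul_left, tsum_geometric_two]
  apply le_of_eq; ring

section Vol
variable {E : Type*} [NormedAddCommGroup E] [InnerProductSpace ℝ E] [FiniteDimensional ℝ E]
  [MeasurableSpace E] [BorelSpace E]

lemma measurable_gs {X : Type*} [MeasurableSpace X] {β : X → ℕ → E} (hβ : ∀ j, Measurable fun x => β x j)
    (k : ℕ) : Measurable fun x => gs (β x) k := by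
  haveI : SecondCountableTopology E := by
    haveI := FiniteDimensional.proper_real E
    infer_instance
  induction k using Nat.strong_induction_on with
  | _ k ih =>
    simp only [gs_eq' _ k]
    refine (hβ k).sub (Finset.measurable_sum _ fun j hj => ?_)
    have h1 := ih j (Finset.mem_range.1 hj)
    exact ((h1.inner (hβ k)).div (h1.norm.pow_const 2)).smul h1

lemma measurable_rr {X : Type*} [MeasurableSpace X] {β : X → ℕ → E} (hβ : ∀ j, Measurable fun x => β x j)
    (k : ℕ) : Measurable fun x => rr (β x) k := (measurable_gs hβ k).norm

lemma measurable_PP {X : Type*} [MeasurableSpace X] {β : X → ℕ → E} (hβ : ∀ j, Measurable fun x => β x j)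
    (k : ℕ) : Measurable fun x => PP (β x) k :=
  Finset.measurable_prod _ fun j _ => measurable_rr hβ j

lemma slice (d : ℕ) (hd : Module.finrank ℝ E = d) (b : ℕ → E) (k : ℕ) (hk : k ≤ d)
    (hr : ∀ l < k, 0 < rr b l) {ρ : ℝ} (hρ : 0 ≤ ρ) :
    (volume : Measure E) {x | (∀ l < k, |inner ℝ (gs b l) x| ≤ 1/2 * rr b l ^ 2) ∧
      ‖x - ∑ l ∈ Finset.range k, (inner ℝ (gs b l) x / rr b l ^ 2) • gs b l‖ ≤ ρ}
    ≤ ENNReal.ofReal (PP b k * (2 * ρ) ^ (d - k)) := by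
  classical
  let v : Fin d → E := fun l => (rr b l)⁻¹ • gs b l
  let s : Set (Fin d) := {l | l.1 < k}
  have hv : Orthonormal ℝ (s.domRestrict v) := by
    constructor
    · rintro ⟨l, hl⟩
      have := hr l hl
      simp only [Set.domRestrict_apply, v, norm_smul, norm_inv, Real.norm_eq_abs, abs_of_pos this]
      exact inv_mul_cancel₀ this.ne'
    · rintro ⟨l, hl⟩ ⟨l', hl'⟩ hne
      simp only [Set.domRestrict_apply, v, inner_smul_left, inner_smul_right]
      rw [gs_orth b]
      · simp
      · intro h; apply hne; ext; exact h
  obtain ⟨o, ho⟩ := hv.exists_orthonormalBasis_extension_of_card_eq (by simpa using hd)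
  let I : Fin d → Set ℝ := fun l => if l.1 < k then Set.Icc (-(1/2 * rr b l)) (1/2 * rr b l)
    else Set.Icc (-ρ) ρ
  have hm : MeasurePreserving (fun x => (WithLp.ofLp (o.repr x) : Fin d → ℝ)) volume volume :=
    (PiLp.volume_preserving_ofLp (Fin d)).comp o.measurePreserving_repr
  have hsub : {x | (∀ l < k, |inner ℝ (gs b l) x| ≤ 1/2 * rr b l ^ 2) ∧
      ‖x - ∑ l ∈ Finset.range k, (inner ℝ (gs b l) x / rr b l ^ 2) • gs b l‖ ≤ ρ} ⊆
      (fun x => (WithLp.ofLp (o.repr x) : Fin d → ℝ)) ⁻¹' (Set.pi Set.univ I) := by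
    rintro x ⟨h1, h2⟩ l -
    simp only [I]
    rw [o.repr_apply_apply]
    by_cases hl : l.1 < k
    · rw [if_pos hl, ho l hl]
      have := hr l hl
      simp only [v, inner_smul_left]
      have h3 := h1 l hl
      rw [Set.mem_Icc, ← abs_le, abs_mul]
      simp only [map_inv₀, abs_inv]
      simp only [conj_trivial]
      rw [abs_of_pos this, inv_mul_le_iff₀ this]
      linarith
    · rw [if_neg hl, Set.mem_Icc, ← abs_le]
      refine le_trans ?_ h2
      have h3 : inner ℝ (o l) x = inner ℝ (o l)
          (x - ∑ l ∈ Finset.range k, (inner ℝ (gs b l) x / rr b l ^ 2) • gs b l) := by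
        rw [inner_sub_right, inner_sum, Finset.sum_eq_zero, sub_zero]
        intro j hj
        have hj := Finset.mem_range.1 hj
        have h4 : gs b j = rr b j • o ⟨j, by omega⟩ := by
          rw [ho ⟨j, by omega⟩ hj]
          simp only [v]
          rw [smul_smul, mul_inv_cancel₀ (hr j hj).ne', one_smul]
        rw [inner_smul_right, h4, inner_smul_right, o.inner_eq_zero]
        · simp
        · intro h5; apply hl; rw [h5]; exact hj
      rw [h3]
      have := abs_real_inner_le_norm (o l) (x - ∑ l ∈ Finset.range k, (inner ℝ (gs b l) x / rr b l ^ 2) • gs b l)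
      simpa using this
  refine (measure_mono hsub).trans ?_
  have hI : MeasurableSet (Set.pi Set.univ I) := by
    apply MeasurableSet.univ_pi
    intro l; simp only [I]; split_ifs <;> exact measurableSet_Icc
  rw [hm.measure_preimage hI.nullMeasurableSet, volume_pi_pi]
  have hI2 : ∀ l, volume (I l) = ENNReal.ofReal (if l.1 < k then rr b l else 2 * ρ) := by
    intro l; simp only [I]; split_ifs <;> rw [Real.volume_Icc] <;> congr 1 <;> ring
  simp only [hI2]
  rw [← ENNReal.ofReal_prod_of_nonneg]
  · apply ENNReal.ofReal_le_ofReal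
    apply le_of_eq
    rw [Fin.prod_univ_eq_prod_range (fun l => if l < k then rr b l else 2 * ρ) d]
    obtain ⟨e, rfl⟩ := Nat.exists_eq_add_of_le hk
    rw [Finset.prod_range_add, PP]
    congr 1
    · apply Finset.prod_congr rfl; intro l hl; rw [if_pos (Finset.mem_range.1 hl)]
    · simp
  · intro l _; split_ifs
    · exact rr_nonneg _ _
    · positivity

end Vol
end KM

open MeasureTheory
open scoped ENNReal
set_option linter.unusedSectionVars false
namespace KM
open InnerProductSpace

section Vol
variable {E : Type*} [NormedAddCommGroup E] [InnerProductSpace ℝ E] 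

/-- extension by zero -/
def ext0 {k : ℕ} (b : Fin k → E) : ℕ → E := fun j => if h : j < k then b ⟨j, h⟩ else 0

lemma ext0_lt {k : ℕ} (b : Fin k → E) {j : ℕ} (h : j < k) : ext0 b j = b ⟨j, h⟩ := by simp [ext0, h]
@[simp] lemma ext0_fin {k : ℕ} (b : Fin k → E) (j : Fin k) : ext0 b j = b j := by simp [ext0]

/-- size reduced with bounded partial products -/
def SS (u : ℕ → ℝ) (k : ℕ) : Set (Fin k → E) :=
  {b | (∀ κ < k, 0 < rr (ext0 b) κ) ∧
    (∀ κ < k, ∀ l < κ, |inner ℝ (gs (ext0 b) l) (ext0 b κ)| ≤ 1/2 * rr (ext0 b) l ^ 2) ∧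
    (∀ κ, 1 ≤ κ → κ ≤ k → PP (ext0 b) κ ≤ u κ)}

variable [FiniteDimensional ℝ E] [MeasurableSpace E] [BorelSpace E]

lemma measurable_ext0 {k : ℕ} (j : ℕ) : Measurable fun b : Fin k → E => ext0 b j := by
  unfold ext0; split_ifs
  · exact measurable_pi_apply _
  · exact measurable_const

lemma measurableSet_SS (u : ℕ → ℝ) (k : ℕ) : MeasurableSet (SS u k : Set (Fin k → E)) := by
  have : SecondCountableTopology E := by
    have := FiniteDimensional.proper_real E
    infer_instance
  unfold SS
  simp only [Set.ofPred_and, Set.ofPred_forall]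
  refine MeasurableSet.inter ?_ (MeasurableSet.inter ?_ ?_)
  · refine MeasurableSet.iInter fun κ => MeasurableSet.iInter fun _ => ?_
    exact measurableSet_lt measurable_const (measurable_rr measurable_ext0 κ)
  · refine MeasurableSet.iInter fun κ => MeasurableSet.iInter fun _ =>
      MeasurableSet.iInter fun l => MeasurableSet.iInter fun _ => ?_
    refine measurableSet_le ?_ ?_
    · exact ((measurable_gs measurable_ext0 l).inner (measurable_ext0 κ)).abs
    · exact measurable_const.mul ((measurable_rr measurable_ext0 l).pow_const 2)
  · refine MeasurableSet.iInter fun κ => MeasurableSet.iInter fun _ => MeasurableSet.iInter fun _ => ?_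
    exact measurableSet_le (measurable_PP measurable_ext0 κ) measurable_const

/-- snoc through the measurable equiv -/
noncomputable def sn (k : ℕ) (p : E × (Fin k → E)) : Fin (k+1) → E :=
  (MeasurableEquiv.piFinSuccAbove (fun _ : Fin (k+1) => E) (Fin.last k)).symm p

lemma sn_last {k : ℕ} (p : E × (Fin k → E)) : ext0 (sn k p) k = p.1 := by
  rw [ext0_lt _ (Nat.lt_succ_self k)]
  have : (⟨k, Nat.lt_succ_self k⟩ : Fin (k+1)) = Fin.last k := rfl
  rw [this]
  simp [sn, MeasurableEquiv.piFinSuccAbove]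

lemma sn_lt {k : ℕ} (p : E × (Fin k → E)) {j : ℕ} (hj : j < k) : ext0 (sn k p) j = ext0 p.2 j := by
  rw [ext0_lt _ (Nat.lt_succ_of_lt hj), ext0_lt _ hj]
  have : (⟨j, Nat.lt_succ_of_lt hj⟩ : Fin (k+1)) = Fin.castSucc ⟨j, hj⟩ := rfl
  have h2 : sn k p = Fin.snoc (α := fun _ => E) p.2 p.1 := by
    simp [sn, MeasurableEquiv.piFinSuccAbove]
    rfl
  rw [this, h2, Fin.snoc_castSucc]

lemma sn_gs {k : ℕ} (p : E × (Fin k → E)) {j : ℕ} (hj : j < k) :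
    gs (ext0 (sn k p)) j = gs (ext0 p.2) j :=
  gs_congr j fun i hi => sn_lt p (by omega)

lemma sn_rr {k : ℕ} (p : E × (Fin k → E)) {j : ℕ} (hj : j < k) :
    rr (ext0 (sn k p)) j = rr (ext0 p.2) j := by rw [rr, sn_gs p hj]; rfl

lemma sn_PP {k : ℕ} (p : E × (Fin k → E)) {j : ℕ} (hj : j ≤ k) :
    PP (ext0 (sn k p)) j = PP (ext0 p.2) j :=
  Finset.prod_congr rfl fun i hi => sn_rr p (by have := Finset.mem_range.1 hi; omega)

lemma sn_gs_last {k : ℕ} (p : E × (Fin k → E)) :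
    gs (ext0 (sn k p)) k = p.1 - ∑ l ∈ Finset.range k,
      (inner ℝ (gs (ext0 p.2) l) p.1 / rr (ext0 p.2) l ^ 2) • gs (ext0 p.2) l := by
  rw [gs_eq', sn_last]
  congr 1
  refine Finset.sum_congr rfl fun l hl => ?_
  have := Finset.mem_range.1 hl
  rw [sn_gs p this, sn_rr p this]

lemma measurable_sn (k : ℕ) : Measurable (sn k : E × (Fin k → E) → _) :=
  MeasurableEquiv.measurable _

lemma lintegral_sn {k : ℕ} (F : (Fin (k+1) → E) → ℝ≥0∞) (hF : Measurable F) :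
    ∫⁻ b, F b = ∫⁻ b : Fin k → E, ∫⁻ x : E, F (sn k (x, b)) := by
  have h := (volume_preserving_piFinSuccAbove (fun _ : Fin (k+1) => E) (Fin.last k)).symm
  rw [← h.lintegral_comp hF]
  rw [Measure.volume_eq_prod, lintegral_prod_symm']
  · rfl
  · exact hF.comp (measurable_sn k)

lemma PP_pos {b : ℕ → E} {k : ℕ} (h : ∀ l < k, 0 < rr b l) : 0 < PP b k :=
  Finset.prod_pos fun l hl => h l (Finset.mem_range.1 hl)

lemma sn_mem {u : ℕ → ℝ} {k : ℕ} {b : Fin k → E} {x : E} (h : sn k (x, b) ∈ SS u (k+1)) :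
    b ∈ SS u k ∧ (∀ l < k, |inner ℝ (gs (ext0 b) l) x| ≤ 1/2 * rr (ext0 b) l ^ 2) ∧
      0 < rr (ext0 (sn k (x, b))) k ∧ PP (ext0 b) k * rr (ext0 (sn k (x, b))) k ≤ u (k+1) := by
  obtain ⟨h1, h2, h3⟩ := h
  refine ⟨⟨?_, ?_, ?_⟩, ?_, h1 k (by omega), ?_⟩
  · intro κ hκ
    have := h1 κ (by omega)
    rwa [sn_rr _ hκ] at this
  · intro κ hκ l hl
    have := h2 κ (by omega) l hl
    rwa [sn_rr _ (by omega), sn_gs _ (by omega), sn_lt _ hκ] at this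
  · intro κ h4 h5
    have := h3 κ h4 (by omega)
    rwa [sn_PP _ h5] at this
  · intro l hl
    have := h2 k (by omega) l hl
    rwa [sn_rr _ (by omega), sn_gs _ (by omega), sn_last] at this
  · have := h3 (k+1) (by omega) le_rfl
    rwa [PP_succ, sn_PP _ le_rfl] at this

/-- the weighted fibre bound -/
lemma fibre (d : ℕ) (hd : Module.finrank ℝ E = d) (u : ℕ → ℝ) (hu : ∀ k, 0 < u k)
    (k q : ℕ) (hq : k + 2 + q = d) (b : Fin k → E) (hb : b ∈ SS u k) :
    ∫⁻ x : E, (SS u (k+1)).indicator (fun b' => ENNReal.ofReal ((PP (ext0 b') (k+1))⁻¹ ^ q)) (sn k (x, b))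
    ≤ ENNReal.ofReal (2 ^ (2 * q + 3) * u (k+1) ^ 2 * (PP (ext0 b) k)⁻¹ ^ (q+1)) := by
  have hP : 0 < PP (ext0 b) k := PP_pos hb.1
  set P := PP (ext0 b) k with hPdef
  set S : Set E := {x | sn k (x, b) ∈ SS u (k+1)} with hSdef
  have hsn : Measurable fun x : E => sn k (x, b) := (measurable_sn k).comp (measurable_id.prodMk measurable_const)
  have hS : MeasurableSet S := hsn (measurableSet_SS u (k+1))
  let f : E → ℝ := fun x => rr (ext0 (sn k (x, b))) k
  have hf : Measurable f := (measurable_rr measurable_ext0 k).comp hsn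
  have hρ : 0 < u (k+1) / P := div_pos (hu _) hP
  have key := dyadic (volume : Measure E) hS hf (fun x hx => (sn_mem hx).2.2.1) hρ
    (fun x hx => by rw [le_div_iff₀ hP, mul_comm]; exact (sn_mem hx).2.2.2) q
    (K := P * (2 * (u (k+1) / P)) ^ (q+2)) (by positivity) (fun t => by
      have h1 := slice d hd (ext0 b) k (by omega) hb.1 (ρ := u (k+1) / P * 2⁻¹ ^ t) (by positivity)
      refine le_trans (measure_mono ?_) (h1.trans ?_)
      · rintro x ⟨hx1, hx2⟩
        refine ⟨(sn_mem hx1).2.1, ?_⟩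
        have : f x ≤ u (k+1) / P * 2⁻¹ ^ t := hx2
        simp only [f, rr, sn_gs_last] at this
        exact this
      · apply ENNReal.ofReal_le_ofReal
        have e : d - k = q + 2 := by omega
        rw [e, ← mul_assoc, mul_pow _ _ (q+2), ← mul_assoc]
        apply mul_le_mul_of_nonneg_left _ (by positivity)
        apply pow_le_pow_of_le_one (by positivity) _ (by omega)
        exact pow_le_one₀ (by norm_num) (by norm_num))
  have e1 : ∀ x, (SS u (k+1)).indicator (fun b' => ENNReal.ofReal ((PP (ext0 b') (k+1))⁻¹ ^ q)) (sn k (x, b))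
      = ENNReal.ofReal (P⁻¹ ^ q) * S.indicator (fun x => ENNReal.ofReal ((f x)⁻¹ ^ q)) x := by
    intro x
    by_cases hx : x ∈ S
    · rw [Set.indicator_of_mem hx, Set.indicator_of_mem (show sn k (x,b) ∈ _ from hx), PP_succ,
        sn_PP _ le_rfl, ← ENNReal.ofReal_mul (by positivity), mul_inv, mul_pow]
    · rw [Set.indicator_of_notMem hx, Set.indicator_of_notMem (show sn k (x,b) ∉ _ from hx), mul_zero]
  simp only [e1]
  rw [lintegral_const_mul' _ _ ENNReal.ofReal_ne_top, lintegral_indicator hS]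
  refine (mul_le_mul_right key _).trans ?_
  rw [← ENNReal.ofReal_mul (by positivity)]
  apply ENNReal.ofReal_le_ofReal
  apply le_of_eq
  have hu' := hu (k+1)
  obtain ⟨v, hv0, hv⟩ : ∃ v, 0 < v ∧ u (k+1) / P = v := ⟨_, hρ, rfl⟩
  have huv : u (k+1) = v * P := by rw [← hv]; field_simp
  rw [hv, huv]
  have e2 : v ^ q * v⁻¹ ^ q = 1 := by rw [← mul_pow, mul_inv_cancel₀ hv0.ne', one_pow]
  have e3 : P * P⁻¹ = 1 := mul_inv_cancel₀ hP.ne'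
  rw [mul_pow 2 v, pow_add v q 2]
  linear_combination (P⁻¹ ^ q * 2 ^ (q+1) * P * 2 ^ (q+2) * v ^ 2) * e2
    - (2 ^ (2*q+3) * v ^ 2 * P * P⁻¹ ^ q) * e3

lemma SS_weighted (d : ℕ) (hd : Module.finrank ℝ E = d) (k : ℕ) (hk : k + 1 ≤ d) :
    ∃ C : ℝ, 0 < C ∧ ∀ u : ℕ → ℝ, (∀ k, 0 < u k) →
      ∫⁻ b in (SS u k : Set (Fin k → E)), ENNReal.ofReal ((PP (ext0 b) k)⁻¹ ^ (d - 1 - k))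
        ≤ ENNReal.ofReal (C * ∏ κ ∈ Finset.range k, u (κ+1) ^ 2) := by
  induction k with
  | zero =>
    refine ⟨1, one_pos, fun u hu => ?_⟩
    simp only [PP, Finset.range_zero, Finset.prod_empty, inv_one, one_pow, mul_one, ENNReal.ofReal_one]
    rw [setLIntegral_one]
    refine (measure_mono (Set.subset_univ _)).trans ?_
    have : (Set.univ : Set (Fin 0 → E)) = Set.pi Set.univ (fun _ => Set.univ) := by simp
    rw [this, volume_pi_pi]; simp
  | succ k ih =>
    obtain ⟨C, hC, h⟩ := ih (by omega)
    obtain ⟨q, hq⟩ : ∃ q, k + 2 + q = d := ⟨d - (k+2), by omega⟩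
    refine ⟨2 ^ (2*q+3) * C, by positivity, fun u hu => ?_⟩
    have h1 := h u hu
    have e1 : d - 1 - k = q + 1 := by omega
    have e2 : d - 1 - (k+1) = q := by omega
    rw [e1] at h1
    rw [e2, ← lintegral_indicator (measurableSet_SS u (k+1)), lintegral_sn]
    · have h2 : ∀ b : Fin k → E, ∫⁻ x : E, (SS u (k+1)).indicator
          (fun b' => ENNReal.ofReal ((PP (ext0 b') (k+1))⁻¹ ^ q)) (sn k (x, b)) ≤
          ENNReal.ofReal (2 ^ (2 * q + 3) * u (k+1) ^ 2) *
            (SS u k).indicator (fun b => ENNReal.ofReal ((PP (ext0 b) k)⁻¹ ^ (q+1))) b := by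
        intro b
        by_cases hb : b ∈ SS u k
        · rw [Set.indicator_of_mem hb, ← ENNReal.ofReal_mul (by have := hu (k+1); positivity)]
          exact fibre d hd u hu k q hq b hb
        · have : ∀ x, sn k (x,b) ∉ SS u (k+1) := fun x hx => hb (sn_mem hx).1
          simp [this]
      refine (lintegral_mono h2).trans ?_
      rw [lintegral_const_mul' _ _ ENNReal.ofReal_ne_top, lintegral_indicator (measurableSet_SS u k)]
      refine (mul_le_mul_right h1 _).trans ?_
      rw [← ENNReal.ofReal_mul (by have := hu (k+1); positivity)]
      apply ENNReal.ofReal_le_ofReal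
      rw [Finset.prod_range_succ]
      apply le_of_eq; ring
    · refine Measurable.indicator ?_ (measurableSet_SS u (k+1))
      exact ((measurable_PP measurable_ext0 (k+1)).inv.pow_const q).ennreal_ofReal

/-- volume bound for the reduced bases. -/
theorem SS_volume (d : ℕ) (hd1 : 1 ≤ d) (hd : Module.finrank ℝ E = d) :
    ∃ C : ℝ, 0 < C ∧ ∀ u : ℕ → ℝ, (∀ k, 0 < u k) →
      volume (SS u d : Set (Fin d → E))
        ≤ ENNReal.ofReal (C * (u d * ∏ κ ∈ Finset.range (d - 1), u (κ+1) ^ 2)) := by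
  obtain ⟨k, rfl⟩ : ∃ k, d = k + 1 := ⟨d - 1, by omega⟩
  obtain ⟨C, hC, h⟩ := SS_weighted (k+1) hd k le_rfl
  refine ⟨2 * C, by positivity, fun u hu => ?_⟩
  have h1 := h u hu
  simp only [Nat.add_sub_cancel, Nat.sub_self, pow_zero, ENNReal.ofReal_one] at h1
  rw [setLIntegral_one] at h1
  rw [← lintegral_indicator_one (measurableSet_SS u (k+1)), lintegral_sn]
  · have h2 : ∀ b : Fin k → E, ∫⁻ x : E, (SS u (k+1)).indicator (1 : (Fin (k+1) → E) → ℝ≥0∞) (sn k (x, b)) ≤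
          ENNReal.ofReal (2 * u (k+1)) * (SS u k).indicator 1 b := by
      intro b
      by_cases hb : b ∈ SS u k
      · rw [Set.indicator_of_mem hb]
        have hP : 0 < PP (ext0 b) k := PP_pos hb.1
        have hu' := hu (k+1)
        have hsn : Measurable fun x : E => sn k (x, b) :=
          (measurable_sn k).comp (measurable_id.prodMk measurable_const)
        have e : ∀ x, (SS u (k+1)).indicator (1 : (Fin (k+1) → E) → ℝ≥0∞) (sn k (x, b)) =
          {x | sn k (x,b) ∈ SS u (k+1)}.indicator 1 x := fun x => rfl
        simp only [e]
        rw [lintegral_indicator_one (show MeasurableSet {x | sn k (x,b) ∈ SS u (k+1)} from hsn (measurableSet_SS u (k+1)))]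
        have h3 := slice (k+1) hd (ext0 b) k (by omega) hb.1 (ρ := u (k+1) / PP (ext0 b) k) (by positivity)
        refine le_trans (measure_mono ?_) (h3.trans ?_)
        · intro x hx
          refine ⟨(sn_mem hx).2.1, ?_⟩
          have := (sn_mem hx).2.2.2
          rw [rr, sn_gs_last, mul_comm, ← le_div_iff₀ hP] at this
          exact this
        · simp only [Pi.one_apply, mul_one]
          apply ENNReal.ofReal_le_ofReal
          rw [Nat.add_sub_cancel_left, pow_one]
          apply le_of_eq; field_simp
      · have : ∀ x, sn k (x,b) ∉ SS u (k+1) := fun x hx => hb (sn_mem hx).1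
        simp [this]
    refine (lintegral_mono h2).trans ?_
    rw [lintegral_const_mul' _ _ ENNReal.ofReal_ne_top, lintegral_indicator_one (measurableSet_SS u k)]
    refine (mul_le_mul_right h1 _).trans ?_
    rw [← ENNReal.ofReal_mul (by have := hu (k+1); positivity)]
    apply ENNReal.ofReal_le_ofReal
    simp only [Nat.add_sub_cancel]
    apply le_of_eq; ring
  · exact measurable_one.indicator (measurableSet_SS u (k+1))

end Vol
end KM

open MeasureTheory
open scoped ENNReal
set_option linter.unusedSectionVars false
namespace KM
open InnerProductSpace

section Interp
variable {E : Type*} [NormedAddCommGroup E] [InnerProductSpace ℝ E] 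

lemma root_le {P K y : ℝ} {s : ℕ} (hs : s ≠ 0) (hy : 0 ≤ y) (hK : 1 ≤ K)
    (h : P ^ s ≤ K * y ^ s) : P ≤ K * y := by
  refine le_of_pow_le_pow_left₀ hs (by positivity) (h.trans ?_)
  rw [mul_pow]
  apply mul_le_mul_of_nonneg_right _ (by positivity)
  exact le_self_pow₀ hK hs

lemma interp {d : ℕ} {b : ℕ → E} (h : IsRed d b) {x y z : ℕ} (hxy : x ≤ y) (hyz : y ≤ z) (hz : z ≤ d) :
    PP b y ^ (z - x) ≤ 2 ^ (d * d * d) * (PP b x ^ (z - y) * PP b z ^ (y - x)) := by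
  have hpos : ∀ k ≤ d, 0 < PP b k := fun k hk =>
    Finset.prod_pos fun l hl => h.pos l (by have := Finset.mem_range.1 hl; omega)
  have e1 : PP b y = PP b x * ∏ l ∈ Finset.Ico x y, rr b l :=
    (Finset.prod_range_mul_prod_Ico _ hxy).symm
  have e2 : PP b z = PP b y * ∏ l ∈ Finset.Ico y z, rr b l :=
    (Finset.prod_range_mul_prod_Ico _ hyz).symm
  set Q1 := ∏ l ∈ Finset.Ico x y, rr b l with hQ1
  set Q2 := ∏ l ∈ Finset.Ico y z, rr b l with hQ2
  have hQ1' : 0 ≤ Q1 := Finset.prod_nonneg fun _ _ => rr_nonneg _ _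
  have hQ2' : 0 ≤ Q2 := Finset.prod_nonneg fun _ _ => rr_nonneg _ _
  have key : Q1 ^ (z - y) ≤ 2 ^ (d * d * d) * Q2 ^ (y - x) := by
    have h1 : ∀ k ∈ Finset.Ico y z, Q1 ≤ (2 ^ d * rr b k) ^ (y - x) := by
      intro k hk
      have hk := Finset.mem_Ico.1 hk
      have : ∏ l ∈ Finset.Ico x y, rr b l ≤ ∏ l ∈ Finset.Ico x y, (2 ^ d * rr b k) := by
        apply Finset.prod_le_prod
        · intros; exact rr_nonneg _ _
        · intro l hl
          have hl := Finset.mem_Ico.1 hl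
          exact h.mono (by omega) (by omega)
      simpa using this
    have h2 := Finset.prod_le_prod (s := Finset.Ico y z) (fun _ _ => hQ1') h1
    rw [Finset.prod_const, Nat.card_Ico, Finset.prod_pow, Finset.prod_mul_distrib, Finset.prod_const,
      Nat.card_Ico, mul_pow, ← hQ2] at h2
    refine h2.trans ?_
    apply mul_le_mul_of_nonneg_right _ (by positivity)
    rw [← pow_mul, ← pow_mul]
    apply pow_le_pow_right₀ (by norm_num)
    have q1 : z - y ≤ d := by omega
    have q2 : y - x ≤ d := by omega
    refine le_trans (le_of_eq ?_) (Nat.mul_le_mul (Nat.mul_le_mul (le_refl d) q1) q2)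
    ring
  have e3 : z - x = (z - y) + (y - x) := by omega
  rw [e3, pow_add]
  nth_rewrite 1 [e1]
  rw [e2, mul_pow, mul_pow]
  have h3 : 0 < PP b x := hpos x (by omega)
  have h4 : 0 < PP b y := hpos y (by omega)
  calc PP b x ^ (z - y) * Q1 ^ (z - y) * PP b y ^ (y - x)
      ≤ PP b x ^ (z - y) * (2 ^ (d * d * d) * Q2 ^ (y - x)) * PP b y ^ (y - x) := by gcongr
    _ = _ := by ring

/-- reduced bases with determinant about one -/
def FF (d : ℕ) : Set (Fin d → E) :=
  {b | IsRed d (ext0 b) ∧ 1/2 ≤ PP (ext0 b) d ∧ PP (ext0 b) d ≤ 2}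

/-- exponents -/
def ee (d i κ : ℕ) : ℕ := if κ ≤ i then (d - i) * κ else i * (d - κ)

lemma sum_ee (d i : ℕ) (hi : i < d) :
    2 * ∑ κ ∈ Finset.range (d - 1), ee d i (κ+1) = i * (d - i) * d := by
  obtain ⟨r, rfl⟩ : ∃ r, d = i + r + 1 := ⟨d - i - 1, by omega⟩
  have e : i + r + 1 - 1 = i + r := rfl
  rw [e, Finset.sum_range_add]
  have h1 : ∀ κ ∈ Finset.range i, ee (i+r+1) i (κ+1) = (r+1) * (κ+1) := by
    intro κ hκ
    have := Finset.mem_range.1 hκ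
    rw [ee, if_pos (by omega)]; congr 1; omega
  have h2 : ∀ t ∈ Finset.range r, ee (i+r+1) i (i + t + 1) = i * (r - t) := by
    intro t _
    rw [ee, if_neg (by omega)]; congr 1; omega
  rw [Finset.sum_congr rfl h1, Finset.sum_congr rfl h2, ← Finset.mul_sum, ← Finset.mul_sum]
  have h3 : ∀ n : ℕ, 2 * ∑ κ ∈ Finset.range n, (κ + 1) = n * (n+1) := by
    intro n; induction n with
    | zero => simp
    | succ n ih => rw [Finset.sum_range_succ, mul_add, ih]; ring
  have h4 : ∀ n : ℕ, 2 * ∑ κ ∈ Finset.range n, (n - κ) = n * (n+1) := by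
    intro n; induction n with
    | zero => simp
    | succ n ih =>
      rw [Finset.sum_range_succ', mul_add]
      simp only [Nat.add_sub_add_right]
      rw [ih]; simp; ring
  have h5 := h3 i
  have h6 := h4 r
  have e2 : i + r + 1 - i = r + 1 := by omega
  rw [e2]
  calc _ = (r+1) * (2 * ∑ κ ∈ Finset.range i, (κ + 1)) + i * (2 * ∑ κ ∈ Finset.range r, (r - κ)) := by ring
    _ = _ := by rw [h5, h6]; ring

variable [FiniteDimensional ℝ E] [MeasurableSpace E] [BorelSpace E]

lemma measurableSet_isRed (d : ℕ) {X : Type*} [MeasurableSpace X] {β : X → ℕ → E}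
    (hβ : ∀ j, Measurable fun x => β x j) : MeasurableSet {x | IsRed d (β x)} := by
  have : SecondCountableTopology E := by
    have := FiniteDimensional.proper_real E
    infer_instance
  have e : {x | IsRed d (β x)} = {x | (∀ k < d, 0 < rr (β x) k) ∧
    (∀ k < d, ∀ l < k, |inner ℝ (gs (β x) l) (β x k)| ≤ 1/2 * rr (β x) l ^ 2) ∧
    (∀ k, k + 1 < d → rr (β x) k ≤ 2 * rr (β x) (k+1))} := by
    ext x; exact ⟨fun h => ⟨h.1, h.2, h.3⟩, fun h => ⟨h.1, h.2.1, h.2.2⟩⟩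
  rw [e]
  simp only [Set.ofPred_and, Set.ofPred_forall]
  refine MeasurableSet.inter ?_ (MeasurableSet.inter ?_ ?_)
  · refine MeasurableSet.iInter fun κ => MeasurableSet.iInter fun _ => ?_
    exact measurableSet_lt measurable_const (measurable_rr hβ κ)
  · refine MeasurableSet.iInter fun κ => MeasurableSet.iInter fun _ =>
      MeasurableSet.iInter fun l => MeasurableSet.iInter fun _ => ?_
    refine measurableSet_le ?_ ?_
    · exact ((measurable_gs hβ l).inner (hβ κ)).abs
    · exact measurable_const.mul ((measurable_rr hβ l).pow_const 2)
  · refine MeasurableSet.iInter fun κ => MeasurableSet.iInter fun _ => ?_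
    exact measurableSet_le (measurable_rr hβ κ) (measurable_const.mul (measurable_rr hβ _))

lemma measurableSet_FF (d : ℕ) : MeasurableSet (FF d : Set (Fin d → E)) := by
  refine (measurableSet_isRed d measurable_ext0).inter (MeasurableSet.inter ?_ ?_)
  · exact measurableSet_le measurable_const (measurable_PP measurable_ext0 d)
  · exact measurableSet_le (measurable_PP measurable_ext0 d) measurable_const

lemma V_core (d : ℕ) (hd : Module.finrank ℝ E = d) (i : ℕ) (hi1 : 1 ≤ i) (hi : i < d) :
    ∃ C : ℝ, 0 < C ∧ ∀ x > (0:ℝ), ∀ δ > (0:ℝ), (δ = 1 ∨ i + 1 < d) →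
      volume (FF d ∩ {b : Fin d → E | PP (ext0 b) i ≤ x ^ (i * (d - i)) ∧
        (δ = 1 ∨ PP (ext0 b) i * rr (ext0 b) i ^ (d - i) ≤ δ ^ (d - i))})
      ≤ ENNReal.ofReal (C * δ ^ 2 * x ^ (i * (d - i) * d)) := by
  obtain ⟨C, hC, hV⟩ := SS_volume (E := E) d (by omega) hd
  set K : ℝ := 2 ^ (d * d * d) * 2 ^ d with hK
  have hK1 : 1 ≤ K := by
    rw [hK, ← pow_add]; exact one_le_pow₀ (by norm_num)
  have hK0 : (2:ℝ) ^ (d*d*d) ≤ K := by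
    rw [hK]; exact le_mul_of_one_le_right (by positivity) (one_le_pow₀ (by norm_num))
  refine ⟨C * K * K ^ (2 * (d-1)), by positivity, fun x hx δ hδ hor => ?_⟩
  let u : ℕ → ℝ := fun κ => K * x ^ (ee d i κ) * (if κ = i + 1 then δ else 1)
  have hu : ∀ κ, 0 < u κ := by intro κ; simp only [u]; split_ifs <;> positivity
  refine le_trans (measure_mono ?_) ((hV u hu).trans (ENNReal.ofReal_le_ofReal ?_))
  · rintro b ⟨⟨hred, hP1, hP2⟩, hPi, hor2⟩
    have hpos : ∀ k ≤ d, 0 < PP (ext0 b) k := fun k hk =>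
      Finset.prod_pos fun l hl => hred.pos l (by have := Finset.mem_range.1 hl; omega)
    refine ⟨hred.pos, hred.size, fun κ hκ1 hκ2 => ?_⟩
    by_cases hκi : κ ≤ i
    · have e : u κ = K * x ^ ((d - i) * κ) := by
        simp only [u, ee]; rw [if_pos hκi, if_neg (by omega), mul_one]
      rw [e]
      apply root_le (s := i) (by omega) (by positivity) hK1
      have h1 := interp hred (Nat.zero_le κ) hκi hi.le
      simp only [Nat.sub_zero, PP, Finset.range_zero, Finset.prod_empty, one_pow, one_mul] at h1
      change PP (ext0 b) κ ^ i ≤ _ * PP (ext0 b) i ^ κ at h1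
      refine h1.trans ?_
      have h2 : PP (ext0 b) i ^ κ ≤ (x ^ (i * (d-i))) ^ κ := by
        have := (hpos i hi.le).le
        gcongr
      have h3 : (x ^ (i * (d-i))) ^ κ = (x ^ ((d - i) * κ)) ^ i := by
        rw [← pow_mul, ← pow_mul]; congr 1; ring
      rw [← h3]
      have := (hpos i hi.le).le
      gcongr
    · by_cases hc : κ = i + 1 ∧ δ ≠ 1
      · obtain ⟨rfl, hδ1⟩ := hc
        have e : u (i+1) = K * (x ^ (i * (d - (i+1))) * δ) := by
          simp only [u, ee]; rw [if_neg hκi]; simp [mul_assoc]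
        rw [e]
        apply root_le (s := d - i) (by omega) (by positivity) hK1
        have h1 := hor2.resolve_left hδ1
        have e2 : d - i = (d - (i+1)) + 1 := by omega
        have h2 : PP (ext0 b) (i+1) ^ (d - i) = PP (ext0 b) i ^ (d - (i+1)) *
            (PP (ext0 b) i * rr (ext0 b) i ^ (d - i)) := by
          rw [PP_succ, mul_pow]; nth_rewrite 1 [e2]; rw [pow_succ]; ring
        rw [h2, mul_pow]
        have h3 : PP (ext0 b) i ^ (d - (i+1)) ≤ (x ^ (i * (d-(i+1)))) ^ (d - i) := by
          calc PP (ext0 b) i ^ (d - (i+1)) ≤ (x ^ (i * (d-i))) ^ (d - (i+1)) := by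
                have := (hpos i hi.le).le
                gcongr
            _ = _ := by rw [← pow_mul, ← pow_mul]; congr 1; ring
        have h4 : PP (ext0 b) i ^ (d - (i+1)) * (PP (ext0 b) i * rr (ext0 b) i ^ (d - i)) ≤
          (x ^ (i * (d-(i+1)))) ^ (d - i) * δ ^ (d - i) := by
          apply mul_le_mul h3 h1 _ (by positivity)
          have := (hpos i hi.le).le
          have := rr_nonneg (ext0 b) i
          positivity
        refine h4.trans ?_
        exact le_mul_of_one_le_left (by positivity) hK1
      · have e : u κ = K * x ^ (i * (d - κ)) := by
          simp only [u, ee]; rw [if_neg hκi]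
          split_ifs with h7
          · have : δ = 1 := by by_contra h8; exact hc ⟨h7, h8⟩
            rw [this, mul_one]
          · rw [mul_one]
        rw [e]
        apply root_le (s := d - i) (by omega) (by positivity) hK1
        have h1 := interp hred (show i ≤ κ by omega) hκ2 le_rfl
        refine h1.trans ?_
        have h2 : PP (ext0 b) i ^ (d - κ) ≤ (x ^ (i * (d-κ))) ^ (d - i) := by
          calc PP (ext0 b) i ^ (d - κ) ≤ (x ^ (i * (d-i))) ^ (d - κ) := by
                have := (hpos i hi.le).le
                gcongr
            _ = _ := by rw [← pow_mul, ← pow_mul]; congr 1; ring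
        have h3 : PP (ext0 b) d ^ (κ - i) ≤ 2 ^ d := by
          calc PP (ext0 b) d ^ (κ - i) ≤ 2 ^ (κ - i) := by
                have := (hpos d le_rfl).le
                gcongr
            _ ≤ _ := pow_le_pow_right₀ (by norm_num) (by omega)
        have h4 : PP (ext0 b) i ^ (d - κ) * PP (ext0 b) d ^ (κ - i) ≤ (x ^ (i * (d-κ))) ^ (d - i) * 2 ^ d := by
          apply mul_le_mul h2 h3 _ (by positivity)
          have := (hpos d le_rfl).le
          positivity
        calc _ ≤ 2 ^ (d*d*d) * ((x ^ (i * (d-κ))) ^ (d - i) * 2 ^ d) := by gcongr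
          _ = _ := by rw [hK]; ring
  · have e1 : u d = K * (if d = i + 1 then δ else 1) := by
      simp only [u, ee]; rw [if_neg (by omega)]; simp
    have e2 : u d = K := by
      rw [e1]; rcases hor with h | h
      · simp [h]
      · rw [if_neg (by omega), mul_one]
    have e3 : ∏ κ ∈ Finset.range (d - 1), u (κ+1) ^ 2 ≤ K ^ (2 * (d-1)) * x ^ (i * (d - i) * d) * δ ^ 2 := by
      simp only [u, mul_pow]
      rw [Finset.prod_mul_distrib, Finset.prod_mul_distrib, Finset.prod_const, Finset.card_range, ← pow_mul]
      have h1 : ∏ κ ∈ Finset.range (d-1), (x ^ ee d i (κ+1)) ^ 2 = x ^ (i * (d - i) * d) := by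
        rw [← sum_ee d i hi, Finset.mul_sum, ← Finset.prod_pow_eq_pow_sum]
        apply Finset.prod_congr rfl
        intro κ _; rw [← pow_mul, mul_comm]
      have h2 : ∏ κ ∈ Finset.range (d-1), (if κ + 1 = i + 1 then δ else 1) ^ 2 = δ ^ 2 := by
        rw [Finset.prod_pow]
        congr 1
        rcases hor with h | h
        · simp [h]
        · have : ∀ κ, (if κ + 1 = i + 1 then δ else 1) = if i = κ then δ else 1 := by
            intro κ; congr 1; simp; exact eq_comm
          simp only [this]
          rw [Finset.prod_ite_eq, if_pos (Finset.mem_range.2 (by omega))]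
      rw [h1, h2]
    rw [e2]
    calc C * (K * ∏ κ ∈ Finset.range (d - 1), u (κ+1) ^ 2) ≤
      C * (K * (K ^ (2 * (d-1)) * x ^ (i * (d - i) * d) * δ ^ 2)) := by gcongr
      _ = _ := by ring

end Interp
end KM

open MeasureTheory
open scoped ENNReal
set_option linter.unusedSectionVars false
namespace KM
open InnerProductSpace

section V2
variable {E : Type*} [NormedAddCommGroup E] [InnerProductSpace ℝ E] 
variable [FiniteDimensional ℝ E] [MeasurableSpace E] [BorelSpace E]

lemma FF_pos {d : ℕ} {b : Fin d → E} (hb : b ∈ FF d) (k : ℕ) (hk : k ≤ d) : 0 < PP (ext0 b) k :=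
  Finset.prod_pos fun l hl => hb.1.pos l (by have := Finset.mem_range.1 hl; omega)

lemma V1d (d : ℕ) (hd : Module.finrank ℝ E = d) (i : ℕ) (hi1 : 1 ≤ i) (hi : i < d) :
    ∃ C : ℝ, 0 < C ∧ ∀ ε > (0:ℝ), ∀ δ > (0:ℝ), (δ = 1 ∨ δ < 1/2) →
      volume (FF d ∩ {b : Fin d → E | PP (ext0 b) i ≤ ε ∧
        (δ = 1 ∨ PP (ext0 b) i * rr (ext0 b) i ^ (d - i) ≤ δ ^ (d - i))})
      ≤ ENNReal.ofReal (C * δ ^ 2 * ε ^ d) := by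
  obtain ⟨C, hC, h⟩ := V_core (E := E) d hd i hi1 hi
  refine ⟨C, hC, fun ε hε δ hδ hor => ?_⟩
  have hne : i * (d - i) ≠ 0 := Nat.mul_ne_zero (by omega) (by omega)
  have e1 : (ε ^ ((i * (d - i) : ℕ) : ℝ)⁻¹) ^ (i * (d - i)) = ε :=
    Real.rpow_inv_natCast_pow hε.le hne
  have h0 := h (ε ^ ((i * (d - i) : ℕ) : ℝ)⁻¹) (by positivity) δ hδ
  rw [pow_mul _ (i * (d-i)) d, e1] at h0
  by_cases hc : δ = 1 ∨ i + 1 < d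
  · exact h0 hc
  · push Not at hc
    have hdi : d = i + 1 := by omega
    refine le_trans (le_of_eq ?_) (zero_le)
    rw [← nonpos_iff_eq_zero]
    refine le_trans (measure_mono ?_) (measure_empty (μ := volume)).le
    rintro b ⟨hb, hb1, hb2⟩
    have h2 := hb2.resolve_left hc.1
    have e : d - i = 1 := by omega
    rw [e, pow_one, pow_one] at h2
    have h3 := hb.2.1
    have := hor.resolve_left hc.1
    subst hdi
    rw [PP_succ] at h3
    linarith

lemma wint {d i κ : ℕ} (hi : i < d) (hκ : κ < d) {S : Set (Fin d → E)} (hS : MeasurableSet S)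
    (hSF : S ⊆ FF d) {a : ℝ} (ha : 0 < a) (h1 : ∀ b ∈ S, ∀ k < κ, rr (ext0 b) k ≤ 2 ^ d * a)
    (h2 : ∀ b ∈ S, ∀ k, κ ≤ k → k < d → a ≤ rr (ext0 b) k) {α K : ℝ} (hα : 0 < α)
    (h3 : ∀ b ∈ S, PP (ext0 b) κ ≤ α) (hK : 0 ≤ K)
    (h4 : ∀ ε > (0:ℝ), volume (S ∩ {b | PP (ext0 b) κ ≤ ε}) ≤ ENNReal.ofReal (K * ε ^ d)) :
    ∫⁻ b in S, ENNReal.ofReal ((∏ k : Fin d, (1 + 2 * a / rr (ext0 b) k)) ^ i) ≤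
      ENNReal.ofReal (((2 ^ d + 3) ^ d * a ^ κ) ^ i * (2 ^ (i+1) * K * α ^ (d - i))) := by
  have hmP : Measurable fun b : Fin d → E => PP (ext0 b) κ := measurable_PP measurable_ext0 κ
  have h5 := dyadic volume hS hmP (fun b hb => FF_pos (hSF hb) κ hκ.le) hα h3 i
    (K := K * α ^ d) (by positivity) (fun t => by
      refine (h4 (α * 2⁻¹ ^ t) (by positivity)).trans (ENNReal.ofReal_le_ofReal ?_)
      rw [mul_pow, mul_assoc]
      have : ((2:ℝ)⁻¹ ^ t) ^ d ≤ (2⁻¹ ^ t) ^ (i+1) :=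
        pow_le_pow_of_le_one (by positivity) (pow_le_one₀ (by norm_num) (by norm_num)) hi
      gcongr)
  have h6 : ∀ b ∈ S, ENNReal.ofReal ((∏ k : Fin d, (1 + 2 * a / rr (ext0 b) k)) ^ i) ≤
      ENNReal.ofReal (((2 ^ d + 3) ^ d * a ^ κ) ^ i) * ENNReal.ofReal ((PP (ext0 b) κ)⁻¹ ^ i) := by
    intro b hb
    rw [← ENNReal.ofReal_mul (by positivity), ← mul_pow]
    apply ENNReal.ofReal_le_ofReal
    have hrp : ∀ k : Fin d, 0 < rr (ext0 b) k := fun k => (hSF hb).1.pos k k.2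
    apply pow_le_pow_left₀
    · exact Finset.prod_nonneg fun k _ => by have := hrp k; positivity
    rw [Finset.prod_range (fun k => 1 + 2 * a / rr (ext0 b) k) |>.symm]
    rw [← Finset.prod_range_mul_prod_Ico _ hκ.le]
    have hM : (1:ℝ) ≤ 2 ^ d + 3 := by have : (0:ℝ) < 2 ^ d := by positivity
                                      linarith
    have p1 : ∏ k ∈ Finset.range κ, (1 + 2 * a / rr (ext0 b) k) ≤
        ∏ k ∈ Finset.range κ, ((2 ^ d + 3) * (a / rr (ext0 b) k)) := by
      apply Finset.prod_le_prod
      · intro k hk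
        have := (hSF hb).1.pos k (by have := Finset.mem_range.1 hk; omega)
        positivity
      · intro k hk
        have hk := Finset.mem_range.1 hk
        have h7 := (hSF hb).1.pos k (by omega)
        have h8 : 1 ≤ 2 ^ d * (a / rr (ext0 b) k) := by
          rw [← mul_div_assoc, one_le_div h7]; exact h1 b hb k hk
        have h9 : 0 < a / rr (ext0 b) k := by positivity
        rw [mul_div_assoc]
        nlinarith
    have p2 : ∏ k ∈ Finset.Ico κ d, (1 + 2 * a / rr (ext0 b) k) ≤
        ∏ k ∈ Finset.Ico κ d, ((2:ℝ) ^ d + 3) := by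
      apply Finset.prod_le_prod
      · intro k hk
        have := (hSF hb).1.pos k (by have := Finset.mem_Ico.1 hk; omega)
        positivity
      · intro k hk
        have hk := Finset.mem_Ico.1 hk
        have h7 := (hSF hb).1.pos k (by omega)
        have h8 : a / rr (ext0 b) k ≤ 1 := by
          rw [div_le_one h7]; exact h2 b hb k hk.1 hk.2
        have : (0:ℝ) < 2 ^ d := by positivity
        rw [mul_div_assoc]
        linarith
    rw [Finset.prod_mul_distrib, Finset.prod_const, Finset.card_range, Finset.prod_div_distrib,
      Finset.prod_const, Finset.card_range] at p1
    rw [Finset.prod_const, Nat.card_Ico] at p2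
    refine (mul_le_mul p1 p2 (Finset.prod_nonneg fun k hk => ?_) ?_).trans (le_of_eq ?_)
    · have := (hSF hb).1.pos k (by have := Finset.mem_Ico.1 hk; omega)
      positivity
    · have := FF_pos (hSF hb) κ hκ.le
      have := Finset.prod_nonneg (s := Finset.range κ) fun k _ => rr_nonneg (ext0 b) k
      positivity
    · have e : ((2:ℝ)^d+3)^d = (2^d+3)^κ * (2^d+3)^(d-κ) := by rw [← pow_add]; congr 1; omega
      rw [e, PP]; ring
  calc _ ≤ ∫⁻ b in S, ENNReal.ofReal (((2 ^ d + 3) ^ d * a ^ κ) ^ i) * ENNReal.ofReal ((PP (ext0 b) κ)⁻¹ ^ i) :=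
        setLIntegral_mono' hS h6
    _ = ENNReal.ofReal (((2 ^ d + 3) ^ d * a ^ κ) ^ i) * ∫⁻ b in S, ENNReal.ofReal ((PP (ext0 b) κ)⁻¹ ^ i) := by
        rw [lintegral_const_mul']; exact ENNReal.ofReal_ne_top
    _ ≤ ENNReal.ofReal (((2 ^ d + 3) ^ d * a ^ κ) ^ i) * ENNReal.ofReal (2 ^ (i+1) * (K * α ^ d) * α⁻¹ ^ i) := by
        gcongr
    _ = _ := by
        rw [← ENNReal.ofReal_mul (by positivity)]
        congr 2
        have : α ^ d = α ^ (d - i) * α ^ i := by rw [← pow_add]; congr 1; omega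
        rw [this, inv_pow]
        field_simp

/-- bad lattices -/
def Bad (d i : ℕ) (a c η T : ℝ) : Set (Fin d → E) :=
  FF d ∩ {b | (∀ k < i, rr (ext0 b) k ≤ a) ∧
    ¬ ((∀ k < i, c * η ≤ rr (ext0 b) k) ∧ ∀ k, i ≤ k → k < d → c * T ≤ rr (ext0 b) k)}

lemma measurableSet_rr_le (d k : ℕ) (a : ℝ) : MeasurableSet {b : Fin d → E | rr (ext0 b) k ≤ a} :=
  measurableSet_le (measurable_rr measurable_ext0 k) measurable_const

lemma measurableSet_le_rr (d k : ℕ) (a : ℝ) : MeasurableSet {b : Fin d → E | a ≤ rr (ext0 b) k} :=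
  measurableSet_le measurable_const (measurable_rr measurable_ext0 k) 

/-- level sets -/
def Lev (d κ : ℕ) (a : ℝ) : Set (Fin d → E) :=
  FF d ∩ {b | (∀ k < κ, rr (ext0 b) k ≤ 2 ^ d * a) ∧ ∀ k, κ ≤ k → k < d → a ≤ rr (ext0 b) k}

lemma measurableSet_Lev (d κ : ℕ) (a : ℝ) : MeasurableSet (Lev d κ a : Set (Fin d → E)) := by
  refine (measurableSet_FF d).inter ?_
  simp only [Set.ofPred_and, Set.ofPred_forall]
  refine MeasurableSet.inter ?_ ?_
  · exact MeasurableSet.iInter fun k => MeasurableSet.iInter fun _ => measurableSet_rr_le _ _ _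
  · exact MeasurableSet.iInter fun k => MeasurableSet.iInter fun _ => MeasurableSet.iInter fun _ => measurableSet_le_rr _ _ _

lemma measurableSet_Bad (d i : ℕ) (a c η T : ℝ) : MeasurableSet (Bad d i a c η T : Set (Fin d → E)) := by
  have h : MeasurableSet {b : Fin d → E | (∀ k < i, c * η ≤ rr (ext0 b) k) ∧ ∀ k, i ≤ k → k < d → c * T ≤ rr (ext0 b) k} := by
    simp only [Set.ofPred_and, Set.ofPred_forall]
    refine MeasurableSet.inter ?_ ?_
    · exact MeasurableSet.iInter fun k => MeasurableSet.iInter fun _ => measurableSet_le_rr _ _ _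
    · exact MeasurableSet.iInter fun k => MeasurableSet.iInter fun _ => MeasurableSet.iInter fun _ => measurableSet_le_rr _ _ _
  refine (measurableSet_FF d).inter (MeasurableSet.inter ?_ h.compl)
  have h2 : MeasurableSet {b : Fin d → E | ∀ k < i, rr (ext0 b) k ≤ a} := by
    simp only [Set.ofPred_forall]
    exact MeasurableSet.iInter fun k => MeasurableSet.iInter fun _ => measurableSet_rr_le _ _ _
  exact h2

lemma lintegral_biUnion_le {X ι : Type*} [MeasurableSpace X] {μ : Measure X} (s : Finset ι)
    (t : ι → Set X) (f : X → ℝ≥0∞) :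
    ∫⁻ x in ⋃ i ∈ s, t i, f x ∂μ ≤ ∑ i ∈ s, ∫⁻ x in t i, f x ∂μ := by
  classical
  induction s using Finset.induction_on with
  | empty => simp
  | insert a s ha ih =>
    rw [Finset.sum_insert ha, Finset.set_biUnion_insert]
    exact (lintegral_union_le _ _ _).trans (add_le_add le_rfl ih)

lemma exists_lev {d i : ℕ} (hi1 : 1 ≤ i) (hi : i < d) {a : ℝ} (ha : 0 < a) (hsm : (2 ^ d * a) ^ d < 1/2) {b : Fin d → E}
    (hb : b ∈ FF d) (hbi : ∀ k < i, rr (ext0 b) k ≤ a) : ∃ κ, i ≤ κ ∧ κ < d ∧ b ∈ Lev d κ a := by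
  classical
  set κ := Nat.findGreatest (fun κ => rr (ext0 b) (κ - 1) ≤ a) d with hκ
  have h1 : i ≤ κ := Nat.le_findGreatest hi.le (hbi _ (by omega))
  have h2 : rr (ext0 b) (κ - 1) ≤ a :=
    Nat.findGreatest_spec (P := fun κ => rr (ext0 b) (κ - 1) ≤ a) hi.le (hbi _ (by omega))
  have h2' : κ ≤ d := Nat.findGreatest_le d
  have h3 : ∀ k < κ, rr (ext0 b) k ≤ 2 ^ d * a := fun k hk =>
    (hb.1.mono (show k ≤ κ - 1 by omega) (by omega)).trans (by gcongr)
  have h4 : κ < d := by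
    rcases h2'.lt_or_eq with h | h
    · exact h
    · exfalso
      have : PP (ext0 b) d ≤ (2 ^ d * a) ^ d := by
        calc PP (ext0 b) d ≤ ∏ k ∈ Finset.range d, (2 ^ d * a) := by
              apply Finset.prod_le_prod (fun _ _ => rr_nonneg _ _)
              intro k hk
              exact h3 k (by rw [h]; exact Finset.mem_range.1 hk)
          _ = _ := by simp
      have := hb.2.1
      linarith
  refine ⟨κ, h1, h4, hb, h3, fun k hk1 hk2 => ?_⟩
  have := Nat.findGreatest_is_greatest (P := fun κ => rr (ext0 b) (κ - 1) ≤ a) (n := d) (k := k + 1) (by omega) (by omega)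
  simp at this
  exact this.le

lemma V2 (d : ℕ) (hd : Module.finrank ℝ E = d) (i : ℕ) (hi1 : 1 ≤ i) (hi : i < d) (A : ℝ) (hA : 1 ≤ A)
    (ε : ℝ) (hε : 0 < ε) : ∃ c > (0:ℝ), ∃ y0 > (0:ℝ), ∀ y > (0:ℝ), y ≤ y0 →
    ∫⁻ b in (Bad d i (A * y ^ (d - i)) c (y ^ (d-i)) ((y ^ i)⁻¹) : Set (Fin d → E)),
      ENNReal.ofReal ((∏ k : Fin d, (1 + 2 * (A * y ^ (d - i)) / rr (ext0 b) k)) ^ i) ≤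
      ENNReal.ofReal (ε * (y ^ (d - i)) ^ (d * i)) := by
  have hV : ∀ κ, ∃ C : ℝ, 0 < C ∧ (1 ≤ κ → κ < d → ∀ ε > (0:ℝ), ∀ δ > (0:ℝ), (δ = 1 ∨ δ < 1/2) →
      volume (FF d ∩ {b : Fin d → E | PP (ext0 b) κ ≤ ε ∧
        (δ = 1 ∨ PP (ext0 b) κ * rr (ext0 b) κ ^ (d - κ) ≤ δ ^ (d - κ))})
      ≤ ENNReal.ofReal (C * δ ^ 2 * ε ^ d)) := by
    intro κ
    by_cases h : 1 ≤ κ ∧ κ < d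
    · obtain ⟨C, hC, h1⟩ := V1d (E := E) d hd κ h.1 h.2
      exact ⟨C, hC, fun _ _ => h1⟩
    · exact ⟨1, one_pos, fun h1 h2 => absurd ⟨h1, h2⟩ h⟩
  choose C hC hV using hV
  -- constants
  set M : ℝ := ((2 ^ d + 3) ^ d) ^ i * 2 ^ (i+1) with hM
  have hMpos : 0 < M := by positivity
  -- choose c
  obtain ⟨c, hc0, hc1, hc2, hc3⟩ : ∃ c > (0:ℝ), c ≤ 1 ∧ A ^ i * 2 ^ d * c < 1/2 ∧
      M * C i * c * A ^ (d * i) + M * C i * (A ^ i * 2 ^ d) ^ 2 * c * A ^ (d * i) ≤ ε / 2 := by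
    set Q := A ^ i * 2 ^ d with hQ
    have hQp : 0 < Q := by positivity
    set W := M * C i * A ^ (d * i) + M * C i * Q ^ 2 * A ^ (d * i) with hW
    have hWp : 0 < W := by have := hC i; positivity
    refine ⟨min 1 (min (1 / (4 * Q)) (ε / 2 / W)), by positivity, min_le_left _ _, ?_, ?_⟩
    · have : min 1 (min (1 / (4 * Q)) (ε / 2 / W)) ≤ 1 / (4 * Q) := (min_le_right _ _).trans (min_le_left _ _)
      calc Q * _ ≤ Q * (1 / (4 * Q)) := by gcongr
        _ = 1/4 := by field_simp
        _ < _ := by norm_num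
    · have : min 1 (min (1 / (4 * Q)) (ε / 2 / W)) ≤ ε / 2 / W := (min_le_right _ _).trans (min_le_right _ _)
      calc _ = W * min 1 (min (1 / (4 * Q)) (ε / 2 / W)) := by rw [hW]; ring
        _ ≤ W * (ε / 2 / W) := by gcongr
        _ = _ := by field_simp
  set X : ℝ := ∑ κ ∈ Finset.Ico (i+1) d, M * C κ * ((2:ℝ) ^ d) ^ (κ * d) * A ^ (d * d) with hX
  have hX0 : 0 ≤ X := Finset.sum_nonneg fun κ _ => by have := hC κ; positivity
  refine ⟨c, hc0, min 1 (min (1 / (4 * 2 ^ d * A)) (ε / 2 / (X + 1))), by positivity, fun y hy hy0 => ?_⟩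
  have hy1 : y ≤ 1 := hy0.trans (min_le_left _ _)
  have hy2 : y ≤ 1 / (4 * 2 ^ d * A) := hy0.trans ((min_le_right _ _).trans (min_le_left _ _))
  have hy3 : y ≤ ε / 2 / (X+1) := hy0.trans ((min_le_right _ _).trans (min_le_right _ _))
  set η := y ^ (d - i) with hη
  have hηpos : 0 < η := by positivity
  have hηy : η ≤ y := by
    calc y ^ (d-i) ≤ y ^ 1 := pow_le_pow_of_le_one hy.le hy1 (by omega)
      _ = y := pow_one y
  set a := A * η with ha
  have hapos : 0 < a := by positivity
  have ha4 : 2 ^ d * a ≤ 1/4 := by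
    calc 2 ^ d * (A * η) ≤ 2 ^ d * (A * (1 / (4 * 2 ^ d * A))) := by gcongr; exact hηy.trans hy2
      _ = 1/4 := by field_simp
  have hsm : (2 ^ d * a) ^ d < 1/2 := by
    calc (2 ^ d * a) ^ d ≤ (2 ^ d * a) ^ 1 := pow_le_pow_of_le_one (by positivity) (by linarith) (by omega)
      _ ≤ 1/4 := by rw [pow_one]; exact ha4
      _ < _ := by norm_num
  let W : (Fin d → E) → ℝ≥0∞ := fun b => ENNReal.ofReal ((∏ k : Fin d, (1 + 2 * a / rr (ext0 b) k)) ^ i)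
  let δ := A ^ i * 2 ^ d * c
  have hδ : 0 < δ := by positivity
  let X1 : Set (Fin d → E) := Lev d i a ∩ {b | PP (ext0 b) i ≤ c * a ^ i}
  let X2 : Set (Fin d → E) := Lev d i a ∩ {b | PP (ext0 b) i ≤ a ^ i ∧ PP (ext0 b) i * rr (ext0 b) i ^ (d - i) ≤ δ ^ (d - i)}
  have hmP : ∀ κ, Measurable fun b : Fin d → E => PP (ext0 b) κ := fun κ => measurable_PP measurable_ext0 κ
  have hmX1 : MeasurableSet X1 := (measurableSet_Lev _ _ _).inter (measurableSet_le (hmP i) measurable_const)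
  have hmX2 : MeasurableSet X2 := (measurableSet_Lev _ _ _).inter
    ((measurableSet_le (hmP i) measurable_const).inter
      (measurableSet_le ((hmP i).mul ((measurable_rr measurable_ext0 i).pow_const _)) measurable_const))
  have hηT : η ^ i * ((y ^ i)⁻¹) ^ (d - i) = 1 := by
    rw [hη, ← pow_mul, inv_pow, ← pow_mul, mul_comm (d - i) i]
    field_simp
  have hcov : (Bad d i a c η ((y ^ i)⁻¹) : Set (Fin d → E)) ⊆
      (X1 ∪ X2) ∪ ⋃ κ ∈ Finset.Ico (i+1) d, Lev d κ a := by
    rintro b ⟨hbF, hba, hbn⟩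
    obtain ⟨κ, hκ1, hκ2, hκ⟩ := exists_lev hi1 hi hapos hsm hbF hba
    rcases hκ1.lt_or_eq with h | h
    · right
      simp only [Set.mem_iUnion, Finset.mem_Ico]
      exact ⟨κ, ⟨h, hκ2⟩, hκ⟩
    · subst h
      left
      have hPa : PP (ext0 b) i ≤ a ^ i := by
        calc PP (ext0 b) i ≤ ∏ k ∈ Finset.range i, a := by
              apply Finset.prod_le_prod (fun _ _ => rr_nonneg _ _)
              intro k hk
              exact hba k (Finset.mem_range.1 hk)
          _ = _ := by simp
      by_cases hg : ∀ k < i, c * η ≤ rr (ext0 b) k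
      · right
        have hg2 : ¬ ∀ k, i ≤ k → k < d → c * (y ^ i)⁻¹ ≤ rr (ext0 b) k := fun h => hbn ⟨hg, h⟩
        push Not at hg2
        obtain ⟨k, hk1, hk2, hk3⟩ := hg2
        have h5 : rr (ext0 b) i ≤ 2 ^ d * (c * (y ^ i)⁻¹) := (hbF.1.mono hk1 hk2).trans (by gcongr)
        refine ⟨hκ, hPa, ?_⟩
        calc PP (ext0 b) i * rr (ext0 b) i ^ (d - i) ≤ a ^ i * (2 ^ d * (c * (y ^ i)⁻¹)) ^ (d - i) := by
              have := rr_nonneg (ext0 b) i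
              gcongr
          _ = A ^ i * (2 ^ d * c) ^ (d - i) * (η ^ i * ((y ^ i)⁻¹) ^ (d - i)) := by
              rw [ha]; rw [mul_pow, ← mul_assoc (2 ^ d), mul_pow (2^d*c)]; ring
          _ = A ^ i * (2 ^ d * c) ^ (d - i) := by rw [hηT, mul_one]
          _ ≤ (A ^ i) ^ (d-i) * (2 ^ d * c) ^ (d - i) := by
              gcongr
              exact le_self_pow₀ (one_le_pow₀ hA) (by omega)
          _ = δ ^ (d - i) := by rw [← mul_pow]; congr 1; simp only [δ]; ring
      · left
        push Not at hg
        obtain ⟨k, hk1, hk2⟩ := hg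
        refine ⟨hκ, ?_⟩
        change ∏ l ∈ Finset.range i, rr (ext0 b) l ≤ _
        rw [← Finset.mul_prod_erase _ _ (Finset.mem_range.2 hk1)]
        have h6 : ∏ x ∈ (Finset.range i).erase k, rr (ext0 b) x ≤ a ^ (i - 1) := by
          calc _ ≤ ∏ x ∈ (Finset.range i).erase k, a := by
                apply Finset.prod_le_prod (fun _ _ => rr_nonneg _ _)
                intro x hx
                exact hba x (Finset.mem_range.1 (Finset.mem_of_mem_erase hx))
            _ = _ := by rw [Finset.prod_const, Finset.card_erase_of_mem (Finset.mem_range.2 hk1), Finset.card_range]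
        calc _ ≤ c * η * a ^ (i-1) := by
              apply mul_le_mul hk2.le h6 _ (by positivity)
              exact Finset.prod_nonneg fun _ _ => rr_nonneg _ _
          _ ≤ c * a * a ^ (i - 1) := by
              gcongr; exact le_mul_of_one_le_left hηpos.le hA
          _ = c * a ^ i := by
              rw [mul_assoc, ← pow_succ']; congr 2; omega
  have hI1 : ∫⁻ b in X1, W b ≤ ENNReal.ofReal (M * C i * c * A ^ (d * i) * η ^ (d * i)) := by
    refine (wint (κ := i) hi hi hmX1 (fun b hb => hb.1.1) hapos (fun b hb => hb.1.2.1) (fun b hb => hb.1.2.2)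
      (α := c * a ^ i) (K := C i) (by positivity) (fun b hb => hb.2) (hC i).le ?_).trans (ENNReal.ofReal_le_ofReal ?_)
    · intro ε' hε'
      refine le_trans (measure_mono ?_) ((hV i hi1 hi ε' hε' 1 one_pos (Or.inl rfl)).trans (by simp))
      rintro b ⟨hb, hb2⟩
      exact ⟨hb.1.1, hb2, Or.inl rfl⟩
    · have hc' : c ^ (d - i) ≤ c := by
        calc c ^ (d-i) ≤ c ^ 1 := pow_le_pow_of_le_one hc0.le hc1 (by omega)
          _ = c := pow_one c
      have e : (a ^ i) ^ i * (a ^ i) ^ (d - i) = A ^ (d * i) * η ^ (d * i) := by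
        rw [← pow_add, ← pow_mul, ha, mul_pow]
        have : i * (i + (d - i)) = d * i := by rw [mul_comm]; congr 1; omega
        rw [this]
      rw [mul_pow c, mul_pow _ (a ^ i) i]
      calc _ = M * C i * c ^ (d-i) * ((a ^ i) ^ i * (a ^ i) ^ (d - i)) := by rw [hM]; ring
        _ = M * C i * c ^ (d-i) * (A ^ (d * i) * η ^ (d * i)) := by rw [e]
        _ ≤ M * C i * c * (A ^ (d * i) * η ^ (d * i)) := by
          have := hC i
          gcongr
        _ = _ := by ring
  have hI2 : ∫⁻ b in X2, W b ≤ ENNReal.ofReal (M * C i * (A ^ i * 2 ^ d) ^ 2 * c * A ^ (d * i) * η ^ (d * i)) := by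
    refine (wint (κ := i) hi hi hmX2 (fun b hb => hb.1.1) hapos (fun b hb => hb.1.2.1) (fun b hb => hb.1.2.2)
      (α := a ^ i) (K := C i * δ ^ 2) (by positivity) (fun b hb => hb.2.1) (by have := hC i; positivity) ?_).trans (ENNReal.ofReal_le_ofReal ?_)
    · intro ε' hε'
      refine le_trans (measure_mono ?_) (hV i hi1 hi ε' hε' δ hδ (Or.inr hc2))
      rintro b ⟨hb, hb2⟩
      exact ⟨hb.1.1, hb2, Or.inr hb.2.2⟩
    · have hc' : c ^ 2 ≤ c := by
        calc c ^ 2 ≤ c ^ 1 := pow_le_pow_of_le_one hc0.le hc1 (by omega)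
          _ = c := pow_one c
      have e : (a ^ i) ^ i * (a ^ i) ^ (d - i) = A ^ (d * i) * η ^ (d * i) := by
        rw [← pow_add, ← pow_mul, ha, mul_pow]
        have : i * (i + (d - i)) = d * i := by rw [mul_comm]; congr 1; omega
        rw [this]
      rw [mul_pow _ (a ^ i) i]
      calc _ = M * C i * (A ^ i * 2 ^ d) ^ 2 * c ^ 2 * ((a ^ i) ^ i * (a ^ i) ^ (d - i)) := by
            simp only [hM, δ]; ring
        _ = M * C i * (A ^ i * 2 ^ d) ^ 2 * c ^ 2 * (A ^ (d * i) * η ^ (d * i)) := by rw [e]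
        _ ≤ M * C i * (A ^ i * 2 ^ d) ^ 2 * c * (A ^ (d * i) * η ^ (d * i)) := by
          have := hC i
          gcongr
        _ = _ := by ring
  have hI3 : ∀ κ ∈ Finset.Ico (i+1) d, ∫⁻ b in (Lev d κ a : Set (Fin d → E)), W b ≤
      ENNReal.ofReal (M * C κ * ((2:ℝ) ^ d) ^ (κ * d) * A ^ (d * d) * (y * η ^ (d * i))) := by
    intro κ hκ
    have hκ := Finset.mem_Ico.1 hκ
    refine (wint (κ := κ) hi hκ.2 (measurableSet_Lev d κ a) (fun b hb => hb.1) hapos (fun b hb => hb.2.1) (fun b hb => hb.2.2)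
      (α := (2 ^ d * a) ^ κ) (K := C κ) (by positivity) ?_ (hC κ).le ?_).trans (ENNReal.ofReal_le_ofReal ?_)
    · intro b hb
      calc PP (ext0 b) κ ≤ ∏ k ∈ Finset.range κ, (2 ^ d * a) := by
            apply Finset.prod_le_prod (fun _ _ => rr_nonneg _ _)
            intro k hk
            exact hb.2.1 k (Finset.mem_range.1 hk)
        _ = _ := by simp
    · intro ε' hε'
      refine le_trans (measure_mono ?_) ((hV κ (by omega) hκ.2 ε' hε' 1 one_pos (Or.inl rfl)).trans (by simp))
      rintro b ⟨hb, hb2⟩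
      exact ⟨hb.1, hb2, Or.inl rfl⟩
    · have e : (a ^ κ) ^ i * (a ^ κ) ^ (d - i) = A ^ (κ * d) * η ^ (κ * d) := by
        rw [← pow_add, ← pow_mul, ha, mul_pow]
        have : κ * (i + (d - i)) = κ * d := by congr 1; omega
        rw [this]
      have h7 : ((2:ℝ) ^ d) ^ (κ * (d - i)) ≤ (2 ^ d) ^ (κ * d) := by
        apply pow_le_pow_right₀ (one_le_pow₀ (by norm_num))
        exact Nat.mul_le_mul le_rfl (by omega)
      have h8 : A ^ (κ * d) ≤ A ^ (d * d) := by
        apply pow_le_pow_right₀ hA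
        exact Nat.mul_le_mul (by omega) le_rfl
      have h9 : η ^ (κ * d) ≤ y * η ^ (d * i) := by
        calc η ^ (κ * d) ≤ η ^ (1 + d * i) := by
              apply pow_le_pow_of_le_one hηpos.le (hηy.trans hy1)
              calc 1 + d * i ≤ d + d * i := by omega
                _ = (i+1) * d := by ring
                _ ≤ κ * d := Nat.mul_le_mul (by omega) le_rfl
          _ = η * η ^ (d * i) := by rw [pow_add, pow_one]
          _ ≤ _ := by gcongr
      rw [mul_pow (2 ^ d), mul_pow _ (a ^ κ) i, mul_pow _ (a ^ κ), ← pow_mul _ κ (d - i)]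
      calc _ = M * C κ * ((2:ℝ) ^ d) ^ (κ * (d-i)) * ((a ^ κ) ^ i * (a ^ κ) ^ (d - i)) := by
            simp only [hM]; ring
        _ = M * C κ * ((2:ℝ) ^ d) ^ (κ * (d-i)) * (A ^ (κ * d) * η ^ (κ * d)) := by rw [e]
        _ ≤ M * C κ * ((2:ℝ) ^ d) ^ (κ * d) * (A ^ (d * d) * (y * η ^ (d * i))) := by
          have := hC κ
          gcongr
        _ = _ := by ring
  have hI4 : ∫⁻ b in ⋃ κ ∈ Finset.Ico (i+1) d, (Lev d κ a : Set (Fin d → E)), W b ≤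
      ENNReal.ofReal (X * (y * η ^ (d * i))) := by
    calc _ ≤ ∑ κ ∈ Finset.Ico (i+1) d, ∫⁻ b in (Lev d κ a : Set (Fin d → E)), W b := by
            exact lintegral_biUnion_le _ _ _
      _ ≤ ∑ κ ∈ Finset.Ico (i+1) d, ENNReal.ofReal (M * C κ * ((2:ℝ) ^ d) ^ (κ * d) * A ^ (d * d) * (y * η ^ (d * i))) :=
            Finset.sum_le_sum hI3
      _ = _ := by
            rw [← ENNReal.ofReal_sum_of_nonneg, hX, Finset.sum_mul]
            intro κ _
            have := hC κ
            positivity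
  calc _ ≤ ∫⁻ b in (X1 ∪ X2) ∪ ⋃ κ ∈ Finset.Ico (i+1) d, Lev d κ a, W b := lintegral_mono_set hcov
    _ ≤ ((∫⁻ b in X1, W b) + ∫⁻ b in X2, W b) + ∫⁻ b in ⋃ κ ∈ Finset.Ico (i+1) d, Lev d κ a, W b :=
        (lintegral_union_le _ _ _).trans (add_le_add (lintegral_union_le _ _ _) le_rfl)
    _ ≤ (ENNReal.ofReal (M * C i * c * A ^ (d * i) * η ^ (d * i)) + ENNReal.ofReal (M * C i * (A ^ i * 2 ^ d) ^ 2 * c * A ^ (d * i) * η ^ (d * i))) + ENNReal.ofReal (X * (y * η ^ (d * i))) :=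
        add_le_add (add_le_add hI1 hI2) hI4
    _ ≤ _ := by
        have := hC i
        rw [← ENNReal.ofReal_add (by positivity) (by positivity), ← ENNReal.ofReal_add (by positivity) (by positivity)]
        apply ENNReal.ofReal_le_ofReal
        have h1 : X * y ≤ ε / 2 := by
          calc X * y ≤ (X+1) * (ε / 2 / (X+1)) := by
                gcongr; linarith
            _ = _ := by field_simp
        have h2 : 0 < η ^ (d * i) := by positivity
        calc _ = ((M * C i * c * A ^ (d * i) + M * C i * (A ^ i * 2 ^ d) ^ 2 * c * A ^ (d * i)) + X * y) * η ^ (d * i) := by ring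
          _ ≤ (ε/2 + ε/2) * η ^ (d * i) := by gcongr
          _ = _ := by ring

end V2
end KM

open MeasureTheory
open scoped ENNReal
set_option linter.unusedSectionVars false
namespace KM
open InnerProductSpace

section Vec
variable {κ ν : Type*} [Fintype κ] [Fintype ν] [DecidableEq κ] [DecidableEq ν]

/-- vectorization as a measurable equivalence -/
def vcE (κ ν : Type*) : (κ → ν → ℝ) ≃ᵐ (ν × κ → ℝ) where
  toFun X := fun p => X p.2 p.1
  invFun x := fun k n => x (n, k)
  left_inv X := rfl
  right_inv x := rfl
  measurable_toFun := by
    refine measurable_pi_iff.2 fun p => ?_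
    exact (measurable_pi_apply p.1).comp (measurable_pi_apply p.2)
  measurable_invFun := by
    refine measurable_pi_iff.2 fun k => measurable_pi_iff.2 fun n => ?_
    exact measurable_pi_apply _

/-- uncurrying as a measurable equivalence -/
def ucE (κ ν : Type*) : (κ → ν → ℝ) ≃ᵐ (κ × ν → ℝ) where
  toFun X := fun p => X p.1 p.2
  invFun x := fun k n => x (k, n)
  left_inv X := rfl
  right_inv x := rfl
  measurable_toFun := by
    refine measurable_pi_iff.2 fun p => ?_
    exact (measurable_pi_apply p.2).comp (measurable_pi_apply p.1)
  measurable_invFun := by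
    refine measurable_pi_iff.2 fun k => measurable_pi_iff.2 fun n => ?_
    exact measurable_pi_apply _

lemma vcE_mp : MeasurePreserving (vcE κ ν) volume volume := by
  refine ⟨(vcE κ ν).measurable, ?_⟩
  symm
  apply Measure.pi_eq
  intro s hs
  rw [(vcE κ ν).map_apply]
  have : (vcE κ ν) ⁻¹' (Set.univ.pi s) = Set.univ.pi (fun k => Set.univ.pi (fun n => s (n, k))) := by
    ext X
    simp only [Set.mem_preimage, Set.mem_pi, Set.mem_univ, true_imp_iff]
    exact ⟨fun h k n => h (n, k), fun h p => h p.2 p.1⟩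
  rw [this, volume_pi_pi]
  simp only [volume_pi_pi]
  rw [Fintype.prod_prod_type_right]

lemma ucE_mp : MeasurePreserving (ucE κ ν) volume volume := by
  refine ⟨(ucE κ ν).measurable, ?_⟩
  symm
  apply Measure.pi_eq
  intro s hs
  rw [(ucE κ ν).map_apply]
  have : (ucE κ ν) ⁻¹' (Set.univ.pi s) = Set.univ.pi (fun k => Set.univ.pi (fun n => s (k, n))) := by
    ext X
    simp only [Set.mem_preimage, Set.mem_pi, Set.mem_univ, true_imp_iff]
    exact ⟨fun h k n => h (k, n), fun h p => h p.1 p.2⟩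
  rw [this, volume_pi_pi]
  simp only [volume_pi_pi]
  rw [Fintype.prod_prod_type]

lemma tr_mp : MeasurePreserving (fun (X : κ → ν → ℝ) => fun n k => X k n) volume volume :=
  ((ucE_mp (κ := ν) (ν := κ)).symm (ucE ν κ)).comp vcE_mp

open scoped Kronecker in
lemma lmr (A : Matrix κ κ ℝ) (C : Matrix ν ν ℝ) (hA : A.det ≠ 0) (hC : C.det ≠ 0)
    {F : (κ → ν → ℝ) → ℝ≥0∞} (hF : Measurable F) :
    ∫⁻ X : κ → ν → ℝ, F (A * Matrix.of X * C) =
      ENNReal.ofReal ((|A.det| ^ Fintype.card ν * |C.det| ^ Fintype.card κ)⁻¹) * ∫⁻ X, F X := by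
  have hM : (C.transpose ⊗ₖ A).det = C.det ^ Fintype.card κ * A.det ^ Fintype.card ν := by
    rw [Matrix.det_kronecker, Matrix.det_transpose]
  have hM0 : (C.transpose ⊗ₖ A).det ≠ 0 := by
    rw [hM]; exact mul_ne_zero (pow_ne_zero _ hC) (pow_ne_zero _ hA)
  let G : (ν × κ → ℝ) → ℝ≥0∞ := fun x => F ((vcE κ ν).symm x)
  have hG : Measurable G := hF.comp (vcE κ ν).symm.measurable
  have h1 : ∀ X : κ → ν → ℝ, F (A * Matrix.of X * C) =
      G (Matrix.toLin' (C.transpose ⊗ₖ A) (vcE κ ν X)) := by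
    intro X
    have := Matrix.kronecker_mulVec_vec A (Matrix.of X) C.transpose
    rw [Matrix.transpose_transpose] at this
    have h2 : (vcE κ ν X) = Matrix.vec (Matrix.of X) := rfl
    rw [h2, Matrix.toLin'_apply, this]
    rfl
  have hm : Measurable (Matrix.toLin' (C.transpose ⊗ₖ A)) :=
    (LinearMap.continuous_of_finiteDimensional _).measurable
  simp only [h1]
  rw [vcE_mp.lintegral_comp (f := fun x => G (Matrix.toLin' (C.transpose ⊗ₖ A) x)) (hG.comp hm),
    ← lintegral_map hG hm, Real.map_matrix_volume_pi_eq_smul_volume_pi hM0, lintegral_smul_measure,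
    ← vcE_mp.lintegral_comp hG, hM]
  congr 1
  rw [abs_inv, abs_mul, abs_pow, abs_pow, mul_comm]

end Vec

section Cols
variable {ι : Type*} [Fintype ι] [DecidableEq ι] {d : ℕ}

/-- columns of a matrix -/
def cols (e : Fin d ≃ ι) (g : ι → ι → ℝ) : Fin d → EuclideanSpace ℝ ι :=
  fun k => WithLp.toLp 2 (fun i => g i (e k))

lemma cols_mp (e : Fin d ≃ ι) : MeasurePreserving (cols e) volume volume := by
  have h1 := tr_mp (κ := ι) (ν := ι)
  have h2 := volume_measurePreserving_piCongrLeft (fun _ : Fin d => ι → ℝ) e.symm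
  have h3 := volume_preserving_pi (fun _ : Fin d => PiLp.volume_preserving_toLp ι)
  have := h3.comp (h2.comp h1)
  have hf : cols e = ((fun (a : Fin d → ι → ℝ) i => WithLp.toLp 2 (a i)) ∘
      (MeasurableEquiv.piCongrLeft (fun _ => ι → ℝ) e.symm) ∘ fun (X : ι → ι → ℝ) n k => X k n) := by
   funext g k
   have h4 := Equiv.piCongrLeft_apply_apply (fun _ : Fin d => ι → ℝ) e.symm (fun n k => g k n) (e k)
   rw [e.symm_apply_apply] at h4
   simp only [Function.comp_apply, MeasurableEquiv.coe_piCongrLeft]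
   rw [h4]; rfl
  rw [hf]; exact this

lemma finrank_E (e : Fin d ≃ ι) : Module.finrank ℝ (EuclideanSpace ℝ ι) = d := by
  rw [finrank_euclideanSpace, ← Fintype.card_congr e, Fintype.card_fin]

lemma PP_cols (e : Fin d ≃ ι) (g : ι → ι → ℝ) : PP (ext0 (cols e g)) d = |(Matrix.of g).det| := by
  have h := det_gram d (ext0 (cols e g))
  have h2 : (Matrix.of fun k l : Fin d => inner ℝ (ext0 (cols e g) k) (ext0 (cols e g) l)) =
      ((Matrix.of g).transpose * Matrix.of g).submatrix e e := by
    ext k l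
    simp only [Matrix.of_apply, ext0_fin, Matrix.submatrix_apply, Matrix.mul_apply, Matrix.transpose_apply]
    simp [cols, PiLp.inner_apply, mul_comm]
  rw [h2, Matrix.det_submatrix_equiv_self, Matrix.det_mul, Matrix.det_transpose, ← sq] at h
  have h3 : 0 ≤ PP (ext0 (cols e g)) d := Finset.prod_nonneg fun _ _ => rr_nonneg _ _
  rw [← abs_of_nonneg h3]
  exact (sq_eq_sq_iff_abs_eq_abs _ _).1 h.symm

lemma cols_mul (e : Fin d ≃ ι) (M : Matrix ι ι ℝ) (g : ι → ι → ℝ) (k : Fin d) :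
    cols e (M * Matrix.of g) k = Matrix.toEuclideanLin M (cols e g k) := by
  ext i
  simp [cols, Matrix.mul_apply, Matrix.mulVec, dotProduct]

end Cols
end KM

open MeasureTheory
open scoped ENNReal
set_option linter.unusedSectionVars false
namespace KM
open InnerProductSpace

/-- a matrix as a function -/
def mf {κ ν : Type*} (M : Matrix κ ν ℝ) : κ → ν → ℝ := fun i j => M i j

@[simp] lemma of_mf {κ ν : Type*} (M : Matrix κ ν ℝ) : Matrix.of (mf M) = M := rfl
@[simp] lemma mf_of {κ ν : Type*} (g : κ → ν → ℝ) : mf (Matrix.of g) = g := rfl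

lemma lmr' {κ ν : Type*} [Fintype κ] [Fintype ν] [DecidableEq κ] [DecidableEq ν]
    (A : Matrix κ κ ℝ) (C : Matrix ν ν ℝ) (hA : A.det ≠ 0) (hC : C.det ≠ 0)
    {F : (κ → ν → ℝ) → ℝ≥0∞} (hF : Measurable F) :
    ∫⁻ X : κ → ν → ℝ, F (mf (A * Matrix.of X * C)) =
      ENNReal.ofReal ((|A.det| ^ Fintype.card ν * |C.det| ^ Fintype.card κ)⁻¹) * ∫⁻ X, F X :=
  lmr A C hA hC hF

lemma meas_mf {κ ν : Type*} [Fintype κ] [Fintype ν] (A : Matrix κ κ ℝ) (C : Matrix ν ν ℝ) :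
    Measurable fun g : κ → ν → ℝ => mf (A * Matrix.of g * C) := by
  have : Continuous fun g : κ → ν → ℝ => (A * Matrix.of g * C : Matrix κ ν ℝ) :=
    (continuous_const.matrix_mul continuous_id).matrix_mul continuous_const
  have h2 : Continuous fun g : κ → ν → ℝ => mf (A * Matrix.of g * C) := this
  exact h2.measurable

section Mult
variable {ι : Type*} [Fintype ι] [DecidableEq ι]

/-- real matrix of a unimodular matrix -/
def rm (γ : (Matrix ι ι ℤ)ˣ) : Matrix ι ι ℝ := (γ : Matrix ι ι ℤ).map (Int.cast : ℤ → ℝ)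

lemma rm_mul (γ δ : (Matrix ι ι ℤ)ˣ) : rm (γ * δ) = rm γ * rm δ := by
  unfold rm
  rw [Units.val_mul]
  exact Matrix.map_mul (f := Int.castRingHom ℝ)

lemma rm_one : rm (1 : (Matrix ι ι ℤ)ˣ) = 1 := by
  unfold rm; simp

lemma abs_det_rm (γ : (Matrix ι ι ℤ)ˣ) : |(rm γ).det| = 1 := by
  have h : (rm γ).det = ((γ : Matrix ι ι ℤ).det : ℝ) := by
    unfold rm
    exact (RingHom.map_det (Int.castRingHom ℝ) (γ : Matrix ι ι ℤ)).symm
  rw [h]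
  have : IsUnit (γ : Matrix ι ι ℤ).det := (Matrix.isUnit_iff_isUnit_det _).1 γ.isUnit
  rcases Int.isUnit_iff.1 this with h | h <;> rw [h] <;> simp

instance : Countable (Matrix ι ι ℤ)ˣ := by
  have : Countable (Matrix ι ι ℤ) := inferInstanceAs (Countable (ι → ι → ℤ))
  exact Function.Injective.countable (f := Units.val) Units.val_injective

/-- bounded matrices with determinant bounded below -/
def KK (C : ℝ) : Set (ι → ι → ℝ) := {g | (∀ i j, |g i j| ≤ C) ∧ 1/2 ≤ |(Matrix.of g).det|}

lemma measurableSet_KK (C : ℝ) : MeasurableSet (KK C : Set (ι → ι → ℝ)) := by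
  refine MeasurableSet.inter ?_ ?_
  · have : MeasurableSet {g : ι → ι → ℝ | ∀ i j, |g i j| ≤ C} := by
      simp only [Set.ofPred_forall]
      refine MeasurableSet.iInter fun i => MeasurableSet.iInter fun j => ?_
      exact measurableSet_le (by fun_prop) measurable_const
    exact this
  · have : Continuous fun g : ι → ι → ℝ => |(Matrix.of g).det| := by
      apply Continuous.abs
      apply Continuous.matrix_det
      exact continuous_id
    have h : MeasurableSet {g : ι → ι → ℝ | 1/2 ≤ |(Matrix.of g).det|} :=
      measurableSet_le measurable_const this.measurable
    exact h

lemma isCompact_KK (C : ℝ) : IsCompact (KK C : Set (ι → ι → ℝ)) := by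
  have h1 : IsCompact (Set.univ.pi fun _ : ι => Set.univ.pi fun _ : ι => Set.Icc (-C) C) :=
    isCompact_univ_pi fun _ => isCompact_univ_pi fun _ => isCompact_Icc
  refine h1.of_isClosed_subset ?_ ?_
  · have c1 : Continuous fun g : ι → ι → ℝ => |(Matrix.of g).det| := by
      apply Continuous.abs
      apply Continuous.matrix_det
      exact continuous_id
    refine IsClosed.inter ?_ (isClosed_le continuous_const c1)
    have : IsClosed {g : ι → ι → ℝ | ∀ i j, |g i j| ≤ C} := by
      simp only [Set.ofPred_forall]
      refine isClosed_iInter fun i => isClosed_iInter fun j => ?_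
      exact isClosed_le (by fun_prop) continuous_const
    exact this
  · rintro g ⟨hg, _⟩ i _ j _
    exact abs_le.1 (hg i j)

lemma mult (C : ℝ) : ∃ M : ℝ≥0∞, M ≠ ⊤ ∧ ∀ g : Matrix ι ι ℝ,
    ∑' γ : (Matrix ι ι ℤ)ˣ, (KK C).indicator (fun _ => (1:ℝ≥0∞)) (mf (g * rm γ)) ≤ M := by
  -- bound on entries
  have hc : Continuous fun p : (ι → ι → ℝ) × (ι → ι → ℝ) =>
      ∑ i, ∑ j, |((Matrix.of p.1).adjugate * Matrix.of p.2) i j| := by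
    refine continuous_finsetSum _ fun i _ => continuous_finsetSum _ fun j _ => ?_
    apply Continuous.abs
    apply Continuous.matrix_elem
    apply Continuous.matrix_mul
    · apply Continuous.matrix_adjugate
      exact continuous_fst
    · exact continuous_snd
  obtain ⟨N, hN⟩ := ((isCompact_KK (ι := ι) C).prod (isCompact_KK C)).bddAbove_image hc.continuousOn
  obtain ⟨N', hN'⟩ := exists_nat_ge (2 * N)
  let F : Set (Matrix ι ι ℤ)ˣ := {γ | ∀ i j, |(γ : Matrix ι ι ℤ) i j| ≤ N'}
  have hF : F.Finite := by
    have h1 : (Set.univ.pi fun _ : ι => Set.univ.pi fun _ : ι => Set.Icc (-(N':ℤ)) N').Finite :=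
      Set.Finite.pi fun _ => Set.Finite.pi fun _ => Set.finite_Icc _ _
    refine Set.Finite.of_finite_image (f := fun γ : (Matrix ι ι ℤ)ˣ => (γ : Matrix ι ι ℤ)) (h1.subset ?_)
      (Units.val_injective.injOn)
    rintro _ ⟨γ, hγ, rfl⟩ i _ j _
    exact abs_le.1 (hγ i j)
  refine ⟨∑' γ : (Matrix ι ι ℤ)ˣ, F.indicator (fun _ => (1:ℝ≥0∞)) γ, ?_, fun g => ?_⟩
  · rw [← tsum_subtype]
    have : Fintype F := hF.fintype
    rw [tsum_fintype]
    simp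
  by_cases hg : ∃ γ0, mf (g * rm γ0) ∈ KK C
  · obtain ⟨γ0, hγ0⟩ := hg
    rw [← (Equiv.mulLeft γ0).tsum_eq]
    refine ENNReal.tsum_le_tsum fun γ => ?_
    by_cases h : mf (g * rm (Equiv.mulLeft γ0 γ)) ∈ KK C
    · rw [Set.indicator_of_mem h, Set.indicator_of_mem]
      intro i j
      simp only [Equiv.coe_mulLeft, rm_mul, ← mul_assoc] at h
      set g0 := g * rm γ0
      have h2 := hN ⟨(mf g0, mf (g0 * rm γ)), ⟨hγ0, h⟩, rfl⟩
      have h3 : |(g0.adjugate * (g0 * rm γ)) i j| ≤ N := by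
        refine le_trans ?_ h2
        refine le_trans ?_ (Finset.single_le_sum (f := fun i => ∑ j, |(g0.adjugate * (g0 * rm γ)) i j|) (fun i _ => Finset.sum_nonneg fun j _ => abs_nonneg _) (Finset.mem_univ i))
        exact Finset.single_le_sum (f := fun j => |(g0.adjugate * (g0 * rm γ)) i j|) (fun j _ => abs_nonneg _) (Finset.mem_univ j)
      have h4 : g0.adjugate * (g0 * rm γ) = g0.det • rm γ := by
        rw [← mul_assoc, Matrix.adjugate_mul, Matrix.smul_mul, one_mul]
      rw [h4, Matrix.smul_apply, smul_eq_mul, abs_mul] at h3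
      have h5 : 1/2 ≤ |g0.det| := hγ0.2
      have h6 : |rm γ i j| ≤ 2 * N := by
        have := abs_nonneg (rm γ i j)
        nlinarith
      have h7 := h6.trans hN'
      have h8 : rm γ i j = (((γ : Matrix ι ι ℤ) i j : ℤ) : ℝ) := rfl
      rw [h8] at h7
      exact_mod_cast h7
    · rw [Set.indicator_of_notMem h]; exact zero_le
  · push Not at hg
    rw [ENNReal.tsum_eq_zero.2]
    · exact zero_le
    · intro γ; exact Set.indicator_of_notMem (hg γ) _

lemma unfold_sum (C : ℝ) : ∃ M : ℝ≥0∞, M ≠ ⊤ ∧ ∀ F : (ι → ι → ℝ) → ℝ≥0∞, Measurable F →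
    ∫⁻ g in (KK C : Set (ι → ι → ℝ)), ∑' γ : (Matrix ι ι ℤ)ˣ, F (mf (Matrix.of g * rm γ)) ≤ M * ∫⁻ g, F g := by
  obtain ⟨M, hM, hmult⟩ := mult (ι := ι) C
  refine ⟨M, hM, fun F hF => ?_⟩
  have hmr : ∀ γ : (Matrix ι ι ℤ)ˣ, Measurable fun g : ι → ι → ℝ => mf (Matrix.of g * rm γ : Matrix ι ι ℝ) := by
    intro γ
    have := meas_mf (1 : Matrix ι ι ℝ) (rm γ)
    simpa only [one_mul] using this
  have hind : Measurable ((KK C : Set (ι → ι → ℝ)).indicator (fun _ => (1:ℝ≥0∞))) :=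
    measurable_const.indicator (measurableSet_KK C)
  rw [lintegral_tsum (f := fun γ g => F (mf (Matrix.of g * rm γ))) fun γ => (hF.comp (hmr γ)).aemeasurable]
  have h1 : ∀ γ : (Matrix ι ι ℤ)ˣ, ∫⁻ g in (KK C : Set (ι → ι → ℝ)), F (mf (Matrix.of g * rm γ)) =
      ∫⁻ g : ι → ι → ℝ, (KK C).indicator (fun _ => (1:ℝ≥0∞)) (mf (Matrix.of g * rm γ⁻¹)) * F g := by
    intro γ
    let G : (ι → ι → ℝ) → ℝ≥0∞ := fun g => (KK C).indicator (fun _ => (1:ℝ≥0∞)) (mf (Matrix.of g * rm γ⁻¹)) * F g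
    have hG : Measurable G := (hind.comp (hmr γ⁻¹)).mul hF
    have h2 := lmr' (1 : Matrix ι ι ℝ) (rm γ) (by simp) (by
      have := abs_det_rm γ
      intro h; rw [h] at this; simp at this) hG
    rw [abs_det_rm] at h2
    simp only [Matrix.det_one, abs_one, one_pow, mul_one, inv_one, ENNReal.ofReal_one, one_mul] at h2
    change _ = ∫⁻ g, G g
    rw [← h2, ← lintegral_indicator (measurableSet_KK C)]
    apply lintegral_congr
    intro g
    simp only [G]
    have h3 : mf (Matrix.of (mf (Matrix.of g * rm γ)) * rm γ⁻¹ : Matrix ι ι ℝ) = g := by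
      rw [of_mf, mul_assoc, ← rm_mul, mul_inv_cancel, rm_one, mul_one, mf_of]
    rw [h3]
    by_cases h : g ∈ KK C
    · rw [Set.indicator_of_mem h, Set.indicator_of_mem h, one_mul]
    · rw [Set.indicator_of_notMem h, Set.indicator_of_notMem h, zero_mul]
  simp only [h1]
  rw [← lintegral_tsum (f := fun γ g => (KK C).indicator (fun _ => (1:ℝ≥0∞)) (mf (Matrix.of g * rm γ⁻¹)) * F g) fun γ => ((hind.comp (hmr γ⁻¹)).mul hF).aemeasurable, ← lintegral_const_mul M hF]
  apply lintegral_mono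
  intro g
  simp only
  rw [ENNReal.tsum_mul_right]
  gcongr
  rw [← (Equiv.inv (Matrix ι ι ℤ)ˣ).tsum_eq]
  simp only [Equiv.inv_apply, inv_inv]
  exact hmult (Matrix.of g)

end Mult
end KM

open MeasureTheory
open scoped ENNReal
set_option linter.unusedSectionVars false
namespace KM
open InnerProductSpace

section Lattice
variable {ι : Type*} [Fintype ι] [DecidableEq ι] {d : ℕ}

/-- sequence of columns of a matrix -/
noncomputable def bb (e : Fin d ≃ ι) (M : Matrix ι ι ℝ) : ℕ → EuclideanSpace ℝ ι := ext0 (cols e (mf M))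

/-- integer combination of columns, as a vector in Euclidean space -/
noncomputable def lv (M : Matrix ι ι ℝ) (z : ι → ℤ) : EuclideanSpace ℝ ι :=
  WithLp.toLp 2 (M.mulVec fun k => (z k : ℝ))

lemma lc_bb (e : Fin d ≃ ι) (M : Matrix ι ι ℝ) (z : Fin d → ℤ) :
    lc d (bb e M) z = lv M (fun k => z (e.symm k)) := by
  ext i
  simp only [lc, bb, ext0_fin, lv, Matrix.mulVec, dotProduct]
  rw [← e.sum_comp]
  simp only [WithLp.ofLp_sum, Finset.sum_apply, WithLp.ofLp_smul, cols, mf, zsmul_eq_mul,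
    Equiv.symm_apply_apply]
  exact Finset.sum_congr rfl fun k _ => mul_comm _ _

lemma mem_lat_bb (e : Fin d ≃ ι) (M : Matrix ι ι ℝ) (x : EuclideanSpace ℝ ι) :
    x ∈ lat d (bb e M) ↔ ∃ z : ι → ℤ, lv M z = x := by
  rw [mem_lat]
  constructor
  · rintro ⟨z, rfl⟩
    exact ⟨_, (lc_bb e M z).symm⟩
  · rintro ⟨z, rfl⟩
    refine ⟨fun k => z (e k), ?_⟩
    rw [lc_bb]; simp

lemma lv_mul_rm (M : Matrix ι ι ℝ) (γ : (Matrix ι ι ℤ)ˣ) (z : ι → ℤ) :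
    lv (M * rm γ) z = lv M ((γ : Matrix ι ι ℤ).mulVec z) := by
  unfold lv
  rw [← Matrix.mulVec_mulVec]
  congr 2
  ext k
  simp [rm, Matrix.mulVec, dotProduct]

lemma lat_rm (e : Fin d ≃ ι) (M : Matrix ι ι ℝ) (γ : (Matrix ι ι ℤ)ˣ) :
    lat d (bb e (M * rm γ)) = lat d (bb e M) := by
  ext x
  rw [mem_lat_bb, mem_lat_bb]
  constructor
  · rintro ⟨z, rfl⟩; exact ⟨_, (lv_mul_rm M γ z).symm⟩
  · rintro ⟨z, rfl⟩
    refine ⟨((γ⁻¹ : (Matrix ι ι ℤ)ˣ) : Matrix ι ι ℤ).mulVec z, ?_⟩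
    rw [lv_mul_rm, Matrix.mulVec_mulVec]
    simp

lemma lv_mul (Q M : Matrix ι ι ℝ) (z : ι → ℤ) : lv (Q * M) z = Matrix.toEuclideanLin Q (lv M z) := by
  unfold lv
  rw [← Matrix.mulVec_mulVec]; rfl

lemma bb_mul (e : Fin d ≃ ι) (Q M : Matrix ι ι ℝ) : bb e (Q * M) = fun k => Matrix.toEuclideanLin Q (bb e M k) := by
  funext k
  unfold bb
  by_cases h : k < d
  · rw [ext0_lt _ h, ext0_lt _ h]
    exact cols_mul e Q (mf M) ⟨k, h⟩
  · simp [ext0, h]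

lemma PP_bb (e : Fin d ≃ ι) (M : Matrix ι ι ℝ) : PP (bb e M) d = |M.det| := PP_cols e (mf M)

lemma bb_li (e : Fin d ≃ ι) (M : Matrix ι ι ℝ) (hM : M.det ≠ 0) :
    LinearIndependent ℝ (fun k : Fin d => bb e M k) := by
  apply li_of_rr
  intro k hk
  have h := PP_bb e M
  have h2 : 0 < PP (bb e M) d := by rw [h]; positivity
  have h3 := rr_nonneg (bb e M) k
  rcases h3.lt_or_eq with h3 | h3
  · exact h3
  · exfalso
    unfold PP at h2
    rw [Finset.prod_eq_zero (Finset.mem_range.2 hk) h3.symm] at h2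
    exact lt_irrefl _ h2

lemma rr_congr {E : Type*} [NormedAddCommGroup E] [InnerProductSpace ℝ E] {b b' : ℕ → E} (k : ℕ) (h : ∀ j ≤ k, b j = b' j) : rr b k = rr b' k := by
  unfold rr; rw [gs_congr k h]

lemma IsRed.congr {E : Type*} [NormedAddCommGroup E] [InnerProductSpace ℝ E] {b b' : ℕ → E}
    (h : ∀ j < d, b j = b' j) (hb : IsRed d b) : IsRed d b' := by
  have h1 : ∀ k < d, rr b k = rr b' k := fun k hk => rr_congr k fun j hj => h j (lt_of_le_of_lt hj hk)
  have h2 : ∀ k < d, gs b k = gs b' k := fun k hk => gs_congr k fun j hj => h j (lt_of_le_of_lt hj hk)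
  refine ⟨fun k hk => ?_, fun k hk l hl => ?_, fun k hk => ?_⟩
  · rw [← h1 k hk]; exact hb.pos k hk
  · rw [← h2 l (hl.trans hk), ← h k hk, ← h1 l (hl.trans hk)]; exact hb.size k hk l hl
  · rw [← h1 k (by omega), ← h1 _ hk]; exact hb.ratio k hk

lemma exists_gamma_red (e : Fin d ≃ ι) (M : Matrix ι ι ℝ) (hM : M.det ≠ 0) :
    ∃ γ : (Matrix ι ι ℤ)ˣ, IsRed d (bb e (M * rm γ)) := by
  obtain ⟨b', h1, h2⟩ := exists_red (bb_li e M hM)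
  have h3 : ∀ j : ι, ∃ z : ι → ℤ, lv M z = b' (e.symm j) := fun j =>
    (mem_lat_bb e M _).1 (h1 ▸ mem_lat_of_lt b' (e.symm j).2)
  choose z hz using h3
  have h4 : ∀ j : ι, ∃ w : Fin d → ℤ, lc d b' w = bb e M (e.symm j) := fun j =>
    mem_lat.1 (h1 ▸ mem_lat_of_lt (bb e M) (e.symm j).2)
  choose w hw using h4
  let Zm : Matrix ι ι ℤ := Matrix.of fun i j => z j i
  let Wm : Matrix ι ι ℤ := Matrix.of fun i j => w j (e.symm i)
  have hZW : M * ((Zm * Wm).map (Int.cast : ℤ → ℝ)) = M := by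
    have hc : (Zm * Wm).map (Int.cast : ℤ → ℝ) = Zm.map Int.cast * Wm.map Int.cast :=
      Matrix.map_mul (f := Int.castRingHom ℝ)
    rw [hc, ← mul_assoc]
    ext i j
    have := congrArg (fun x : EuclideanSpace ℝ ι => x i) (hw j)
    simp only [lc, bb, ext0_fin, cols, WithLp.ofLp_sum, Finset.sum_apply, WithLp.ofLp_smul,
      Equiv.apply_symm_apply, mf, zsmul_eq_mul] at this
    rw [← this, Matrix.mul_apply, ← e.sum_comp]
    refine Finset.sum_congr rfl fun k _ => ?_
    have h5 := congrArg (fun x : EuclideanSpace ℝ ι => x i) (hz (e k))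
    simp only [Equiv.symm_apply_apply] at h5
    have h9 : ((w j k : (ι → ℝ)) * (b' k).ofLp) i = (w j k : ℝ) * (b' k).ofLp i := rfl
    refine Eq.trans ?_ h9.symm
    rw [← h5, mul_comm]
    simp [lv, Zm, Wm, Matrix.mulVec, dotProduct, Matrix.mul_apply]
  have h6 : (Zm * Wm).map (Int.cast : ℤ → ℝ) = 1 := by
    have hu : IsUnit M.det := isUnit_iff_ne_zero.2 hM
    have := congrArg (fun X => M⁻¹ * X) hZW
    simpa [← mul_assoc, Matrix.nonsing_inv_mul M hu] using this
  have h7 : Zm * Wm = 1 := by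
    ext i j
    have := congrFun (congrFun h6 i) j
    simp only [Matrix.map_apply] at this
    by_cases hij : i = j
    · subst hij; simp only [Matrix.one_apply_eq] at this ⊢; exact_mod_cast this
    · rw [Matrix.one_apply_ne hij] at this ⊢; exact_mod_cast this
  let γ : (Matrix ι ι ℤ)ˣ := ⟨Zm, Wm, h7, mul_eq_one_comm.1 h7⟩
  refine ⟨γ, h2.congr fun k hk => ?_⟩
  have h8 : b' k = lv M (z (e ⟨k, hk⟩)) := by rw [hz]; simp
  rw [h8]
  ext i
  simp [bb, ext0, hk, cols, mf, lv, rm, γ, Zm, Matrix.mul_apply, Matrix.mulVec, dotProduct]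

end Lattice
end KM

open MeasureTheory
open scoped ENNReal
set_option linter.unusedSectionVars false
namespace KM
open InnerProductSpace

section Haar
variable {m n : ℕ}

/-- block assembly -/
def gm (t : Fin n → (Fin n ⊕ Fin m) → ℝ) (B : Fin m → Fin n → ℝ) (s : Fin m → Fin m → ℝ) :
    (Fin n ⊕ Fin m) → (Fin n ⊕ Fin m) → ℝ := Sum.elim t (fun r => Sum.elim (B r) (s r))

lemma measurable_gm : Measurable fun x : (Fin n → (Fin n ⊕ Fin m) → ℝ) × (Fin m → Fin n → ℝ) × (Fin m → Fin m → ℝ) =>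
    gm x.1 x.2.1 x.2.2 := by
  refine measurable_pi_iff.2 fun i => measurable_pi_iff.2 fun j => ?_
  rcases i with i | i
  · simp only [gm, Sum.elim_inl]; fun_prop
  · rcases j with j | j <;> simp only [gm, Sum.elim_inl, Sum.elim_inr] <;> fun_prop

lemma gm_mp : MeasurePreserving (fun x : (Fin n → (Fin n ⊕ Fin m) → ℝ) × (Fin m → Fin n → ℝ) × (Fin m → Fin m → ℝ) =>
    gm x.1 x.2.1 x.2.2) volume volume := by
  have h1 : MeasurePreserving (fun x : (Fin n → (Fin n ⊕ Fin m) → ℝ) × (Fin m → Fin n → ℝ) × (Fin m → Fin m → ℝ) =>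
    ucE _ _ (gm x.1 x.2.1 x.2.2)) volume volume := by
    refine ⟨(ucE _ _).measurable.comp measurable_gm, ?_⟩
    symm
    apply Measure.pi_eq
    intro s hs
    have hmm : Measurable (fun x : (Fin n → (Fin n ⊕ Fin m) → ℝ) × (Fin m → Fin n → ℝ) × (Fin m → Fin m → ℝ) =>
      ucE _ _ (gm x.1 x.2.1 x.2.2)) := (ucE _ _).measurable.comp measurable_gm
    rw [Measure.map_apply hmm (MeasurableSet.univ_pi hs)]
    have : (fun x : (Fin n → (Fin n ⊕ Fin m) → ℝ) × (Fin m → Fin n → ℝ) × (Fin m → Fin m → ℝ) =>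
      ucE _ _ (gm x.1 x.2.1 x.2.2)) ⁻¹' (Set.univ.pi s) =
      (Set.univ.pi fun i => Set.univ.pi fun j => s (Sum.inl i, j)) ×ˢ
      ((Set.univ.pi fun i => Set.univ.pi fun j => s (Sum.inr i, Sum.inl j)) ×ˢ
      (Set.univ.pi fun i => Set.univ.pi fun j => s (Sum.inr i, Sum.inr j))) := by
      ext ⟨t, B, u⟩
      simp only [Set.mem_preimage, Set.mem_pi, Set.mem_univ, true_imp_iff, Set.mem_prod]
      constructor
      · intro h
        exact ⟨fun i j => h (Sum.inl i, j), fun i j => h (Sum.inr i, Sum.inl j), fun i j => h (Sum.inr i, Sum.inr j)⟩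
      · rintro ⟨h1, h2, h3⟩ ⟨i | i, j⟩
        · exact h1 i j
        · rcases j with j | j
          · exact h2 i j
          · exact h3 i j
    rw [this, Measure.volume_eq_prod, Measure.prod_prod, Measure.volume_eq_prod, Measure.prod_prod]
    simp only [volume_pi_pi]
    rw [Fintype.prod_prod_type, Fintype.prod_sum_type]
    congr 1
    rw [← Finset.prod_mul_distrib]
    exact Finset.prod_congr rfl fun i _ => (Fintype.prod_sum_type (fun y => volume (s (Sum.inr i, y)))).symm
  have h2 := ((ucE_mp (κ := Fin n ⊕ Fin m) (ν := Fin n ⊕ Fin m)).symm (ucE _ _)).comp h1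
  have h3 : (fun x : (Fin n → (Fin n ⊕ Fin m) → ℝ) × (Fin m → Fin n → ℝ) × (Fin m → Fin m → ℝ) =>
    gm x.1 x.2.1 x.2.2) = ((ucE (Fin n ⊕ Fin m) (Fin n ⊕ Fin m)).symm) ∘ (fun x : (Fin n → (Fin n ⊕ Fin m) → ℝ) × (Fin m → Fin n → ℝ) × (Fin m → Fin m → ℝ) =>
    ucE _ _ (gm x.1 x.2.1 x.2.2)) := by
    funext x; simp
  rw [h3]; exact h2

lemma lintegral_gm {F : ((Fin n ⊕ Fin m) → (Fin n ⊕ Fin m) → ℝ) → ℝ≥0∞} (hF : Measurable F) :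
    ∫⁻ s : Fin m → Fin m → ℝ, ∫⁻ t : Fin n → (Fin n ⊕ Fin m) → ℝ, ∫⁻ B : Fin m → Fin n → ℝ, F (gm t B s) =
    ∫⁻ g, F g := by
  have hm : Measurable fun x : (Fin n → (Fin n ⊕ Fin m) → ℝ) × (Fin m → Fin n → ℝ) × (Fin m → Fin m → ℝ) =>
    F (gm x.1 x.2.1 x.2.2) := hF.comp (measurable_gm (m := m) (n := n))
  rw [← gm_mp.lintegral_comp hF, Measure.volume_eq_prod, lintegral_prod _ hm.aemeasurable]
  rw [lintegral_lintegral_swap]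
  · refine lintegral_congr fun t => ?_
    have h2 : Measurable fun y : (Fin m → Fin n → ℝ) × (Fin m → Fin m → ℝ) => F (gm t y.1 y.2) :=
      hm.comp (measurable_const.prodMk measurable_id)
    rw [Measure.volume_eq_prod, lintegral_prod_symm _ h2.aemeasurable]
  · refine Measurable.aemeasurable ?_
    have : Measurable fun y : ((Fin m → Fin m → ℝ) × (Fin n → (Fin n ⊕ Fin m) → ℝ)) × (Fin m → Fin n → ℝ) => F (gm y.1.2 y.2 y.1.1) :=
      hm.comp (by fun_prop : Measurable fun y : ((Fin m → Fin m → ℝ) × (Fin n → (Fin n ⊕ Fin m) → ℝ)) × (Fin m → Fin n → ℝ) => (y.1.2, y.2, y.1.1))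
    exact this.lintegral_prod_right'

lemma gm_mul (t : Fin n → (Fin n ⊕ Fin m) → ℝ) (s : Fin m → Fin m → ℝ) (B : Fin m → Fin n → ℝ) :
    mf (Matrix.of (gm t 0 s) * UB B) = gm (mf ((1 : Matrix (Fin n) (Fin n) ℝ) * Matrix.of t * UB B)) (mf (Matrix.of s * Matrix.of B * (1 : Matrix (Fin n) (Fin n) ℝ))) s := by
  funext i j
  rw [Matrix.one_mul, Matrix.mul_one]
  rcases i with i | i
  · simp [mf, gm, Matrix.mul_apply]
  · rcases j with j | j <;> simp [mf, gm, Matrix.mul_apply, UB, Fintype.sum_sum_type, Matrix.one_apply]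

lemma det_UB (B : Fin m → Fin n → ℝ) : (UB B).det = 1 := by
  unfold UB; rw [Matrix.det_fromBlocks_zero₁₂]; simp

lemma det_AQ (hm : 1 ≤ m) (hn : 1 ≤ n) {R : ℝ} (hR : 0 < R) : (AQ m n R).det = 1 := by
  unfold AQ
  rw [Matrix.det_diagonal, Fintype.prod_sum_type]
  simp only [Sum.elim_inl, Sum.elim_inr, Finset.prod_const, Finset.card_univ, Fintype.card_fin]
  rw [← Real.rpow_natCast, ← Real.rpow_natCast, ← Real.rpow_mul hR.le, ← Real.rpow_mul hR.le,
    neg_mul, inv_mul_cancel₀ (by positivity), inv_mul_cancel₀ (by positivity), Real.rpow_neg hR.le]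
  simp [hR.ne']

end Haar
end KM

open MeasureTheory
open scoped ENNReal
set_option linter.unusedSectionVars false
namespace KM
open InnerProductSpace

section Near
variable {ι : Type*} [Fintype ι] [DecidableEq ι]

/-- bi-Lipschitz near-identity matrices -/
structure Nice (q : Matrix ι ι ℝ) : Prop where
  le : ∀ v : EuclideanSpace ℝ ι, ‖Matrix.toEuclideanLin q v‖ ≤ 2 * ‖v‖
  ge : ∀ v : EuclideanSpace ℝ ι, ‖v‖ ≤ 2 * ‖Matrix.toEuclideanLin q v‖
  d1 : 1/2 ≤ |q.det|
  d2 : |q.det| ≤ 2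

lemma near_cont (φ : (ι → ι → ℝ) → ℝ) (hφ : Continuous φ) (h1 : φ (mf 1) = 1) :
    ∃ κ > (0:ℝ), ∀ g : ι → ι → ℝ, (∀ i j, |g i j - (1 : Matrix ι ι ℝ) i j| ≤ κ) → 1/2 ≤ φ g ∧ φ g ≤ 2 := by
  have hc := Metric.continuousAt_iff.1 (hφ.continuousAt (x := mf 1)) (1/2) (by norm_num)
  obtain ⟨κ, hκ, h⟩ := hc
  refine ⟨κ/2, by positivity, fun g hg => ?_⟩
  have : dist g (mf 1) < κ := by
    rw [dist_pi_lt_iff hκ]; intro i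
    rw [dist_pi_lt_iff hκ]; intro j
    rw [Real.dist_eq]
    have := hg i j
    simp only [mf]
    linarith
  have h2 := h this
  rw [Real.dist_eq, h1, abs_lt] at h2
  constructor <;> linarith [h2.1, h2.2]

lemma norm_le_of_coord (v : EuclideanSpace ℝ ι) {a : ℝ} (ha : 0 ≤ a) (h : ∀ i, |v i| ≤ a) :
    ‖v‖ ≤ Fintype.card ι * a := by
  rw [EuclideanSpace.norm_eq]
  apply Real.sqrt_le_iff.2
  refine ⟨by positivity, ?_⟩
  have h1 : ∑ i, ‖v i‖ ^ 2 ≤ Fintype.card ι * a ^ 2 := by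
    calc ∑ i, ‖v i‖ ^ 2 ≤ ∑ i : ι, a ^ 2 := Finset.sum_le_sum fun i _ => by
          have := h i
          rw [Real.norm_eq_abs]; gcongr
      _ = _ := by simp
  refine h1.trans ?_
  rw [mul_pow]
  gcongr
  exact_mod_cast Nat.le_self_pow two_ne_zero _

lemma abs_coord_le (v : EuclideanSpace ℝ ι) (i : ι) : |v i| ≤ ‖v‖ := by
  have := PiLp.norm_apply_le v i
  rwa [Real.norm_eq_abs] at this

lemma near_norm {κ : ℝ} (hκ0 : 0 ≤ κ) (hκ : Fintype.card ι * (Fintype.card ι * κ) ≤ 1/2) (q : Matrix ι ι ℝ)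
    (hq : ∀ i j, |q i j - (1 : Matrix ι ι ℝ) i j| ≤ κ) (v : EuclideanSpace ℝ ι) :
    ‖Matrix.toEuclideanLin q v - v‖ ≤ 1/2 * ‖v‖ := by
  have h1 : ∀ i, |(Matrix.toEuclideanLin q v - v) i| ≤ Fintype.card ι * κ * ‖v‖ := by
    intro i
    have : (Matrix.toEuclideanLin q v - v) i = ∑ j, (q i j - (1 : Matrix ι ι ℝ) i j) * v j := by
      simp only [sub_mul, Finset.sum_sub_distrib, Matrix.one_apply, ite_mul, one_mul, zero_mul,
        Finset.sum_ite_eq, Finset.mem_univ, if_true]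
      rfl
    rw [this]
    calc _ ≤ ∑ j, |(q i j - (1 : Matrix ι ι ℝ) i j) * v j| := Finset.abs_sum_le_sum_abs _ _
      _ ≤ ∑ j : ι, κ * ‖v‖ := Finset.sum_le_sum fun j _ => by
        rw [abs_mul]; exact mul_le_mul (hq i j) (abs_coord_le v j) (abs_nonneg _) hκ0
      _ = _ := by simp; ring
  refine (norm_le_of_coord _ (by positivity) h1).trans ?_
  have := norm_nonneg v
  nlinarith

lemma nice_of_near {κ : ℝ} (hκ0 : 0 ≤ κ) (hκ : Fintype.card ι * (Fintype.card ι * κ) ≤ 1/2) (q : Matrix ι ι ℝ)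
    (hq : ∀ i j, |q i j - (1 : Matrix ι ι ℝ) i j| ≤ κ) (h1 : 1/2 ≤ |q.det|) (h2 : |q.det| ≤ 2) : Nice q := by
  refine ⟨fun v => ?_, fun v => ?_, h1, h2⟩
  · have h3 := near_norm hκ0 hκ q hq v
    have h4 := norm_le_norm_add_norm_sub' (Matrix.toEuclideanLin q v) v
    have := norm_nonneg v
    linarith
  · have h3 := near_norm hκ0 hκ q hq v
    have h4 := norm_le_norm_add_norm_sub (Matrix.toEuclideanLin q v) v
    have := norm_nonneg v
    linarith
end Near

section Haar
variable {m n : ℕ}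

/-- cube of matrices -/
def cube (m n : ℕ) (Z : ℝ) : Set (Fin m → Fin n → ℝ) := {B | ∀ i j, |B i j| ≤ Z}

lemma measurableSet_cube (Z : ℝ) : MeasurableSet (cube m n Z) := by
  have : MeasurableSet {g : Fin m → Fin n → ℝ | ∀ i j, |g i j| ≤ Z} := by
    simp only [Set.ofPred_forall]
    refine MeasurableSet.iInter fun i => MeasurableSet.iInter fun j => ?_
    exact measurableSet_le (by fun_prop) measurable_const
  exact this

/-- boxes around a matrix -/
def nbx {κ ν : Type*} (p : κ → ν → ℝ) (r : ℝ) : Set (κ → ν → ℝ) := {g | ∀ i j, |g i j - p i j| ≤ r}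

lemma nbx_eq {κ ν : Type*} (p : κ → ν → ℝ) (r : ℝ) :
    nbx p r = Set.univ.pi fun i => Set.univ.pi fun j => Set.Icc (p i j - r) (p i j + r) := by
  ext g
  simp only [nbx, Set.mem_ofPred_eq, Set.mem_pi, Set.mem_univ, true_imp_iff, Set.mem_Icc]
  refine forall_congr' fun i => forall_congr' fun j => ?_
  rw [abs_le]
  constructor <;> intro h <;> constructor <;> linarith [h.1, h.2]

lemma measurableSet_nbx {κ ν : Type*} [Countable κ] [Countable ν] (p : κ → ν → ℝ) (r : ℝ) :
    MeasurableSet (nbx p r) := by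
  rw [nbx_eq]
  exact MeasurableSet.univ_pi fun i => MeasurableSet.univ_pi fun j => measurableSet_Icc

lemma volume_nbx {κ ν : Type*} [Fintype κ] [Fintype ν] (p : κ → ν → ℝ) (r : ℝ) :
    volume (nbx p r) = ENNReal.ofReal (2 * r) ^ (Fintype.card ν * Fintype.card κ) := by
  rw [nbx_eq, volume_pi_pi]
  simp only [volume_pi_pi, Real.volume_Icc]
  simp only [show ∀ x y : ℝ, x + y - (x - y) = 2 * y by intros; ring, Finset.prod_const, Finset.card_univ]
  rw [pow_mul]

/-- diagonal entries of AQ -/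
noncomputable def aq (m n : ℕ) (R : ℝ) : Fin n ⊕ Fin m → ℝ :=
  Sum.elim (fun _ : Fin n => R ^ (-(n : ℝ)⁻¹)) (fun _ : Fin m => R ^ ((m : ℝ)⁻¹))

lemma aq_pos {R : ℝ} (hR : 0 < R) (i : Fin n ⊕ Fin m) : 0 < aq m n R i := by
  rcases i with i | i <;> simp only [aq, Sum.elim_inl, Sum.elim_inr] <;> positivity

/-- top rows of identity -/
def t0 (m n : ℕ) : Fin n → (Fin n ⊕ Fin m) → ℝ := fun i j => (1 : Matrix (Fin n ⊕ Fin m) (Fin n ⊕ Fin m) ℝ) (Sum.inl i) j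

lemma near_gm {κ : ℝ} (hκ : 0 ≤ κ) {t : Fin n → (Fin n ⊕ Fin m) → ℝ} {s : Fin m → Fin m → ℝ}
    (ht : t ∈ nbx (t0 m n) κ) (hs : s ∈ nbx (mf 1) κ) (i j) :
    |gm t 0 s i j - (1 : Matrix (Fin n ⊕ Fin m) (Fin n ⊕ Fin m) ℝ) i j| ≤ κ := by
  rcases i with i | i
  · exact ht i j
  · rcases j with j | j
    · simpa [gm] using hκ
    · have := hs i j
      simpa [gm, mf, Matrix.one_apply] using this

lemma conj_near {κ : ℝ} (hκ : 0 ≤ κ) {t : Fin n → (Fin n ⊕ Fin m) → ℝ} {s : Fin m → Fin m → ℝ}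
    (ht : t ∈ nbx (t0 m n) κ) (hs : s ∈ nbx (mf 1) κ) {R : ℝ} (hR : 1 ≤ R) (i j) :
    |aq m n R i * gm t 0 s i j * (aq m n R j)⁻¹ - (1 : Matrix (Fin n ⊕ Fin m) (Fin n ⊕ Fin m) ℝ) i j| ≤ κ := by
  have hR0 : 0 < R := by linarith
  have h := near_gm hκ ht hs i j
  have key : aq m n R i = aq m n R j → |aq m n R i * gm t 0 s i j * (aq m n R j)⁻¹ - (1 : Matrix (Fin n ⊕ Fin m) (Fin n ⊕ Fin m) ℝ) i j| ≤ κ := by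
    intro he
    have : aq m n R i * gm t 0 s i j * (aq m n R j)⁻¹ = gm t 0 s i j := by
      rw [he]; have := (aq_pos (m := m) (n := n) hR0 j).ne'; field_simp
    rw [this]; exact h
  rcases i with i | i <;> rcases j with j | j
  · exact key rfl
  · have h1 : aq m n R (Sum.inl i) ≤ 1 := by
      simp only [aq, Sum.elim_inl]
      exact Real.rpow_le_one_of_one_le_of_nonpos hR (by simp)
    have h2 : 1 ≤ aq m n R (Sum.inr j) := by
      simp only [aq, Sum.elim_inr]
      exact Real.one_le_rpow hR (by positivity)
    have h3 := aq_pos (m := m) (n := n) hR0 (Sum.inl i)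
    rw [Matrix.one_apply_ne (by simp), sub_zero] at h ⊢
    rw [abs_mul, abs_mul, abs_of_pos h3, abs_of_pos (inv_pos.2 (aq_pos (m := m) (n := n) hR0 (Sum.inr j)))]
    have h4 : (aq m n R (Sum.inr j))⁻¹ ≤ 1 := inv_le_one_of_one_le₀ h2
    calc _ ≤ 1 * κ * 1 := by gcongr
      _ = κ := by ring
  · simpa [gm] using hκ
  · exact key rfl

theorem haar {d : ℕ} (e : Fin d ≃ Fin n ⊕ Fin m) (hm : 1 ≤ m) (hn : 1 ≤ n) (Z : ℝ) (hZ : 0 ≤ Z) : ∃ C : ℝ≥0∞, C ≠ ⊤ ∧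
    ∀ R : ℝ, 1 ≤ R → ∀ Ψ : (Fin d → EuclideanSpace ℝ (Fin n ⊕ Fin m)) → ℝ≥0∞, Measurable Ψ →
    ∀ Φ : (Fin m → Fin n → ℝ) → ℝ≥0∞,
    (∀ q : Matrix (Fin n ⊕ Fin m) (Fin n ⊕ Fin m) ℝ, Nice q → ∀ B ∈ cube m n Z, ∃ γ : (Matrix (Fin n ⊕ Fin m) (Fin n ⊕ Fin m) ℤ)ˣ,
      Φ B ≤ Ψ (cols e (mf (q * (AQ m n R * UB B) * rm γ)))) →
    ∫⁻ B in cube m n Z, Φ B ≤ C * ∫⁻ b, Ψ b := by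
  obtain ⟨κ1, hκ1, hd1⟩ := near_cont (ι := Fin n ⊕ Fin m) (fun g => |(Matrix.of g).det|)
    (by
      apply Continuous.abs
      apply Continuous.matrix_det
      exact continuous_id) (by simp)
  obtain ⟨κ2, hκ2, hd2⟩ := near_cont (ι := Fin m) (fun g => |(Matrix.of g).det| ^ n)
    (by
      apply Continuous.pow
      apply Continuous.abs
      apply Continuous.matrix_det
      exact continuous_id) (by simp)
  set D : ℝ := (Fintype.card (Fin n ⊕ Fin m) : ℝ) with hD
  have hDpos : 1 ≤ D := by
    rw [hD]; simp only [Fintype.card_sum, Fintype.card_fin]; exact_mod_cast (by omega : 1 ≤ n + m)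
  obtain ⟨κ, hκ, hκ1', hκ2', hκ3⟩ : ∃ κ > (0:ℝ), κ ≤ κ1 ∧ κ ≤ κ2 ∧ D * (D * κ) ≤ 1/2 := by
    refine ⟨min (min κ1 κ2) ((2 * D * D)⁻¹), by positivity, ?_, ?_, ?_⟩
    · exact (min_le_left _ _).trans (min_le_left _ _)
    · exact (min_le_left _ _).trans (min_le_right _ _)
    · calc _ ≤ D * (D * ((2 * D * D)⁻¹)) := by gcongr; exact min_le_right _ _
        _ = 1/2 := by field_simp
  have hκle : κ ≤ 1 := by
    have h1 : κ ≤ D * κ := le_mul_of_one_le_left hκ.le hDpos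
    have h2 : D * κ ≤ D * (D * κ) := le_mul_of_one_le_left (by positivity) hDpos
    linarith
  let Yt := nbx (t0 m n) κ
  let Ys : Set (Fin m → Fin m → ℝ) := nbx (mf 1) κ
  let Cb : ℝ := 2 + D * (2 * (Z + 1))
  obtain ⟨M, hM, hunf⟩ := unfold_sum (ι := Fin n ⊕ Fin m) Cb
  have hVt : volume Yt ≠ 0 ∧ volume Yt ≠ ⊤ := by
    simp only [Yt, volume_nbx]
    refine ⟨pow_ne_zero _ (by simpa using hκ), ENNReal.pow_ne_top ENNReal.ofReal_ne_top⟩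
  have hVs : volume Ys ≠ 0 ∧ volume Ys ≠ ⊤ := by
    simp only [Ys, volume_nbx]
    refine ⟨pow_ne_zero _ (by simpa using hκ), ENNReal.pow_ne_top ENNReal.ofReal_ne_top⟩
  set V := volume Yt * volume Ys with hV
  have hV0 : V ≠ 0 := mul_ne_zero hVt.1 hVs.1
  have hVT : V ≠ ⊤ := ENNReal.mul_ne_top hVt.2 hVs.2
  refine ⟨V⁻¹ * (2 * M), ENNReal.mul_ne_top (ENNReal.inv_ne_top.2 hV0) (ENNReal.mul_ne_top (by simp) hM), ?_⟩
  intro R hR Ψ hΨ Φ hΦ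
  have hR0 : 0 < R := by linarith
  suffices h : V * ∫⁻ B in cube m n Z, Φ B ≤ 2 * M * ∫⁻ b, Ψ b by
    calc ∫⁻ B in cube m n Z, Φ B = V⁻¹ * (V * ∫⁻ B in cube m n Z, Φ B) := by
          rw [← mul_assoc, ENNReal.inv_mul_cancel hV0 hVT, one_mul]
      _ ≤ V⁻¹ * (2 * M * ∫⁻ b, Ψ b) := by gcongr
      _ = _ := by ring
  -- the functions
  let F : ((Fin n ⊕ Fin m) → (Fin n ⊕ Fin m) → ℝ) → ℝ≥0∞ := fun g => Ψ (cols e (mf (AQ m n R * Matrix.of g * 1)))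
  have hF : Measurable F := hΨ.comp ((cols_mp e).measurable.comp (meas_mf _ _))
  have hmr : ∀ γ : (Matrix (Fin n ⊕ Fin m) (Fin n ⊕ Fin m) ℤ)ˣ, Measurable fun g : (Fin n ⊕ Fin m) → (Fin n ⊕ Fin m) → ℝ => mf (Matrix.of g * rm γ) := by
    intro γ
    have := meas_mf (1 : Matrix (Fin n ⊕ Fin m) (Fin n ⊕ Fin m) ℝ) (rm γ)
    simpa only [one_mul] using this
  let S : ((Fin n ⊕ Fin m) → (Fin n ⊕ Fin m) → ℝ) → ℝ≥0∞ := (KK Cb).indicator fun g => ∑' γ, F (mf (Matrix.of g * rm γ))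
  have hS : Measurable S := (Measurable.tsum (f := fun γ g => F (mf (Matrix.of g * rm γ))) (fun γ => hF.comp (hmr γ))).indicator (measurableSet_KK Cb)
  -- pointwise bound
  have hpt : ∀ B ∈ cube m n Z, ∀ s ∈ Ys, ∀ t ∈ Yt, Φ B ≤ S (mf (Matrix.of (gm t 0 s) * UB B)) := by
    intro B hB s hs t ht
    set p := Matrix.of (gm t 0 s) with hp
    have hnear := near_gm hκ.le ht hs
    have hdp := hd1 (gm t 0 s) (fun i j => (hnear i j).trans hκ1')
    have hmem : mf (p * UB B) ∈ KK Cb := by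
      refine ⟨fun i j => ?_, ?_⟩
      · have hpe : ∀ i j, |p i j| ≤ 2 := by
          intro i j
          have h1 := hnear i j
          have h2 : |(1 : Matrix (Fin n ⊕ Fin m) (Fin n ⊕ Fin m) ℝ) i j| ≤ 1 := by
            rw [Matrix.one_apply]; split_ifs <;> simp
          have h3 := abs_add_le (gm t 0 s i j - (1 : Matrix (Fin n ⊕ Fin m) (Fin n ⊕ Fin m) ℝ) i j) ((1 : Matrix (Fin n ⊕ Fin m) (Fin n ⊕ Fin m) ℝ) i j)
          rw [sub_add_cancel] at h3
          change |gm t 0 s i j| ≤ 2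
          linarith
        have hue : ∀ i j, |UB B i j| ≤ Z + 1 := by
          intro i j
          rcases i with i | i <;> rcases j with j | j <;> simp only [UB, Matrix.fromBlocks_apply₁₁, Matrix.fromBlocks_apply₁₂, Matrix.fromBlocks_apply₂₁, Matrix.fromBlocks_apply₂₂, Matrix.zero_apply, Matrix.of_apply]
          · rw [Matrix.one_apply]; split_ifs <;> simp <;> linarith
          · simp; linarith
          · have := hB i j; linarith
          · rw [Matrix.one_apply]; split_ifs <;> simp <;> linarith
        change |(p * UB B) i j| ≤ Cb
        rw [Matrix.mul_apply]
        calc _ ≤ ∑ k, |p i k * UB B k j| := Finset.abs_sum_le_sum_abs _ _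
          _ ≤ ∑ k : Fin n ⊕ Fin m, 2 * (Z + 1) := Finset.sum_le_sum fun k _ => by
            rw [abs_mul]; exact mul_le_mul (hpe _ _) (hue _ _) (abs_nonneg _) (by norm_num)
          _ = D * (2 * (Z + 1)) := by rw [Finset.sum_const, Finset.card_univ, nsmul_eq_mul]
          _ ≤ Cb := by simp only [Cb]; linarith
      · rw [of_mf, Matrix.det_mul, det_UB, mul_one]; exact hdp.1
    simp only [S]
    rw [Set.indicator_of_mem hmem]
    let q : Matrix (Fin n ⊕ Fin m) (Fin n ⊕ Fin m) ℝ := Matrix.of fun i j => aq m n R i * gm t 0 s i j * (aq m n R j)⁻¹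
    have hqA : q * AQ m n R = AQ m n R * p := by
      ext i j
      change (q * Matrix.diagonal (aq m n R)) i j = (Matrix.diagonal (aq m n R) * p) i j
      rw [Matrix.mul_diagonal, Matrix.diagonal_mul]
      simp only [q, p, Matrix.of_apply]
      have := (aq_pos (m := m) (n := n) hR0 j).ne'
      field_simp
    have hdet : q.det = p.det := by
      have := congrArg Matrix.det hqA
      rwa [Matrix.det_mul, Matrix.det_mul, det_AQ hm hn hR0, mul_one, one_mul] at this
    have hq : Nice q := nice_of_near hκ.le hκ3 q (conj_near hκ.le ht hs hR) (by rw [hdet]; exact hdp.1) (by rw [hdet]; exact hdp.2)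
    obtain ⟨γ, hγ⟩ := hΦ q hq B hB
    refine le_trans ?_ (ENNReal.le_tsum γ)
    refine hγ.trans (le_of_eq ?_)
    simp only [F, of_mf]
    rw [← mul_assoc q, hqA, mul_one]
    simp only [mul_assoc]
  -- integrate
  have hUm : Measurable fun y : (Fin m → Fin n → ℝ) × (Fin m → Fin m → ℝ) × (Fin n → (Fin n ⊕ Fin m) → ℝ) =>
      S (gm y.2.2 (mf (Matrix.of y.2.1 * Matrix.of y.1 * (1 : Matrix (Fin n) (Fin n) ℝ))) y.2.1) := by
    refine hS.comp (measurable_gm.comp (f := fun y : (Fin m → Fin n → ℝ) × (Fin m → Fin m → ℝ) × (Fin n → (Fin n ⊕ Fin m) → ℝ) => (y.2.2, (mf (Matrix.of y.2.1 * Matrix.of y.1 * (1 : Matrix (Fin n) (Fin n) ℝ))), y.2.1)) ?_)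
    refine Measurable.prodMk (by fun_prop) (Measurable.prodMk ?_ (by fun_prop))
    have : Continuous fun y : (Fin m → Fin n → ℝ) × (Fin m → Fin m → ℝ) × (Fin n → (Fin n ⊕ Fin m) → ℝ) =>
        (mf (Matrix.of y.2.1 * Matrix.of y.1 * (1 : Matrix (Fin n) (Fin n) ℝ))) := by
      simp only [Matrix.mul_one]
      exact Continuous.matrix_mul (A := fun y : (Fin m → Fin n → ℝ) × (Fin m → Fin m → ℝ) × (Fin n → (Fin n ⊕ Fin m) → ℝ) => Matrix.of y.2.1) (B := fun y => Matrix.of y.1) (continuous_fst.comp continuous_snd) continuous_fst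
    exact this.measurable
  calc V * ∫⁻ B in cube m n Z, Φ B = ∫⁻ B in cube m n Z, ∫⁻ s in Ys, ∫⁻ t in Yt, Φ B := by
        simp only [lintegral_const, Measure.restrict_apply MeasurableSet.univ, Set.univ_inter]
        simp only [mul_assoc]
        rw [lintegral_mul_const' _ _ hVT, mul_comm]
    _ ≤ ∫⁻ B in cube m n Z, ∫⁻ s in Ys, ∫⁻ t in Yt, S (mf (Matrix.of (gm t 0 s) * UB B)) := by
        refine setLIntegral_mono' (measurableSet_cube Z) fun B hB => ?_
        refine setLIntegral_mono' (measurableSet_nbx _ _) fun s hs => ?_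
        exact setLIntegral_mono' (measurableSet_nbx _ _) fun t ht => hpt B hB s hs t ht
    _ ≤ ∫⁻ B, ∫⁻ s in Ys, ∫⁻ t, S (mf (Matrix.of (gm t 0 s) * UB B)) := by
        refine (setLIntegral_le_lintegral _ _).trans ?_
        refine lintegral_mono fun B => lintegral_mono fun s => ?_
        exact setLIntegral_le_lintegral _ _
    _ = ∫⁻ B : Fin m → Fin n → ℝ, ∫⁻ s in Ys, ∫⁻ t, S (gm t (mf (Matrix.of s * Matrix.of B * (1 : Matrix (Fin n) (Fin n) ℝ))) s) := by
        refine lintegral_congr fun B => lintegral_congr fun s => ?_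
        simp only [gm_mul]
        rw [lmr' (1 : Matrix (Fin n) (Fin n) ℝ) (UB B) (by simp) (by rw [det_UB]; simp)
          (F := fun t => S (gm t (mf (Matrix.of s * Matrix.of B * (1 : Matrix (Fin n) (Fin n) ℝ))) s))
          (hS.comp (measurable_gm.comp (f := fun t => (t, (mf (Matrix.of s * Matrix.of B * (1 : Matrix (Fin n) (Fin n) ℝ))), s)) (measurable_id.prodMk measurable_const)))]
        rw [det_UB]; simp
    _ = ∫⁻ s in Ys, ∫⁻ t, ∫⁻ B : Fin m → Fin n → ℝ, S (gm t (mf (Matrix.of s * Matrix.of B * (1 : Matrix (Fin n) (Fin n) ℝ))) s) := by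
        rw [lintegral_lintegral_swap]
        · refine lintegral_congr fun s => ?_
          rw [lintegral_lintegral_swap]
          exact (hUm.comp (by fun_prop : Measurable fun y : (Fin m → Fin n → ℝ) × (Fin n → (Fin n ⊕ Fin m) → ℝ) => (y.1, s, y.2))).aemeasurable
        · refine Measurable.aemeasurable ?_
          have := hUm.comp (by fun_prop : Measurable fun y : ((Fin m → Fin n → ℝ) × (Fin m → Fin m → ℝ)) × (Fin n → (Fin n ⊕ Fin m) → ℝ) => (y.1.1, y.1.2, y.2))
          exact this.lintegral_prod_right'
    _ ≤ ∫⁻ s in Ys, ∫⁻ t, 2 * ∫⁻ B, S (gm t B s) := by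
        refine setLIntegral_mono' (measurableSet_nbx _ _) fun s hs => lintegral_mono fun t => ?_
        have hds := (hd2 s (fun i j => (hs i j).trans hκ2')).1
        have hs0 : (Matrix.of s).det ≠ 0 := by
          intro h0
          rw [h0, abs_zero, zero_pow (by omega)] at hds
          norm_num at hds
        rw [lmr' (Matrix.of s) (1 : Matrix (Fin n) (Fin n) ℝ) hs0 (by simp)
          (F := fun B => S (gm t B s))
          (hS.comp (measurable_gm.comp (measurable_const.prodMk (measurable_id.prodMk measurable_const))))]
        gcongr
        rw [ENNReal.ofReal_le_ofNat]
        simp only [Matrix.det_one, abs_one, one_pow, mul_one, Fintype.card_fin]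
        rw [inv_le_comm₀ (by linarith) (by norm_num)]
        simpa using hds
    _ ≤ ∫⁻ s, ∫⁻ t, 2 * ∫⁻ B, S (gm t B s) := setLIntegral_le_lintegral _ _
    _ = 2 * ∫⁻ g, S g := by
        have hx : ∀ s : Fin m → Fin m → ℝ, ∫⁻ t : Fin n → (Fin n ⊕ Fin m) → ℝ, 2 * (∫⁻ B : Fin m → Fin n → ℝ, S (gm t B s)) = 2 * ∫⁻ t : Fin n → (Fin n ⊕ Fin m) → ℝ, ∫⁻ B : Fin m → Fin n → ℝ, S (gm t B s) :=
          fun s => lintegral_const_mul' _ _ (by simp)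
        simp only [hx]
        rw [lintegral_const_mul' _ _ (by simp), lintegral_gm hS]
    _ ≤ 2 * (M * ∫⁻ g, F g) := by
        gcongr
        simp only [S]
        rw [lintegral_indicator (measurableSet_KK Cb)]
        exact hunf F hF
    _ = 2 * M * ∫⁻ b, Ψ b := by
        have h1 := lmr' (AQ m n R) (1 : Matrix (Fin n ⊕ Fin m) (Fin n ⊕ Fin m) ℝ) (by rw [det_AQ hm hn hR0]; simp) (by simp)
          (F := fun g => Ψ (cols e g)) (hΨ.comp (cols_mp e).measurable)
        rw [det_AQ hm hn hR0] at h1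
        simp only [abs_one, one_pow, Matrix.det_one, mul_one, inv_one, ENNReal.ofReal_one, one_mul] at h1
        have h2 : ∫⁻ g, F g = ∫⁻ g, Ψ (cols e g) := by
          simp only [F, mul_one]; exact h1
        rw [h2, (cols_mp e).lintegral_comp hΨ, mul_assoc]

end Haar
end KM

open MeasureTheory
open scoped ENNReal
set_option linter.unusedSectionVars false
namespace KM
open InnerProductSpace

section SV
variable {ι : Type*} [Fintype ι] [DecidableEq ι] {d : ℕ}

/-- existence of independent short lattice vectors -/
def SV (e : Fin d ≃ ι) (M : Matrix ι ι ℝ) (i : ℕ) (ρ : ℝ) : Prop :=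
  ∃ v : Fin i → EuclideanSpace ℝ ι, (∀ a, v a ∈ lat d (bb e M)) ∧ LinearIndependent ℝ v ∧ ∀ a, ‖v a‖ ≤ ρ

lemma SV.mono {e : Fin d ≃ ι} {M : Matrix ι ι ℝ} {i : ℕ} {ρ ρ' : ℝ} (h : SV e M i ρ) (hρ : ρ ≤ ρ') : SV e M i ρ' := by
  obtain ⟨v, h1, h2, h3⟩ := h
  exact ⟨v, h1, h2, fun a => (h3 a).trans hρ⟩

lemma sv_rm (e : Fin d ≃ ι) (M : Matrix ι ι ℝ) (γ : (Matrix ι ι ℤ)ˣ) (i : ℕ) (ρ : ℝ) :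
    SV e (M * rm γ) i ρ ↔ SV e M i ρ := by
  unfold SV; rw [lat_rm]

lemma lin_inj (Q : Matrix ι ι ℝ) (hQ : Q.det ≠ 0) : Function.Injective (Matrix.toEuclideanLin Q) := by
  rw [← LinearMap.ker_eq_bot, LinearMap.ker_eq_bot']
  intro v hv
  have h2 : Q.mulVec v.ofLp = 0 := congrArg WithLp.ofLp hv
  have := Matrix.eq_zero_of_mulVec_eq_zero hQ h2
  ext i; exact congrFun this i

lemma sv_mul (e : Fin d ≃ ι) (Q M : Matrix ι ι ℝ) (hQ : Q.det ≠ 0) {C : ℝ} (hC : 0 ≤ C)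
    (hn : ∀ v : EuclideanSpace ℝ ι, ‖Matrix.toEuclideanLin Q v‖ ≤ C * ‖v‖) {i : ℕ} {ρ : ℝ} (h : SV e M i ρ) :
    SV e (Q * M) i (C * ρ) := by
  obtain ⟨v, h1, h2, h3⟩ := h
  refine ⟨fun a => Matrix.toEuclideanLin Q (v a), fun a => ?_, ?_, fun a => ?_⟩
  · rw [mem_lat_bb]
    obtain ⟨z, hz⟩ := (mem_lat_bb e M _).1 (h1 a)
    exact ⟨z, by rw [lv_mul, hz]⟩
  · exact h2.map' _ (LinearMap.ker_eq_bot.2 (lin_inj Q hQ))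
  · exact (hn _).trans (by gcongr; exact h3 a)

lemma mem_colLattice (M : Matrix ι ι ℝ) (v : ι → ℝ) : v ∈ colLattice M ↔ ∃ z : ι → ℤ, M.mulVec (fun k => (z k : ℝ)) = v := by
  unfold colLattice
  rw [Submodule.mem_span_range_iff_exists_fun]
  refine exists_congr fun z => ?_
  have : ∑ i, z i • (fun k => M k i) = M.mulVec (fun k => (z k : ℝ)) := by
    ext k
    simp [Matrix.mulVec, dotProduct, mul_comm]
  rw [this]

lemma mem_colLattice' (e : Fin d ≃ ι) (M : Matrix ι ι ℝ) (v : EuclideanSpace ℝ ι) :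
    v.ofLp ∈ colLattice M ↔ v ∈ lat d (bb e M) := by
  rw [mem_colLattice, mem_lat_bb]
  refine exists_congr fun z => ?_
  unfold lv
  constructor
  · intro h; rw [h]
  · intro h; rw [← h]

lemma euclNorm_eq (v : EuclideanSpace ℝ ι) : euclNorm v.ofLp = ‖v‖ := by
  rw [EuclideanSpace.norm_eq, euclNorm]
  simp

lemma li_toLp {i : ℕ} (v : Fin i → EuclideanSpace ℝ ι) :
    LinearIndependent ℝ (fun a => (v a).ofLp) ↔ LinearIndependent ℝ v := by
  have := LinearMap.linearIndependent_iff (v := v) (WithLp.linearEquiv 2 ℝ (ι → ℝ)).toLinearMap (LinearEquiv.ker _)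
  exact this

lemma succSet_eq (e : Fin d ≃ ι) (M : Matrix ι ι ℝ) (i : ℕ) :
    {r : ℝ | 0 < r ∧ ∃ v : Fin i → (ι → ℝ), (∀ j, v j ∈ colLattice M) ∧
    LinearIndependent ℝ v ∧ ∀ j, euclNorm (v j) ≤ r} = {r | 0 < r ∧ SV e M i r} := by
  ext r
  refine and_congr_right fun _ => ?_
  constructor
  · rintro ⟨v, h1, h2, h3⟩
    refine ⟨fun a => WithLp.toLp 2 (v a), fun a => (mem_colLattice' e M _).1 (h1 a), ?_, fun a => ?_⟩
    · exact (li_toLp fun a => WithLp.toLp 2 (v a)).1 h2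
    · rw [← euclNorm_eq]; exact h3 a
  · rintro ⟨v, h1, h2, h3⟩
    refine ⟨fun a => (v a).ofLp, fun a => (mem_colLattice' e M _).2 (h1 a), ?_, fun a => ?_⟩
    · exact (li_toLp v).2 h2
    · rw [euclNorm_eq]; exact h3 a

lemma succMin_le (e : Fin d ≃ ι) (M : Matrix ι ι ℝ) (i : ℕ) {ρ : ℝ} (hρ : 0 < ρ) (h : SV e M i ρ) :
    succMin (colLattice M) i ≤ ρ := by
  unfold succMin
  rw [succSet_eq e]
  exact csInf_le ⟨0, fun r hr => hr.1.le⟩ ⟨hρ, h⟩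

lemma le_succMin (e : Fin d ≃ ι) (M : Matrix ι ι ℝ) (hM : M.det ≠ 0) (i : ℕ) (hi : i ≤ d) {ρ : ℝ}
    (h : ∀ r < ρ, ¬ SV e M i r) : ρ ≤ succMin (colLattice M) i := by
  unfold succMin
  rw [succSet_eq e]
  apply le_csInf
  · refine ⟨1 + ∑ k ∈ Finset.range d, ‖bb e M k‖, ?_, ?_⟩
    · have : 0 ≤ ∑ k ∈ Finset.range d, ‖bb e M k‖ := Finset.sum_nonneg fun _ _ => norm_nonneg _
      show 0 < 1 + ∑ k ∈ Finset.range d, ‖bb e M k‖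
      linarith
    · refine ⟨fun a => bb e M a, fun a => mem_lat_of_lt _ (by omega), ?_, fun a => ?_⟩
      · exact (bb_li e M hM).comp (Fin.castLE hi) (Fin.castLE_injective hi)
      · have := Finset.single_le_sum (f := fun k => ‖bb e M k‖) (fun _ _ => norm_nonneg _) (Finset.mem_range.2 (lt_of_lt_of_le a.2 hi))
        simp only at this ⊢
        linarith
  · rintro r ⟨_, hr⟩
    by_contra hlt
    exact h r (not_le.1 hlt) hr

lemma Nice.det_ne {q : Matrix ι ι ℝ} (h : Nice q) : q.det ≠ 0 := by
  intro h0; have := h.d1; rw [h0] at this; norm_num at this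

lemma rr_nice (e : Fin d ≃ ι) {q : Matrix ι ι ℝ} (h : Nice q) (M : Matrix ι ι ℝ) (k : ℕ) :
    rr (bb e (q * M)) k ≤ 2 * rr (bb e M) k := by
  rw [bb_mul]; exact rr_map_le _ h.le _ k

/-- short vectors pulled back by a nice map -/
lemma sv_nice_inv (e : Fin d ≃ ι) {q : Matrix ι ι ℝ} (h : Nice q) (M : Matrix ι ι ℝ) {i : ℕ} {ρ : ℝ}
    (hs : SV e (q * M) i ρ) : SV e M i (2 * ρ) := by
  have hu : IsUnit q.det := isUnit_iff_ne_zero.2 h.det_ne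
  have h1 := sv_mul e q⁻¹ (q * M) (by rw [Matrix.det_nonsing_inv, Ring.inverse_eq_inv']; exact inv_ne_zero h.det_ne) (C := 2) (by norm_num) (fun v => ?_) hs
  · rwa [← mul_assoc, Matrix.nonsing_inv_mul q hu, one_mul] at h1
  · have h2 := h.ge (Matrix.toEuclideanLin q⁻¹ v)
    have h3 : Matrix.toEuclideanLin q (Matrix.toEuclideanLin q⁻¹ v) = v := by
      ext i
      change (q.mulVec (q⁻¹.mulVec v.ofLp)) i = v i
      rw [Matrix.mulVec_mulVec, Matrix.mul_nonsing_inv q hu, Matrix.one_mulVec]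
    rwa [h3] at h2

end SV

section Est
variable {m n d : ℕ}

/-- the flow matrix -/
noncomputable def MB (m n : ℕ) (R : ℝ) (B : Fin m → Fin n → ℝ) : Matrix (Fin n ⊕ Fin m) (Fin n ⊕ Fin m) ℝ := AQ m n R * UB B

lemma det_MB (hm : 1 ≤ m) (hn : 1 ≤ n) {R : ℝ} (hR : 0 < R) (B : Fin m → Fin n → ℝ) : (MB m n R B).det = 1 := by
  unfold MB; rw [Matrix.det_mul, det_AQ hm hn hR, det_UB, one_mul]

theorem haarF (e : Fin d ≃ Fin n ⊕ Fin m) (hm : 1 ≤ m) (hn : 1 ≤ n) (Z : ℝ) (hZ : 0 ≤ Z) : ∃ C : ℝ≥0∞, C ≠ ⊤ ∧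
    ∀ R : ℝ, 1 ≤ R → ∀ Ψ : (Fin d → EuclideanSpace ℝ (Fin n ⊕ Fin m)) → ℝ≥0∞, Measurable Ψ →
    ∀ Φ : (Fin m → Fin n → ℝ) → ℝ≥0∞,
    (∀ q : Matrix (Fin n ⊕ Fin m) (Fin n ⊕ Fin m) ℝ, Nice q → ∀ B ∈ cube m n Z, ∀ γ : (Matrix (Fin n ⊕ Fin m) (Fin n ⊕ Fin m) ℤ)ˣ,
      cols e (mf (q * (MB m n R B * rm γ))) ∈ FF d →
      Φ B ≤ Ψ (cols e (mf (q * (MB m n R B * rm γ))))) →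
    ∫⁻ B in cube m n Z, Φ B ≤ C * ∫⁻ b in FF d, Ψ b := by
  obtain ⟨C, hC, h⟩ := haar e hm hn Z hZ
  refine ⟨C, hC, fun R hR Ψ hΨ Φ hΦ => ?_⟩
  have hR0 : 0 < R := by linarith
  rw [← lintegral_indicator (measurableSet_FF d)]
  refine h R hR _ (hΨ.indicator (measurableSet_FF d)) Φ fun q hq B hB => ?_
  have hdet : (q * (AQ m n R * UB B)).det = q.det := by
    have := det_MB hm hn hR0 B
    unfold MB at this
    rw [Matrix.det_mul, this, mul_one]
  obtain ⟨γ, hγ⟩ := exists_gamma_red e (q * (AQ m n R * UB B)) (by rw [hdet]; exact hq.det_ne)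
  refine ⟨γ, ?_⟩
  have hmem : cols e (mf (q * (AQ m n R * UB B) * rm γ)) ∈ FF d := by
    refine ⟨hγ, ?_, ?_⟩
    · have := PP_bb e (q * (AQ m n R * UB B) * rm γ)
      rw [Matrix.det_mul, abs_mul, abs_det_rm, mul_one, hdet] at this
      exact this ▸ hq.d1
    · have := PP_bb e (q * (AQ m n R * UB B) * rm γ)
      rw [Matrix.det_mul, abs_mul, abs_det_rm, mul_one, hdet] at this
      exact this ▸ hq.d2
  rw [Set.indicator_of_mem hmem]
  have hq2 := hΦ q hq B hB γ
  have he : q * (MB m n R B * rm γ) = q * (AQ m n R * UB B) * rm γ := by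
    unfold MB; simp only [mul_assoc]
  rw [he] at hq2
  exact hq2 hmem

/-- transfer of sets -/
lemma haarS (e : Fin d ≃ Fin n ⊕ Fin m) (hm : 1 ≤ m) (hn : 1 ≤ n) (Z : ℝ) (hZ : 0 ≤ Z) : ∃ C : ℝ≥0∞, C ≠ ⊤ ∧
    ∀ R : ℝ, 1 ≤ R → ∀ S : Set (Fin d → EuclideanSpace ℝ (Fin n ⊕ Fin m)), MeasurableSet S →
    ∀ P : Set (Fin m → Fin n → ℝ), MeasurableSet P →
    (∀ q : Matrix (Fin n ⊕ Fin m) (Fin n ⊕ Fin m) ℝ, Nice q → ∀ B ∈ cube m n Z, B ∈ P → ∀ γ : (Matrix (Fin n ⊕ Fin m) (Fin n ⊕ Fin m) ℤ)ˣ,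
      cols e (mf (q * (MB m n R B * rm γ))) ∈ FF d →
      cols e (mf (q * (MB m n R B * rm γ))) ∈ S) →
    volume (cube m n Z ∩ P) ≤ C * volume (FF d ∩ S) := by
  obtain ⟨C, hC, h⟩ := haarF e hm hn Z hZ
  refine ⟨C, hC, fun R hR S hS P hPm hP => ?_⟩
  have h1 := h R hR (S.indicator fun _ => 1) (measurable_const.indicator hS) (P.indicator fun _ => 1) ?_
  · rw [lintegral_indicator hS, Measure.restrict_restrict hS] at h1
    simp only [lintegral_const, one_mul, Measure.restrict_apply MeasurableSet.univ, Set.univ_inter] at h1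
    rw [Set.inter_comm (FF d)]
    refine le_trans ?_ h1
    have h2 : ∫⁻ B in cube m n Z, P.indicator (fun _ => (1:ℝ≥0∞)) B = ∫⁻ B, (cube m n Z ∩ P).indicator (fun _ => (1:ℝ≥0∞)) B := by
      rw [← lintegral_indicator (measurableSet_cube Z)]
      simp only [Set.indicator_indicator]
    rw [h2]
    rw [lintegral_indicator ((measurableSet_cube Z).inter hPm)]; simp
  · intro q hq B hB γ hγ
    by_cases hBP : B ∈ P
    · rw [Set.indicator_of_mem hBP, Set.indicator_of_mem (hP q hq B hB hBP γ hγ)]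
    · rw [Set.indicator_of_notMem hBP]; exact zero_le
end Est
end KM

open MeasureTheory
open scoped ENNReal
set_option linter.unusedSectionVars false
namespace KM
open InnerProductSpace

section Est
variable {m n d : ℕ}

lemma lv_li {ι : Type*} [Fintype ι] [DecidableEq ι] (M : Matrix ι ι ℝ) (hM : M.det ≠ 0) {i : ℕ} (w : Fin i → ι → ℤ) :
    LinearIndependent ℝ (fun a => lv M (w a)) ↔ LinearIndependent ℝ (fun a => lv 1 (w a)) := by
  have h : (fun a => lv M (w a)) = (Matrix.toEuclideanLin M) ∘ (fun a => lv 1 (w a)) := by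
    funext a
    simp only [Function.comp_apply]
    rw [← lv_mul, mul_one]
  rw [h]
  exact LinearMap.linearIndependent_iff _ (LinearMap.ker_eq_bot.2 (lin_inj M hM))

lemma sv_iff {ι : Type*} [Fintype ι] [DecidableEq ι] (e : Fin d ≃ ι) (M : Matrix ι ι ℝ) (hM : M.det ≠ 0) (i : ℕ) (ρ : ℝ) :
    SV e M i ρ ↔ ∃ w : Fin i → ι → ℤ, LinearIndependent ℝ (fun a => lv 1 (w a)) ∧ ∀ a, ‖lv M (w a)‖ ≤ ρ := by
  constructor
  · rintro ⟨v, h1, h2, h3⟩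
    choose w hw using fun a => (mem_lat_bb e M _).1 (h1 a)
    have : v = fun a => lv M (w a) := by funext a; exact (hw a).symm
    refine ⟨w, ?_, ?_⟩
    · rw [← lv_li M hM]; exact this ▸ h2
    · intro a; rw [hw]; exact h3 a
  · rintro ⟨w, h1, h2⟩
    exact ⟨fun a => lv M (w a), fun a => (mem_lat_bb e M _).2 ⟨_, rfl⟩, (lv_li M hM w).2 h1, h2⟩

lemma lv_inl (R : ℝ) (B : Fin m → Fin n → ℝ) (w : Fin n ⊕ Fin m → ℤ) (k : Fin n) :
    lv (MB m n R B) w (Sum.inl k) = R ^ (-(n : ℝ)⁻¹) * w (Sum.inl k) := by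
  unfold MB
  simp only [lv, ← Matrix.mulVec_mulVec]
  simp only [AQ, Matrix.mulVec_diagonal, Sum.elim_inl]
  congr 1
  simp [UB, Matrix.mulVec, dotProduct, Matrix.one_apply]

lemma lv_inr (R : ℝ) (B : Fin m → Fin n → ℝ) (w : Fin n ⊕ Fin m → ℤ) (r : Fin m) :
    lv (MB m n R B) w (Sum.inr r) = R ^ ((m : ℝ)⁻¹) * (∑ k, B r k * w (Sum.inl k) + w (Sum.inr r)) := by
  unfold MB
  simp only [lv, ← Matrix.mulVec_mulVec]
  simp only [AQ, Matrix.mulVec_diagonal, Sum.elim_inr]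
  congr 1
  simp [UB, Matrix.mulVec, dotProduct, Matrix.one_apply]

lemma continuous_lv (R : ℝ) (w : Fin n ⊕ Fin m → ℤ) : Continuous fun B : Fin m → Fin n → ℝ => lv (MB m n R B) w := by
  refine (PiLp.continuous_toLp 2 _).comp (g := WithLp.toLp 2) (f := fun B : Fin m → Fin n → ℝ => (lv (MB m n R B) w).ofLp) ?_
  refine continuous_pi fun i => ?_
  rcases i with i | i
  · simp only [lv_inl]; exact continuous_const
  · simp only [lv_inr]; fun_prop

lemma measurableSet_SV (e : Fin d ≃ Fin n ⊕ Fin m) (hm : 1 ≤ m) (hn : 1 ≤ n) {R : ℝ} (hR : 0 < R) (i : ℕ) (ρ : ℝ) :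
    MeasurableSet {B | SV e (MB m n R B) i ρ} := by
  have : {B | SV e (MB m n R B) i ρ} = ⋃ w : Fin i → Fin n ⊕ Fin m → ℤ, ⋃ (_ : LinearIndependent ℝ (fun a => (lv 1 (w a) : EuclideanSpace ℝ (Fin n ⊕ Fin m)))),
      ⋂ a, {B | ‖lv (MB m n R B) (w a)‖ ≤ ρ} := by
    ext B
    simp only [Set.mem_ofPred_eq, Set.mem_iUnion, Set.mem_iInter, exists_prop]
    exact sv_iff e _ (by rw [det_MB hm hn hR]; simp) i ρ
  rw [this]
  refine MeasurableSet.iUnion fun w => MeasurableSet.iUnion fun _ => MeasurableSet.iInter fun a => ?_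
  exact measurableSet_le (continuous_lv R (w a)).norm.measurable measurable_const

lemma ofReal_const {C : ℝ≥0∞} (hC : C ≠ ⊤) : ∃ C' : ℝ, 0 < C' ∧ C ≤ ENNReal.ofReal C' :=
  ⟨C.toReal + 1, by positivity, by
    rw [ENNReal.ofReal_add (by positivity) (by norm_num), ENNReal.ofReal_toReal hC]; exact le_self_add⟩

theorem est1 (e : Fin d ≃ Fin n ⊕ Fin m) (hm : 1 ≤ m) (hn : 1 ≤ n) (Z : ℝ) (hZ : 0 ≤ Z) (i : ℕ) (hi1 : 1 ≤ i) (hi : i < d) :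
    ∃ C : ℝ, 0 < C ∧ ∀ R : ℝ, 1 ≤ R → ∀ T : ℝ, 0 < T →
    volume (cube m n Z ∩ {B | ¬ SV e (MB m n R B) (i+1) T}) ≤ ENNReal.ofReal (C * (T ^ ((d - i) * d))⁻¹) := by
  obtain ⟨C0, hC0, h0⟩ := haarS e hm hn Z hZ
  obtain ⟨C0', hC0', h0'⟩ := ofReal_const hC0
  obtain ⟨C1, hC1, h1⟩ := V1d (E := EuclideanSpace ℝ (Fin n ⊕ Fin m)) d (finrank_E e) i hi1 hi
  set K : ℝ := 2 * ((1 + d * 2 ^ d) * 2 ^ d) with hK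
  have hKpos : 0 < K := by positivity
  refine ⟨C0' * (C1 * (2 * (K * 2 ^ d) ^ (d - i)) ^ d), by positivity, fun R hR T hT => ?_⟩
  have hR0 : 0 < R := by linarith
  set ε : ℝ := 2 * (K * 2 ^ d / T) ^ (d - i) with hε
  have hεpos : 0 < ε := by positivity
  have key := h0 R hR {b | PP (ext0 b) i ≤ ε ∧ ((1:ℝ) = 1 ∨ PP (ext0 b) i * rr (ext0 b) i ^ (d - i) ≤ (1:ℝ) ^ (d - i))} ?_
    {B | ¬ SV e (MB m n R B) (i+1) T} (measurableSet_SV e hm hn hR0 _ _).compl ?_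
  · refine key.trans ?_
    calc _ ≤ ENNReal.ofReal C0' * ENNReal.ofReal (C1 * 1 ^ 2 * ε ^ d) := by
          gcongr; exact h1 ε hεpos 1 one_pos (Or.inl rfl)
      _ = _ := by
        rw [← ENNReal.ofReal_mul hC0'.le]
        congr 1
        rw [hε, pow_mul, ← inv_pow, div_eq_mul_inv, mul_pow _ T⁻¹, inv_pow]
        ring
  · simp only [true_or, and_true]
    exact measurableSet_le (measurable_PP measurable_ext0 i) measurable_const
  · intro q hq B hB hBP γ hF
    refine ⟨?_, Or.inl rfl⟩
    set b' := bb e (q * (MB m n R B * rm γ)) with hb'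
    have hred : IsRed d b' := hF.1
    have hlow : T < K * rr b' i := by
      by_contra hcon
      push Not at hcon
      apply hBP
      rw [← sv_rm e _ γ]
      have : SV e (q * (MB m n R B * rm γ)) (i+1) (((1 + d * 2 ^ d) * 2 ^ d) * rr b' i) := by
        refine ⟨fun a => b' a, fun a => mem_lat_of_lt _ (by omega), ?_, fun a => ?_⟩
        · exact (li_of_rr hred.pos).comp (Fin.castLE (by omega : i + 1 ≤ d)) (Fin.castLE_injective _)
        · have h2 := hred.norm_le (k := a) (by omega)
          have h3 := hred.mono (l := a) (k := i) (by omega) hi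
          calc _ ≤ _ := h2
            _ ≤ (1 + d * 2 ^ d) * (2 ^ d * rr b' i) := by gcongr
            _ = _ := by ring
      refine (sv_nice_inv e hq _ this).mono ?_
      rw [hK] at hcon; linarith
    have hPP : PP b' i * (rr b' i / 2 ^ d) ^ (d - i) ≤ 2 := by
      refine le_trans ?_ hF.2.2
      change _ ≤ PP b' d
      have : PP b' d = PP b' i * ∏ k ∈ Finset.Ico i d, rr b' k := (Finset.prod_range_mul_prod_Ico _ hi.le).symm
      rw [this]
      have hp : 0 ≤ PP b' i := Finset.prod_nonneg fun _ _ => rr_nonneg _ _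
      gcongr
      have hc : (rr b' i / 2 ^ d) ^ (d - i) = ∏ k ∈ Finset.Ico i d, (rr b' i / 2 ^ d) := by
        rw [Finset.prod_const, Nat.card_Ico]
      rw [hc]
      refine Finset.prod_le_prod (fun k _ => div_nonneg (rr_nonneg _ _) (by positivity)) fun k hk => ?_
      have hk' := Finset.mem_Ico.1 hk
      rw [div_le_iff₀ (by positivity), mul_comm]
      exact hred.mono hk'.1 hk'.2
    have hTr : T / (K * 2 ^ d) ≤ rr b' i / 2 ^ d := by
      rw [div_le_div_iff₀ (by positivity) (by positivity)]
      have : (0:ℝ) < 2 ^ d := by positivity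
      nlinarith
    have hp : 0 ≤ PP b' i := Finset.prod_nonneg fun _ _ => rr_nonneg _ _
    have h5 : PP b' i * (T / (K * 2 ^ d)) ^ (d - i) ≤ 2 := by
      refine le_trans ?_ hPP
      gcongr
    change PP b' i ≤ ε
    have h6 : (K * 2 ^ d / T) ^ (d - i) = ((T / (K * 2 ^ d)) ^ (d - i))⁻¹ := by
      rw [← inv_pow, inv_div]
    rw [hε, h6, ← div_eq_mul_inv, le_div_iff₀ (by positivity)]
    exact h5

theorem est1' (e : Fin d ≃ Fin n ⊕ Fin m) (hm : 1 ≤ m) (hn : 1 ≤ n) (Z : ℝ) (hZ : 0 ≤ Z) (i : ℕ) (hi1 : 1 ≤ i) (hi : i < d) :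
    ∃ C : ℝ, 0 < C ∧ ∀ R : ℝ, 1 ≤ R → ∀ ρ : ℝ, 0 < ρ →
    volume (cube m n Z ∩ {B | SV e (MB m n R B) i ρ}) ≤ ENNReal.ofReal (C * ρ ^ (d * i)) := by
  obtain ⟨C0, hC0, h0⟩ := haarS e hm hn Z hZ
  obtain ⟨C0', hC0', h0'⟩ := ofReal_const hC0
  obtain ⟨C1, hC1, h1⟩ := V1d (E := EuclideanSpace ℝ (Fin n ⊕ Fin m)) d (finrank_E e) i hi1 hi
  refine ⟨C0' * (C1 * ((2 ^ d * 2) ^ i) ^ d), by positivity, fun R hR ρ hρ => ?_⟩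
  have hR0 : 0 < R := by linarith
  set ε : ℝ := (2 ^ d * (2 * ρ)) ^ i with hε
  have hεpos : 0 < ε := by positivity
  have key := h0 R hR {b | PP (ext0 b) i ≤ ε ∧ ((1:ℝ) = 1 ∨ PP (ext0 b) i * rr (ext0 b) i ^ (d - i) ≤ (1:ℝ) ^ (d - i))} ?_
    {B | SV e (MB m n R B) i ρ} (measurableSet_SV e hm hn hR0 _ _) ?_
  · refine key.trans ?_
    calc _ ≤ ENNReal.ofReal C0' * ENNReal.ofReal (C1 * 1 ^ 2 * ε ^ d) := by
          gcongr; exact h1 ε hεpos 1 one_pos (Or.inl rfl)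
      _ = _ := by
        rw [← ENNReal.ofReal_mul hC0'.le]
        congr 1
        rw [hε, mul_comm d i, pow_mul ρ, show (2:ℝ)^d*(2*ρ) = (2^d*2)*ρ by ring, mul_pow _ ρ]
        ring
  · simp only [true_or, and_true]
    exact measurableSet_le (measurable_PP measurable_ext0 i) measurable_const
  · intro q hq B hB hBP γ hF
    refine ⟨?_, Or.inl rfl⟩
    set b' := bb e (q * (MB m n R B * rm γ)) with hb'
    have hred : IsRed d b' := hF.1
    have h2 : SV e (q * (MB m n R B * rm γ)) i (2 * ρ) :=
      sv_mul e q _ hq.det_ne (by norm_num) hq.le ((sv_rm e _ γ i ρ).2 hBP)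
    obtain ⟨v, hv1, hv2, hv3⟩ := h2
    change PP b' i ≤ ε
    unfold PP
    rw [hε]
    calc ∏ l ∈ Finset.range i, rr b' l ≤ ∏ l ∈ Finset.range i, (2 ^ d * (2 * ρ)) :=
          Finset.prod_le_prod (fun _ _ => rr_nonneg _ _) fun l hl => hred.short v hv1 hv2 hv3 (Finset.mem_range.1 hl)
      _ = _ := by simp
end Est
end KM

open MeasureTheory
open scoped ENNReal
set_option linter.unusedSectionVars false
namespace KM
open InnerProductSpace

section Conv
variable {m n d : ℕ}

lemma diag_norm_le {ι : Type*} [Fintype ι] [DecidableEq ι] (D : ι → ℝ) {C : ℝ} (hC : 0 ≤ C) (h : ∀ k, |D k| ≤ C)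
    (v : EuclideanSpace ℝ ι) : ‖Matrix.toEuclideanLin (Matrix.diagonal D) v‖ ≤ C * ‖v‖ := by
  rw [← abs_of_nonneg hC, ← Real.norm_eq_abs, ← norm_smul]
  rw [EuclideanSpace.norm_eq, EuclideanSpace.norm_eq]
  apply Real.sqrt_le_sqrt
  refine Finset.sum_le_sum fun k _ => ?_
  have : (Matrix.toEuclideanLin (Matrix.diagonal D) v) k = D k * v k := by
    simp [Matrix.toLpLin_apply, Matrix.mulVec_diagonal]
  rw [this]
  simp only [PiLp.smul_apply, smul_eq_mul, norm_mul, Real.norm_eq_abs]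
  refine pow_le_pow_left₀ (by positivity) (mul_le_mul_of_nonneg_right ?_ (abs_nonneg _)) 2
  simpa using (h k).trans (le_abs_self C)

lemma MB_mul {R S : ℝ} (hR : 0 < R) (hS : 0 < S) (B : Fin m → Fin n → ℝ) : MB m n (R * S) B = AQ m n R * MB m n S B := by
  unfold MB
  rw [← Matrix.mul_assoc]
  congr 1
  unfold AQ
  rw [Matrix.diagonal_mul_diagonal]
  congr 1
  funext k
  rcases k with k | k
  · simp [Real.mul_rpow hR.le hS.le]
  · simp [Real.mul_rpow hR.le hS.le]

lemma AQ_norm_le (hm : 1 ≤ m) (hn : 1 ≤ n) {R : ℝ} (hR : 1 ≤ R) (v : EuclideanSpace ℝ (Fin n ⊕ Fin m)) :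
    ‖Matrix.toEuclideanLin (AQ m n R) v‖ ≤ R * ‖v‖ := by
  refine diag_norm_le _ (by linarith) (fun k => ?_) v
  have hR0 : 0 < R := by linarith
  rcases k with k | k
  · simp only [Sum.elim_inl]
    rw [abs_of_pos (by positivity)]
    refine (Real.rpow_le_rpow_of_exponent_le hR (y := -(n:ℝ)⁻¹) (z := 1) ?_).trans_eq (Real.rpow_one R)
    have : (0:ℝ) ≤ (n:ℝ)⁻¹ := by positivity
    linarith
  · simp only [Sum.elim_inr]
    rw [abs_of_pos (by positivity)]
    refine (Real.rpow_le_rpow_of_exponent_le hR (y := (m:ℝ)⁻¹) (z := 1) ?_).trans_eq (Real.rpow_one R)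
    have : (1:ℝ) ≤ m := by exact_mod_cast hm
    exact inv_le_one_of_one_le₀ this

lemma equivE (m n : ℕ) : Nonempty (Fin (m+n) ≃ Fin n ⊕ Fin m) := ⟨Fintype.equivOfCardEq (by simp [add_comm])⟩

lemma iUnion_cube (B : Fin m → Fin n → ℝ) : ∃ Z : ℕ, B ∈ cube m n Z := by
  obtain ⟨Z, hZ⟩ := exists_nat_ge (∑ i, ∑ j, |B i j|)
  refine ⟨Z, fun i j => le_trans ?_ hZ⟩
  refine (Finset.single_le_sum (f := fun j => |B i j|) (fun _ _ => abs_nonneg _) (Finset.mem_univ j)).trans ?_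
  exact (Finset.single_le_sum (f := fun i => ∑ j, |B i j|) (fun _ _ => Finset.sum_nonneg fun _ _ => abs_nonneg _) (Finset.mem_univ i))

theorem conv_dir (hm : 1 ≤ m) (hn : 1 ≤ n)
    (f : ℝ → ℝ) (hfpos : ∀ x > (0 : ℝ), 0 < f x) (hfmono : MonotoneOn f (Set.Ioi 0))
    (j : ℕ) (hj1 : 2 ≤ j) (hj2 : j ≤ m + n)
    (hs : Summable fun k : ℕ => 1 / f (k + 1)) :
      ∀ᵐ B : Fin m → Fin n → ℝ ∂volume, ∃ R₀ > (0 : ℝ), ∀ R ≥ R₀,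
        succMin (colLattice (AQ m n R * UB B)) j
          < f (Real.log R) ^ ((((m + n : ℕ) : ℝ) * ((m + n - j + 1 : ℕ) : ℝ))⁻¹) := by
  obtain ⟨e⟩ := equivE m n
  obtain ⟨i, rfl⟩ : ∃ i, j = i + 1 := ⟨j - 1, by omega⟩
  have hdi : m + n - (i+1) + 1 = m + n - i := by omega
  rw [hdi]
  set α : ℝ := (((m + n : ℕ) : ℝ) * ((m + n - i : ℕ) : ℝ))⁻¹ with hα
  have hαpos : 0 < α := by
    have : 0 < m + n := by omega
    have : 0 < m + n - i := by omega
    positivity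
  set E := Real.exp 1 with hE
  have hEpos : 0 < E := Real.exp_pos 1
  let T : ℕ → ℝ := fun k => f (k+1) ^ α / (2 * E)
  have hfk : ∀ k : ℕ, 0 < f (k+1) := fun k => hfpos _ (by positivity)
  have hT : ∀ k, 0 < T k := fun k => by have := hfk k; positivity
  have hTpow : ∀ k, (T k ^ ((m+n-i) * (m+n)))⁻¹ = (2*E)^((m+n-i)*(m+n)) * (1 / f (k+1)) := fun k => by
    have h1 : (f (k+1) ^ α) ^ ((m+n-i) * (m+n)) = f (k+1) := by
      rw [← Real.rpow_natCast, ← Real.rpow_mul (hfk k).le]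
      have : α * (((m+n-i) * (m+n) : ℕ) : ℝ) = 1 := by
        rw [hα, Nat.cast_mul, mul_comm ((m+n-i : ℕ):ℝ)]
        apply inv_mul_cancel₀
        have : 0 < m + n := by omega
        have : 0 < m + n - i := by omega
        positivity
      rw [this, Real.rpow_one]
    simp only [T]
    rw [div_pow, h1, inv_div, div_eq_mul_one_div]
  have main : ∀ Z : ℕ, ∀ᵐ B : Fin m → Fin n → ℝ ∂volume, ∀ᶠ k : ℕ in Filter.atTop,
      B ∉ cube m n Z ∩ {B | ¬ SV e (MB m n (Real.exp (k+1)) B) (i+1) (T k)} := by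
    intro Z
    obtain ⟨C, hC, hest⟩ := est1 e hm hn Z (by positivity) i (by omega) (by omega)
    apply ae_eventually_notMem
    have hle : ∀ k : ℕ, volume (cube m n Z ∩ {B | ¬ SV e (MB m n (Real.exp (k+1)) B) (i+1) (T k)}) ≤
        ENNReal.ofReal (C * (2*E)^((m+n-i)*(m+n)) * (1 / f (k+1))) := fun k => by
      refine (hest (Real.exp (k+1)) (Real.one_le_exp (by positivity)) (T k) (hT k)).trans_eq ?_
      rw [hTpow, mul_assoc]
    refine ne_top_of_le_ne_top ?_ (ENNReal.tsum_le_tsum hle)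
    have hs' := hs.mul_left (C * (2*E)^((m+n-i)*(m+n)))
    rw [← ENNReal.ofReal_tsum_of_nonneg _ hs']
    · exact ENNReal.ofReal_ne_top
    · intro k; have := hfk k; positivity
  filter_upwards [ae_all_iff.2 main] with B hB
  obtain ⟨Z, hZ⟩ := iUnion_cube B
  obtain ⟨K, hK⟩ := Filter.eventually_atTop.1 (hB Z)
  refine ⟨Real.exp (K+1), Real.exp_pos _, fun R hR => ?_⟩
  have hR0 : 0 < R := (Real.exp_pos _).trans_le hR
  have hlog : (K:ℝ) + 1 ≤ Real.log R := (Real.le_log_iff_exp_le hR0).2 hR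
  obtain ⟨k, hk⟩ : ∃ k : ℕ, ⌊Real.log R⌋₊ = k + 1 := by
    refine ⟨⌊Real.log R⌋₊ - 1, ?_⟩
    have : 1 ≤ ⌊Real.log R⌋₊ := Nat.le_floor (by push_cast; linarith [(Nat.cast_nonneg K : (0:ℝ) ≤ K)])
    omega
  have hk1 : ((k:ℝ)+1) ≤ Real.log R := by
    have := Nat.floor_le (a := Real.log R) (by linarith [(Nat.cast_nonneg K : (0:ℝ) ≤ K)])
    rw [hk] at this; push_cast at this; exact this
  have hk2 : Real.log R < (k:ℝ) + 1 + 1 := by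
    have := Nat.lt_floor_add_one (Real.log R)
    rw [hk] at this; push_cast at this; exact this
  have hKk : K ≤ k := by
    have : ((K:ℝ)) < k + 1 := by linarith
    have : K < k + 1 := by exact_mod_cast this
    omega
  have hSV : SV e (MB m n (Real.exp (k+1)) B) (i+1) (T k) := by
    by_contra hcon
    exact hK k hKk ⟨hZ, hcon⟩
  set S := R / Real.exp (k+1) with hS
  have hRS : R = S * Real.exp (k+1) := by rw [hS]; field_simp
  have hS1 : 1 ≤ S := by
    rw [hS, one_le_div (Real.exp_pos _)]
    exact (Real.le_log_iff_exp_le hR0).1 hk1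
  have hS2 : S ≤ E := by
    rw [hS, div_le_iff₀ (Real.exp_pos _), hE, ← Real.exp_add]
    exact (Real.log_le_iff_le_exp hR0).1 (by linarith)
  have hSVR : SV e (MB m n R B) (i+1) (E * T k) := by
    rw [hRS, MB_mul (by linarith) (Real.exp_pos _)]
    refine sv_mul e _ _ ?_ hEpos.le (fun v => ?_) hSV
    · rw [det_AQ hm hn (by linarith)]; norm_num
    · exact (AQ_norm_le hm hn hS1 v).trans (by gcongr)
  have h1 := succMin_le e _ (i+1) (mul_pos hEpos (hT k)) hSVR
  refine lt_of_le_of_lt h1 ?_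
  have h2 : E * T k = f (k+1) ^ α / 2 := by simp only [T]; field_simp
  rw [h2]
  have hp : 0 < f (k+1) ^ α := Real.rpow_pos_of_pos (hfk k) _
  have hmono : f (k+1) ≤ f (Real.log R) := hfmono (show (0:ℝ) < k+1 by positivity) (show 0 < Real.log R by linarith [(Nat.cast_nonneg k : (0:ℝ) ≤ k)]) hk1
  have : f (k+1) ^ α ≤ f (Real.log R) ^ α := Real.rpow_le_rpow (hfk k).le hmono hαpos.le
  linarith

end Conv
end KM

open MeasureTheory
open scoped ENNReal
set_option linter.unusedSectionVars false
namespace KM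
open InnerProductSpace

section Vol
variable {m n i : ℕ}

def KapOK (m n : ℕ) (κ : ℝ) : Prop := 0 < κ ∧ κ ≤ 1 ∧ n * κ ≤ 1/4 ∧
  ∀ g : Matrix (Fin n) (Fin n) ℝ, (∀ i j, |g i j - (1 : Matrix (Fin n) (Fin n) ℝ) i j| ≤ κ) → 1/2 ≤ |g.det| ^ m ∧ |g.det| ^ m ≤ 2

lemma exists_kappa (m n : ℕ) : ∃ κ, KapOK m n κ := by
  obtain ⟨κ, hκ, h⟩ := near_cont (ι := Fin n) (fun g => |(Matrix.of g).det| ^ m) (by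
    have : Continuous fun g : Fin n → Fin n → ℝ => (Matrix.of g).det := Continuous.matrix_det continuous_id
    exact this.abs.pow m) (by simp)
  refine ⟨min κ (min 1 (1 / (4 * (n+1)))), by positivity, ?_, ?_, fun g hg => ?_⟩
  · exact (min_le_right _ _).trans (min_le_left _ _)
  · have : min κ (min 1 (1 / (4 * ((n:ℝ)+1)))) ≤ 1 / (4 * (n+1)) := (min_le_right _ _).trans (min_le_right _ _)
    calc (n:ℝ) * _ ≤ (n+1) * (1 / (4 * (n+1))) := by gcongr; linarith
      _ = 1/4 := by field_simp
  · exact h (mf g) fun i j => (hg i j).trans (min_le_left _ _)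

def vbox (p : Fin m → Fin n → ℝ) (ρ : Fin n → ℝ) : Set (Fin m → Fin n → ℝ) := {g | ∀ r a, |g r a - p r a| ≤ ρ a}

lemma vbox_eq (p : Fin m → Fin n → ℝ) (ρ : Fin n → ℝ) :
    vbox p ρ = Set.univ.pi fun i => Set.univ.pi fun j => Set.Icc (p i j - ρ j) (p i j + ρ j) := by
  ext g
  simp only [vbox, Set.mem_ofPred_eq, Set.mem_pi, Set.mem_univ, true_imp_iff, Set.mem_Icc]
  refine forall_congr' fun i => forall_congr' fun j => ?_
  rw [abs_le]
  constructor <;> rintro ⟨h1, h2⟩ <;> constructor <;> linarith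

lemma measurableSet_vbox (p : Fin m → Fin n → ℝ) (ρ : Fin n → ℝ) : MeasurableSet (vbox p ρ) := by
  rw [vbox_eq]
  exact MeasurableSet.univ_pi fun i => MeasurableSet.univ_pi fun j => measurableSet_Icc

lemma volume_vbox (p : Fin m → Fin n → ℝ) (ρ : Fin n → ℝ) (hρ : ∀ a, 0 ≤ ρ a) :
    volume (vbox p ρ) = ENNReal.ofReal ((∏ a, 2 * ρ a) ^ m) := by
  rw [vbox_eq, volume_pi_pi]
  have : ∀ r : Fin m, volume (Set.univ.pi fun j => Set.Icc (p r j - ρ j) (p r j + ρ j)) = ENNReal.ofReal (∏ a, 2 * ρ a) := by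
    intro r
    rw [volume_pi_pi, ENNReal.ofReal_prod_of_nonneg fun a _ => by have := hρ a; positivity]
    refine Finset.prod_congr rfl fun a _ => ?_
    rw [Real.volume_Icc]; congr 1; ring
  simp only [this, Finset.prod_const, Finset.card_univ, Fintype.card_fin]
  rw [ENNReal.ofReal_pow (Finset.prod_nonneg fun a _ => by have := hρ a; positivity)]

lemma prod_split (hi : i ≤ n) (x y : ℝ) : ∏ a : Fin n, (if (a:ℕ) < i then x else y) = x ^ i * y ^ (n - i) := by
  rw [Fin.prod_univ_eq_prod_range (fun a => if a < i then x else y) n, ← Finset.prod_range_mul_prod_Ico _ hi]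
  congr 1
  · rw [Finset.prod_congr rfl (g := fun _ => x)]
    · simp
    · intro a ha; simp [Finset.mem_range.1 ha]
  · rw [Finset.prod_congr rfl (g := fun _ => y)]
    · simp
    · intro a ha; have := (Finset.mem_Ico.1 ha).1; simp [this]

noncomputable def VV (D : ℝ) (w : Fin i → Fin n ⊕ Fin m → ℤ) : Matrix (Fin n) (Fin n) ℝ :=
  fun k a => if h : (a:ℕ) < i then w ⟨a, h⟩ (Sum.inl k) / D else (1 : Matrix (Fin n) (Fin n) ℝ) k a

def TopC (D κ : ℝ) (w : Fin i → Fin n ⊕ Fin m → ℤ) : Prop :=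
  ∀ (a : Fin i) (k : Fin n), |(w a (Sum.inl k) : ℝ) - D * (if (k:ℕ) = a then 1 else 0)| ≤ κ * D

lemma VV_near {D κ : ℝ} (hD : 0 < D) (hκ : 0 ≤ κ) {w : Fin i → Fin n ⊕ Fin m → ℤ} (h : TopC D κ w) (k a : Fin n) :
    |VV D w k a - (1 : Matrix (Fin n) (Fin n) ℝ) k a| ≤ κ := by
  unfold VV
  split_ifs with hh
  · have h1 := h ⟨a, hh⟩ k
    have h2 : (w ⟨a, hh⟩ (Sum.inl k) : ℝ) / D - (1 : Matrix (Fin n) (Fin n) ℝ) k a =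
        ((w ⟨a, hh⟩ (Sum.inl k) : ℝ) - D * (if (k:ℕ) = a then 1 else 0)) / D := by
      rw [sub_div, mul_div_cancel_left₀ _ hD.ne', Matrix.one_apply]
      simp only [Fin.ext_iff]
    rw [h2, abs_div, abs_of_pos hD, div_le_iff₀ hD]
    exact h1
  · simpa using hκ

def CS (D θ : ℝ) (w : Fin i → Fin n ⊕ Fin m → ℤ) (ρ : ℝ) (c : Fin m → Fin n → ℝ) : Set (Fin m → Fin n → ℝ) :=
  {B | (∀ a r, |∑ k, B r k * w a (Sum.inl k) + w a (Sum.inr r)| ≤ θ * D) ∧ ∀ (a : Fin n) r, i ≤ a → |B r a - c r a| ≤ ρ}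

lemma CS_eq {D : ℝ} (hD : 0 < D) (hi : i ≤ n) (θ : ℝ) (w : Fin i → Fin n ⊕ Fin m → ℤ) (ρ : ℝ) (c : Fin m → Fin n → ℝ) (B : Fin m → Fin n → ℝ) :
    B ∈ CS D θ w ρ c ↔ mf ((1 : Matrix (Fin m) (Fin m) ℝ) * Matrix.of B * VV D w) ∈
      vbox (fun r a => if h : (a:ℕ) < i then - (w ⟨a, h⟩ (Sum.inr r) : ℝ) / D else c r a) (fun a => if (a:ℕ) < i then θ else ρ) := by
  have h1 : ∀ r (a : Fin n) (h : (a:ℕ) < i), (Matrix.of B * VV D w) r a = (∑ k, B r k * w ⟨a, h⟩ (Sum.inl k)) / D := by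
    intro r a h
    simp only [Matrix.mul_apply, VV, h, dif_pos, Matrix.of_apply, Finset.sum_div]
    exact Finset.sum_congr rfl fun k _ => by ring
  have h2 : ∀ r (a : Fin n) (h : ¬ (a:ℕ) < i), (Matrix.of B * VV D w) r a = B r a := by
    intro r a h
    simp [Matrix.mul_apply, VV, h, Matrix.one_apply]
  simp only [vbox, CS, mf, Set.mem_ofPred_eq, Matrix.one_mul]
  constructor
  · rintro ⟨h3, h4⟩ r a
    split_ifs with h
    · rw [h1 r a h, neg_div, sub_neg_eq_add, ← add_div, abs_div, abs_of_pos hD, div_le_iff₀ hD]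
      exact h3 _ _
    · rw [h2 r a h]; exact h4 a r (by omega)
  · intro h3
    refine ⟨fun a r => ?_, fun a r ha => ?_⟩
    · have h4 := h3 r ⟨a, by omega⟩
      have ha : ((⟨a, by omega⟩ : Fin n) : ℕ) < i := a.2
      rw [dif_pos ha, if_pos ha, h1 r _ ha, neg_div, sub_neg_eq_add, ← add_div, abs_div, abs_of_pos hD, div_le_iff₀ hD] at h4
      exact h4
    · have h4 := h3 r a
      have ha' : ¬ (a:ℕ) < i := by omega
      rwa [dif_neg ha', if_neg ha', h2 r a ha'] at h4

lemma measurableSet_CS (D θ : ℝ) (w : Fin i → Fin n ⊕ Fin m → ℤ) (ρ : ℝ) (c : Fin m → Fin n → ℝ) :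
    MeasurableSet (CS D θ w ρ c) := by
  have : CS D θ w ρ c = (⋂ a, ⋂ r, {B : Fin m → Fin n → ℝ | |∑ k, B r k * (w a (Sum.inl k) : ℝ) + (w a (Sum.inr r) : ℝ)| ≤ θ * D}) ∩
      ⋂ (a : Fin n), ⋂ r, ⋂ (_ : i ≤ a), {B | |B r a - c r a| ≤ ρ} := by
    ext B; simp [CS]
  rw [this]
  refine MeasurableSet.inter ?_ ?_
  · refine MeasurableSet.iInter fun a => MeasurableSet.iInter fun r => measurableSet_le ?_ measurable_const
    have : Continuous fun B : Fin m → Fin n → ℝ => |∑ k, B r k * w a (Sum.inl k) + w a (Sum.inr r)| := by fun_prop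
    exact this.measurable
  · refine MeasurableSet.iInter fun a => MeasurableSet.iInter fun r => MeasurableSet.iInter fun _ => measurableSet_le ?_ measurable_const
    have : Continuous fun B : Fin m → Fin n → ℝ => |B r a - c r a| := by fun_prop
    exact this.measurable

lemma VV_det {D κ : ℝ} (hκ : KapOK m n κ) (hD : 0 < D) {w : Fin i → Fin n ⊕ Fin m → ℤ} (h : TopC D κ w) :
    1/2 ≤ |(VV D w).det| ^ m ∧ |(VV D w).det| ^ m ≤ 2 := hκ.2.2.2 _ (VV_near hD hκ.1.le h)

lemma VV_det_ne (hm : 1 ≤ m) {D κ : ℝ} (hκ : KapOK m n κ) (hD : 0 < D) {w : Fin i → Fin n ⊕ Fin m → ℤ} (h : TopC D κ w) :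
    (VV D w).det ≠ 0 := by
  intro h0
  have := (VV_det hκ hD h).1
  rw [h0, abs_zero, zero_pow (by omega)] at this
  norm_num at this

lemma vol_CS (hm : 1 ≤ m) (hi : i ≤ n) {κ : ℝ} (hκ : KapOK m n κ) {D θ ρ : ℝ} (hD : 0 < D) (hθ : 0 ≤ θ) (hρ : 0 ≤ ρ)
    {w : Fin i → Fin n ⊕ Fin m → ℤ} (h : TopC D κ w) (c : Fin m → Fin n → ℝ) :
    ENNReal.ofReal (1/2 * ((2*θ)^i*(2*ρ)^(n-i))^m) ≤ volume (CS D θ w ρ c) ∧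
    volume (CS D θ w ρ c) ≤ ENNReal.ofReal (2 * ((2*θ)^i*(2*ρ)^(n-i))^m) := by
  set bx := vbox (fun r a => if h : (a:ℕ) < i then - (w ⟨a, h⟩ (Sum.inr r) : ℝ) / D else c r a) (fun a => if (a:ℕ) < i then θ else ρ) with hbx
  have hv : volume bx = ENNReal.ofReal (((2*θ)^i*(2*ρ)^(n-i))^m) := by
    rw [hbx, volume_vbox _ _ (fun a => by split_ifs <;> assumption)]
    congr 2
    rw [← prod_split hi]
    exact Finset.prod_congr rfl fun a _ => by split_ifs <;> rfl
  have hdet := VV_det hκ hD h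
  have hpre : CS D θ w ρ c = (fun B : Fin m → Fin n → ℝ => mf ((1 : Matrix (Fin m) (Fin m) ℝ) * Matrix.of B * VV D w)) ⁻¹' bx := by
    ext B; exact CS_eq hD hi θ w ρ c B
  have key := lmr' (1 : Matrix (Fin m) (Fin m) ℝ) (VV D w) (by simp) (VV_det_ne hm hκ hD h)
    (F := bx.indicator 1) (measurable_one.indicator (measurableSet_vbox _ _))
  have h1 : ∫⁻ B : Fin m → Fin n → ℝ, bx.indicator 1 (mf ((1 : Matrix (Fin m) (Fin m) ℝ) * Matrix.of B * VV D w)) = volume (CS D θ w ρ c) := by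
    rw [hpre, ← lintegral_indicator_one]
    · rfl
    · rw [← hpre]; exact measurableSet_CS _ _ _ _ _
  rw [h1, lintegral_indicator_one (measurableSet_vbox _ _), hv, ← ENNReal.ofReal_mul (by positivity)] at key
  rw [key]
  simp only [Matrix.det_one, abs_one, one_pow, one_mul, Fintype.card_fin]
  have hpos : 0 < |(VV D w).det| ^ m := by linarith
  constructor
  · gcongr
    rw [one_div]
    exact inv_anti₀ hpos hdet.2
  · gcongr
    exact (inv_anti₀ (by norm_num) hdet.1).trans_eq (by norm_num)

end Vol
end KM

open MeasureTheory
open scoped ENNReal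
set_option linter.unusedSectionVars false
namespace KM
open InnerProductSpace

section Cnt
variable {m n i d : ℕ}

noncomputable def uR (n : ℕ) (R : ℝ) : ℝ := R ^ ((n:ℝ)⁻¹)
lemma uR_pos {n : ℕ} {R : ℝ} (hR : 0 < R) : 0 < uR n R := Real.rpow_pos_of_pos hR _
lemma uR_pow {n : ℕ} (hn : 1 ≤ n) {R : ℝ} (hR : 0 < R) : uR n R ^ n = R := by
  unfold uR
  exact Real.rpow_inv_natCast_pow hR.le (by omega)
lemma one_le_uR {n : ℕ} {R : ℝ} (hR : 1 ≤ R) : 1 ≤ uR n R := Real.one_le_rpow hR (by positivity)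
lemma uR_inv {n : ℕ} {R : ℝ} (hR : 0 < R) : R ^ (-(n:ℝ)⁻¹) = (uR n R)⁻¹ := Real.rpow_neg hR.le _

noncomputable def th (m n : ℕ) (R : ℝ) : ℝ := (uR n R * uR m R)⁻¹

noncomputable def WW (m n i : ℕ) (κ D : ℝ) : Finset (Fin i → Fin n ⊕ Fin m → ℤ) :=
  Fintype.piFinset fun a => Fintype.piFinset (fun s => Finset.Icc
    ⌈Sum.elim (fun k : Fin n => D * (if (k:ℕ) = a then 1 else 0) - κ * D) (fun _ => - (D * (11/20))) s⌉
    ⌊Sum.elim (fun k : Fin n => D * (if (k:ℕ) = a then 1 else 0) + κ * D) (fun _ => - (D * (9/20))) s⌋)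

lemma WW_top {κ D : ℝ} {w : Fin i → Fin n ⊕ Fin m → ℤ} (h : w ∈ WW m n i κ D) : TopC D κ w := by
  intro a k
  have := Fintype.mem_piFinset.1 (Fintype.mem_piFinset.1 h a) (Sum.inl k)
  rw [Finset.mem_Icc, Int.ceil_le, Int.le_floor] at this
  simp only [Sum.elim_inl] at this
  rw [abs_le]; constructor <;> linarith [this.1, this.2]

lemma WW_bot {κ D : ℝ} {w : Fin i → Fin n ⊕ Fin m → ℤ} (h : w ∈ WW m n i κ D) (a : Fin i) (r : Fin m) :
    -(D * (11/20)) ≤ (w a (Sum.inr r) : ℝ) ∧ (w a (Sum.inr r) : ℝ) ≤ - (D * (9/20)) := by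
  have := Fintype.mem_piFinset.1 (Fintype.mem_piFinset.1 h a) (Sum.inr r)
  rw [Finset.mem_Icc, Int.ceil_le, Int.le_floor] at this
  simpa using this

lemma card_Icc_ge (x y : ℝ) : y - x - 1 ≤ ((Finset.Icc ⌈x⌉ ⌊y⌋).card : ℝ) := by
  rw [Int.card_Icc]
  have h1 : ((⌊y⌋ + 1 - ⌈x⌉ : ℤ) : ℝ) ≤ (((⌊y⌋ + 1 - ⌈x⌉).toNat : ℕ) : ℝ) := by
    exact_mod_cast Int.self_le_toNat _
  push_cast at h1
  have := Int.lt_floor_add_one y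
  have := Int.ceil_lt_add_one x
  linarith

lemma WW_card {κ D : ℝ} (hκ : 0 < κ) (hD : 20 ≤ D) (hκD : 1 ≤ κ * D) :
    (κ * D) ^ (n * i) * (D / 20) ^ (m * i) ≤ ((WW m n i κ D).card : ℝ) := by
  unfold WW
  rw [Fintype.card_piFinset]
  simp only [Fintype.card_piFinset, Fintype.prod_sum_type, Sum.elim_inl, Sum.elim_inr]
  push_cast
  have : (κ * D) ^ (n * i) * (D / 20) ^ (m * i) = ∏ a : Fin i, ((∏ k : Fin n, (κ * D)) * ∏ r : Fin m, (D/20)) := by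
    simp only [Finset.prod_const, Finset.card_univ, Fintype.card_fin, mul_pow, ← pow_mul]
  rw [this]
  refine Finset.prod_le_prod (fun a _ => by positivity) fun a _ => ?_
  refine mul_le_mul ?_ ?_ (by positivity) (by positivity)
  · refine Finset.prod_le_prod (fun _ _ => by positivity) fun k _ => ?_
    refine le_trans ?_ (card_Icc_ge _ _)
    linarith
  · refine Finset.prod_le_prod (fun _ _ => by positivity) fun k _ => ?_
    refine le_trans ?_ (card_Icc_ge _ _)
    linarith

def CC (D θ : ℝ) (w : Fin i → Fin n ⊕ Fin m → ℤ) : Set (Fin m → Fin n → ℝ) :=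
  {B | ∀ a r, |∑ k, B r k * w a (Sum.inl k) + w a (Sum.inr r)| ≤ θ * D}

lemma measurableSet_CC (D θ : ℝ) (w : Fin i → Fin n ⊕ Fin m → ℤ) : MeasurableSet (CC D θ w) := by
  have : CC D θ w = ⋂ a, ⋂ r, {B : Fin m → Fin n → ℝ | |∑ k, B r k * (w a (Sum.inl k) : ℝ) + (w a (Sum.inr r) : ℝ)| ≤ θ * D} := by
    ext B; simp [CC]
  rw [this]
  refine MeasurableSet.iInter fun a => MeasurableSet.iInter fun r => measurableSet_le ?_ measurable_const
  have : Continuous fun B : Fin m → Fin n → ℝ => |∑ k, B r k * (w a (Sum.inl k) : ℝ) + (w a (Sum.inr r) : ℝ)| := by fun_prop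
  exact this.measurable

lemma CS_sub (hi : i ≤ n) {κ : ℝ} (hκ : KapOK m n κ) {D θ : ℝ} (hD : 0 < D) (hθ : θ ≤ 1/20)
    {w : Fin i → Fin n ⊕ Fin m → ℤ} (h : w ∈ WW m n i κ D) :
    CS D θ w (1/10) (fun _ _ => 1/2) ⊆ cube m n 1 ∩ CC D θ w := by
  intro B hB
  refine ⟨?_, hB.1⟩
  have h1 := (CS_eq hD hi θ w _ _ B).1 hB
  have h2 : ∀ r a, |(Matrix.of B * VV D w) r a| ≤ 3/5 := by
    intro r a
    have h3 := h1 r a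
    rw [Matrix.one_mul] at h3
    change |(Matrix.of B * VV D w) r a - _| ≤ _ at h3
    rw [abs_le] at h3 ⊢
    beta_reduce at h3
    split_ifs at h3 with hh
    · have hb := WW_bot h ⟨a, hh⟩ r
      have e1 : 9/20 ≤ -(w ⟨a, hh⟩ (Sum.inr r) : ℝ) / D := by rw [le_div_iff₀ hD]; linarith
      have e2 : -(w ⟨a, hh⟩ (Sum.inr r) : ℝ) / D ≤ 11/20 := by rw [div_le_iff₀ hD]; linarith
      constructor <;> linarith [h3.1, h3.2]
    · constructor <;> linarith [h3.1, h3.2]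
  have hM : ‖B‖ ≤ 3/5 + 1/4 * ‖B‖ := by
    refine (pi_norm_le_iff_of_nonneg (by positivity)).2 fun r => (pi_norm_le_iff_of_nonneg (by positivity)).2 fun a => ?_
    rw [Real.norm_eq_abs]
    have e1 : B r a = (Matrix.of B * VV D w) r a - ∑ k, B r k * (VV D w k a - (1 : Matrix (Fin n) (Fin n) ℝ) k a) := by
      simp [mul_sub, Finset.sum_sub_distrib, Matrix.mul_apply, Matrix.one_apply]
    have e2 : |∑ k, B r k * (VV D w k a - (1 : Matrix (Fin n) (Fin n) ℝ) k a)| ≤ ∑ _k : Fin n, ‖B‖ * κ := by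
      refine (Finset.abs_sum_le_sum_abs _ _).trans (Finset.sum_le_sum fun k _ => ?_)
      rw [abs_mul]
      refine mul_le_mul ?_ (VV_near hD hκ.1.le (WW_top h) k a) (abs_nonneg _) (norm_nonneg _)
      exact (norm_le_pi_norm (B r) k).trans (norm_le_pi_norm B r)
    have e3 : ∑ _k : Fin n, ‖B‖ * κ ≤ 1/4 * ‖B‖ := by
      rw [Finset.sum_const, Finset.card_univ, Fintype.card_fin, nsmul_eq_mul]
      have := hκ.2.2.1
      nlinarith [norm_nonneg B]
    rw [e1]
    refine (abs_sub _ _).trans ?_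
    linarith [h2 r a]
  intro r a
  have h5 : |B r a| ≤ ‖B‖ := (norm_le_pi_norm (B r) a).trans (norm_le_pi_norm B r)
  linarith

lemma Dth (hm : 1 ≤ m) (hn : 1 ≤ n) {R η : ℝ} (hR : 0 < R) :
    (η * uR n R) ^ (n * i) * (η * uR n R) ^ (m * i) * (th m n R) ^ (i * m) = η ^ ((m + n) * i) := by
  have h1 := uR_pow hn hR
  have h2 := uR_pow hm hR
  have p1 := uR_pos (n := n) hR
  have p2 := uR_pos (n := m) hR
  have e1 : η * uR n R * th m n R = η * (uR m R)⁻¹ := by unfold th; field_simp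
  rw [mul_comm i m, mul_assoc, ← mul_pow, e1, pow_mul, pow_mul, mul_pow, mul_pow _ _ m, inv_pow, h1, h2, ← mul_pow]
  have : η ^ n * R * (η ^ m * R⁻¹) = η ^ (m + n) := by rw [pow_add]; field_simp
  rw [this, ← pow_mul]

/-- lower bound on expected number -/
lemma lowerN (hm : 1 ≤ m) (hn : 1 ≤ n) (hi : i ≤ n) {κ : ℝ} (hκ : KapOK m n κ) : ∃ c0 > (0:ℝ), ∃ K0 > (0:ℝ), ∀ R : ℝ, 1 ≤ R →
    ∀ η : ℝ, 0 < η → η ≤ 1 → K0 ≤ η * uR n R →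
    ENNReal.ofReal (c0 * η ^ ((m+n) * i)) ≤ ∫⁻ B : Fin m → Fin n → ℝ in cube m n 1,
      ∑ w ∈ WW m n i κ (η * uR n R), (CC (η * uR n R) (th m n R) w).indicator 1 B := by
  have hκ0 := hκ.1
  refine ⟨κ ^ (n*i) * (1/20) ^ (m*i) * (1/2 * (2^i*(2*(1/10):ℝ)^(n-i))^m), by positivity, max 20 (1/κ), by positivity, fun R hR η hη hη1 hK => ?_⟩
  have hR0 : 0 < R := by linarith
  set D := η * uR n R with hDdef
  set θ := th m n R with hθdef
  have hD20 : 20 ≤ D := (le_max_left _ _).trans hK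
  have hκD : 1 ≤ κ * D := by
    have := (le_max_right 20 (1/κ)).trans hK
    rw [div_le_iff₀ hκ0] at this; linarith
  have hD : 0 < D := by linarith
  have hu := uR_pos (n := n) hR0
  have hv := uR_pos (n := m) hR0
  have hθ0 : 0 < θ := by rw [hθdef, th]; positivity
  have hθ : θ ≤ 1/20 := by
    rw [hθdef, th, one_div]
    apply inv_anti₀ (by norm_num)
    have := one_le_uR (n := m) hR
    have : D ≤ uR n R := by rw [hDdef]; nlinarith
    nlinarith
  rw [lintegral_finsetSum _ fun w _ => measurable_one.indicator (measurableSet_CC _ _ _)]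
  have hterm : ∀ w ∈ WW m n i κ D, ENNReal.ofReal (1/2 * ((2*θ)^i*(2*(1/10))^(n-i))^m) ≤
      ∫⁻ B : Fin m → Fin n → ℝ in cube m n 1, (CC D θ w).indicator 1 B := by
    intro w hw
    rw [lintegral_indicator_one (measurableSet_CC _ _ _), Measure.restrict_apply (measurableSet_CC _ _ _), Set.inter_comm]
    refine le_trans (vol_CS hm hi hκ hD hθ0.le (by norm_num) (WW_top hw) (fun _ _ => 1/2)).1 (measure_mono (CS_sub hi hκ hD hθ hw))
  refine le_trans ?_ (Finset.sum_le_sum hterm)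
  rw [Finset.sum_const, nsmul_eq_mul, ← ENNReal.ofReal_natCast, ← ENNReal.ofReal_mul (by positivity)]
  apply ENNReal.ofReal_le_ofReal
  have hc := WW_card (m := m) (n := n) (i := i) hκ0 hD20 hκD
  refine le_trans (le_of_eq ?_) (mul_le_mul_of_nonneg_right hc (by positivity))
  rw [← Dth (i := i) hm hn (η := η) hR0]
  rw [← hDdef, ← hθdef]
  simp only [mul_pow, div_pow, ← pow_mul, one_div, inv_pow]
  field_simp

lemma li_of_top (hm : 1 ≤ m) (hi : i ≤ n) {κ : ℝ} (hκ : KapOK m n κ) {D : ℝ} (hD : 0 < D) {w : Fin i → Fin n ⊕ Fin m → ℤ} (h : TopC D κ w) :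
    LinearIndependent ℝ (fun a => (lv 1 (w a) : EuclideanSpace ℝ (Fin n ⊕ Fin m))) := by
  have h1 : LinearIndependent ℝ (VV D w).col := Matrix.linearIndependent_cols_of_det_ne_zero (VV_det_ne hm hκ hD h)
  have h2 := h1.comp (Fin.castLE hi) (Fin.castLE_injective hi)
  let L : EuclideanSpace ℝ (Fin n ⊕ Fin m) →ₗ[ℝ] (Fin n → ℝ) :=
    { toFun := fun x k => D⁻¹ * x (Sum.inl k)
      map_add' := fun x y => by funext k; simp [mul_add]
      map_smul' := fun c x => by funext k; simp; ring }
  refine LinearIndependent.of_comp L ?_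
  convert h2 using 1
  funext a k
  have ha : ((Fin.castLE hi a : Fin n) : ℕ) < i := a.2
  change D⁻¹ * (lv 1 (w a) : EuclideanSpace ℝ (Fin n ⊕ Fin m)) (Sum.inl k) = VV D w k (Fin.castLE hi a)
  rw [VV, dif_pos ha, div_eq_inv_mul]
  simp only [lv, Matrix.one_mulVec]
  rfl

lemma norm_of_cond {κ : ℝ} (hκ : KapOK m n κ) {R η : ℝ} (hR : 0 < R) (hη : 0 < η)
    {w : Fin i → Fin n ⊕ Fin m → ℤ} (h : TopC (η * uR n R) κ w) {B : Fin m → Fin n → ℝ} (hB : B ∈ CC (η * uR n R) (th m n R) w) (a : Fin i) :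
    ‖lv (MB m n R B) (w a)‖ ≤ 2 * (m + n) * η := by
  have hu := uR_pos (n := n) hR
  have hv := uR_pos (n := m) hR
  refine (norm_le_of_coord (a := 2 * η) _ (by positivity) fun s => ?_).trans_eq ?_
  · rcases s with k | r
    · rw [lv_inl, uR_inv hR, abs_mul, abs_of_pos (inv_pos.2 hu), inv_mul_le_iff₀ hu]
      have h1 := abs_le.1 (h a k)
      have h2 : (0:ℝ) ≤ η * uR n R * (if (k:ℕ) = a then 1 else 0) := by split_ifs <;> positivity
      have h3 : η * uR n R * (if (k:ℕ) = a then 1 else 0) ≤ η * uR n R := by split_ifs <;> simp; positivity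
      have hp : 0 < η * uR n R := by positivity
      have h4 : κ * (η * uR n R) ≤ η * uR n R := by nlinarith [hκ.2.1]
      rw [abs_le]; constructor <;> nlinarith [h1.1, h1.2]
    · rw [lv_inr]
      change |uR m R * _| ≤ _
      rw [abs_mul, abs_of_pos hv]
      have h1 := hB a r
      have h2 : uR m R * (th m n R * (η * uR n R)) = η := by unfold th; field_simp
      calc _ ≤ uR m R * (th m n R * (η * uR n R)) := by gcongr
        _ ≤ _ := by rw [h2]; linarith
  · simp; ring

end Cnt
end KM

open MeasureTheory
open scoped ENNReal
set_option linter.unusedSectionVars false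
namespace KM
open InnerProductSpace

section Good
variable {m n i d : ℕ}

section gen
variable {ι : Type*} [Fintype ι] [DecidableEq ι]

def Good (e : Fin d ≃ ι) (i : ℕ) (c η T : ℝ) (M : Matrix ι ι ℝ) : Prop :=
  ∃ γ : (Matrix ι ι ℤ)ˣ, (∀ k < i, c * η ≤ rr (bb e (M * rm γ)) k) ∧ ∀ k, i ≤ k → k < d → c * T ≤ rr (bb e (M * rm γ)) k

lemma rr_pos_all (e : Fin d ≃ ι) (M : Matrix ι ι ℝ) (hM : M.det ≠ 0) (k : ℕ) (hk : k < d) : 0 < rr (bb e M) k := by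
  refine lt_of_le_of_ne (rr_nonneg _ _) fun h0 => ?_
  have h1 := PP_bb e M
  rw [PP, Finset.prod_eq_zero (Finset.mem_range.2 hk) h0.symm] at h1
  exact hM (abs_eq_zero.1 h1.symm)

lemma det_rm_ne (M : Matrix ι ι ℝ) (hM : M.det ≠ 0) (γ : (Matrix ι ι ℤ)ˣ) : (M * rm γ).det ≠ 0 := by
  rw [Matrix.det_mul]
  refine mul_ne_zero hM fun h => ?_
  have := abs_det_rm γ
  rw [h] at this; simp at this

lemma card_lv (e : Fin d ≃ ι) (M : Matrix ι ι ℝ) (hM : M.det ≠ 0) (γ : (Matrix ι ι ℤ)ˣ) {ρ : ℝ} (hρ : 0 ≤ ρ)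
    (S : Finset (ι → ℤ)) (hS : ∀ z ∈ S, ‖lv M z‖ ≤ ρ) : (S.card : ℝ) ≤ ∏ k : Fin d, (1 + 2 * ρ / rr (bb e (M * rm γ)) k) := by
  let g : (ι → ℤ) → (Fin d → ℤ) := fun z k => ((γ⁻¹ : (Matrix ι ι ℤ)ˣ) : Matrix ι ι ℤ).mulVec z (e k)
  have hg : Function.Injective g := by
    intro z z' h
    have h1 : ((γ⁻¹ : (Matrix ι ι ℤ)ˣ) : Matrix ι ι ℤ).mulVec z = ((γ⁻¹ : (Matrix ι ι ℤ)ˣ) : Matrix ι ι ℤ).mulVec z' := by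
      funext k
      have := congrFun h (e.symm k)
      simpa [g] using this
    have h2 := congrArg (fun x => (γ : Matrix ι ι ℤ).mulVec x) h1
    simpa only [Matrix.mulVec_mulVec, Units.mul_inv, Matrix.one_mulVec] using h2
  have := card_le (b := bb e (M * rm γ)) (rr_pos_all e _ (det_rm_ne M hM γ)) hρ (S.map ⟨g, hg⟩) ?_
  · simpa using this
  · intro z hz
    obtain ⟨z0, hz0, rfl⟩ := Finset.mem_map.1 hz
    simp only [Function.Embedding.coeFn_mk]
    rw [lc_bb, lv_mul_rm]
    have : (γ : Matrix ι ι ℤ).mulVec (fun k => g z0 (e.symm k)) = z0 := by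
      simp only [g, Equiv.apply_symm_apply]
      rw [Matrix.mulVec_mulVec, Units.mul_inv, Matrix.one_mulVec]
    rw [this]
    exact hS z0 hz0

lemma card_tuple (e : Fin d ≃ ι) (M : Matrix ι ι ℝ) (hM : M.det ≠ 0) (γ : (Matrix ι ι ℤ)ˣ) {ρ : ℝ} (hρ : 0 ≤ ρ)
    (S : Finset (Fin i → ι → ℤ)) (hS : ∀ w ∈ S, ∀ a, ‖lv M (w a)‖ ≤ ρ) :
    (S.card : ℝ) ≤ (∏ k : Fin d, (1 + 2 * ρ / rr (bb e (M * rm γ)) k)) ^ i := by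
  let S0 : Finset (ι → ℤ) := S.biUnion fun w => Finset.univ.image w
  have h1 : ∀ z ∈ S0, ‖lv M z‖ ≤ ρ := by
    intro z hz
    obtain ⟨w, hw, hz⟩ := Finset.mem_biUnion.1 hz
    obtain ⟨a, _, rfl⟩ := Finset.mem_image.1 hz
    exact hS w hw a
  have h2 : S ⊆ Fintype.piFinset fun _ => S0 := by
    intro w hw
    refine Fintype.mem_piFinset.2 fun a => Finset.mem_biUnion.2 ⟨w, hw, Finset.mem_image.2 ⟨a, Finset.mem_univ _, rfl⟩⟩
  have h3 := Finset.card_le_card h2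
  rw [Fintype.card_piFinset, Finset.prod_const, Finset.card_univ, Fintype.card_fin] at h3
  calc (S.card : ℝ) ≤ ((S0.card ^ i : ℕ) : ℝ) := by exact_mod_cast h3
    _ = (S0.card : ℝ) ^ i := by push_cast; rfl
    _ ≤ _ := by gcongr; exact card_lv e M hM γ hρ S0 h1

lemma Good.prod_le {e : Fin d ≃ ι} {c η T : ℝ} (hc : 0 < c) (hη : 0 < η) (hT : 0 < T) (hid : i ≤ d) {M : Matrix ι ι ℝ}
    {γ : (Matrix ι ι ℤ)ˣ} (hγ : (∀ k < i, c * η ≤ rr (bb e (M * rm γ)) k) ∧ ∀ k, i ≤ k → k < d → c * T ≤ rr (bb e (M * rm γ)) k)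
    {ρ : ℝ} (hρ : 0 ≤ ρ) :
    ∏ k : Fin d, (1 + 2 * ρ / rr (bb e (M * rm γ)) k) ≤ (1 + 2 * ρ / (c * η)) ^ i * (1 + 2 * ρ / (c * T)) ^ (d - i) := by
  rw [← prod_split hid]
  refine Finset.prod_le_prod (fun k _ => ?_) fun k _ => ?_
  · have := rr_nonneg (bb e (M * rm γ)) k; positivity
  · split_ifs with h
    · have := hγ.1 k h; gcongr
    · have := hγ.2 k (by omega) k.2; gcongr

lemma Good.card_le {e : Fin d ≃ ι} {c η T : ℝ} (hc : 0 < c) (hη : 0 < η) (hT : 0 < T) (hid : i ≤ d) {M : Matrix ι ι ℝ} (hM : M.det ≠ 0)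
    (h : Good e i c η T M) {ρ : ℝ} (hρ : 0 ≤ ρ)
    (S : Finset (Fin i → ι → ℤ)) (hS : ∀ w ∈ S, ∀ a, ‖lv M (w a)‖ ≤ ρ) :
    (S.card : ℝ) ≤ ((1 + 2 * ρ / (c * η)) ^ i * (1 + 2 * ρ / (c * T)) ^ (d - i)) ^ i := by
  obtain ⟨γ, hγ⟩ := h
  refine (card_tuple e M hM γ hρ S hS).trans ?_
  refine pow_le_pow_left₀ (Finset.prod_nonneg fun k _ => ?_) (Good.prod_le hc hη hT hid hγ hρ) i
  have := rr_nonneg (bb e (M * rm γ)) k; positivity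

lemma Good.not_SV {e : Fin d ≃ ι} {c η T : ℝ} {M : Matrix ι ι ℝ} (h : Good e i c η T M) {r : ℝ} (hr : r < c * T) : ¬ SV e M (i+1) r := by
  obtain ⟨γ, hγ⟩ := h
  rw [← sv_rm e M γ]
  rintro ⟨v, h1, h2, h3⟩
  obtain ⟨a, J, hJ1, hJ2, hJ3⟩ := exists_large _ i v h1 h2
  have := hγ.2 J hJ1 hJ2
  linarith [h3 a]

end gen

lemma measurable_bb (e : Fin d ≃ Fin n ⊕ Fin m) (R : ℝ) (γ : (Matrix (Fin n ⊕ Fin m) (Fin n ⊕ Fin m) ℤ)ˣ) (j : ℕ) :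
    Measurable fun B : Fin m → Fin n → ℝ => bb e (MB m n R B * rm γ) j := by
  have h1 : Continuous fun B : Fin m → Fin n → ℝ => MB m n R B := by
    unfold MB UB
    refine continuous_const.matrix_mul ?_
    refine Continuous.matrix_fromBlocks continuous_const continuous_const ?_ continuous_const
    exact continuous_id
  have h2 : Continuous fun B : Fin m → Fin n → ℝ => mf (MB m n R B * rm γ) := h1.matrix_mul continuous_const
  exact (measurable_ext0 j).comp ((cols_mp e).measurable.comp h2.measurable)

lemma measurableSet_Good (e : Fin d ≃ Fin n ⊕ Fin m) (i : ℕ) (c η T R : ℝ) :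
    MeasurableSet {B : Fin m → Fin n → ℝ | Good e i c η T (MB m n R B)} := by
  unfold Good
  simp only [Set.ofPred_exists, Set.ofPred_and, Set.ofPred_forall]
  refine MeasurableSet.iUnion fun γ => MeasurableSet.inter ?_ ?_
  · exact MeasurableSet.iInter fun k => MeasurableSet.iInter fun _ => measurableSet_le measurable_const (measurable_rr (measurable_bb e R γ) k)
  · exact MeasurableSet.iInter fun k => MeasurableSet.iInter fun _ => MeasurableSet.iInter fun _ => measurableSet_le measurable_const (measurable_rr (measurable_bb e R γ) k)

noncomputable def NN (m n i : ℕ) (κ R η : ℝ) (B : Fin m → Fin n → ℝ) : ℝ≥0∞ :=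
  ∑ w ∈ WW m n i κ (η * uR n R), (CC (η * uR n R) (th m n R) w).indicator 1 B

lemma measurable_NN (κ R η : ℝ) : Measurable (NN m n i κ R η) := by
  unfold NN
  exact Finset.measurable_sum _ fun w _ => measurable_one.indicator (measurableSet_CC _ _ _)

open Classical in
lemma NN_eq (κ R η : ℝ) (B : Fin m → Fin n → ℝ) :
    NN m n i κ R η B = ENNReal.ofReal (((WW m n i κ (η * uR n R)).filter fun w => B ∈ CC (η * uR n R) (th m n R) w).card : ℝ) := by
  unfold NN
  simp only [Set.indicator_apply, Pi.one_apply]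
  rw [Finset.sum_ite]
  simp

theorem est2 (e : Fin d ≃ Fin n ⊕ Fin m) (hm : 1 ≤ m) (hn : 1 ≤ n) (hi1 : 1 ≤ i) (hi : i ≤ n) {κ : ℝ} (hκ : KapOK m n κ) (ε : ℝ) (hε : 0 < ε) :
    ∃ c > (0:ℝ), ∃ y0 > (0:ℝ), ∀ R : ℝ, 1 ≤ R → ∀ y : ℝ, 0 < y → y ≤ y0 →
    ∫⁻ B : Fin m → Fin n → ℝ in cube m n 1, {B | ¬ Good e i c (y^(d-i)) ((y^i)⁻¹) (MB m n R B)}.indicator (NN m n i κ R (y^(d-i))) B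
      ≤ ENNReal.ofReal (ε * (y^(d-i)) ^ (d * i)) := by
  classical
  have hdmn : d = m + n := by
    have := Fintype.card_congr e; simp at this; omega
  obtain ⟨C, hC, hH⟩ := haarF e hm hn 1 zero_le_one
  obtain ⟨C', hC', hCC⟩ := ofReal_const hC
  have hA1 : (1:ℝ) ≤ 2 ^ d * (2 * (2 * d)) := by
    have : (1:ℝ) ≤ d := by exact_mod_cast (by omega : 1 ≤ d)
    have : (1:ℝ) ≤ 2 ^ d := one_le_pow₀ (by norm_num)
    nlinarith
  set A : ℝ := 2 ^ d * (2 * (2 * d)) with hA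
  obtain ⟨c, hc, y0, hy0, hV⟩ := V2 (E := EuclideanSpace ℝ (Fin n ⊕ Fin m)) d (finrank_E e) i hi1 (by omega) A hA1 (ε / C') (by positivity)
  refine ⟨c / 2, by positivity, y0, hy0, fun R hR y hy hyy => ?_⟩
  have hR0 : 0 < R := by linarith
  set η := y^(d-i) with hη
  set T := (y^i)⁻¹ with hT
  have hηpos : 0 < η := by positivity
  have hmP : Measurable fun b : Fin d → EuclideanSpace ℝ (Fin n ⊕ Fin m) => ENNReal.ofReal ((∏ k : Fin d, (1 + 2 * (A * η) / rr (ext0 b) k)) ^ i) := by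
    refine ENNReal.measurable_ofReal.comp (Measurable.pow_const (Finset.measurable_prod _ fun k _ => ?_) i)
    exact measurable_const.add (measurable_const.div (measurable_rr measurable_ext0 k))
  have key := hH R hR (Ψ := (Bad d i (A * η) c η T).indicator fun b => ENNReal.ofReal ((∏ k : Fin d, (1 + 2 * (A * η) / rr (ext0 b) k)) ^ i))
    (hmP.indicator (measurableSet_Bad _ _ _ _ _ _))
    (Φ := {B | ¬ Good e i (c/2) η T (MB m n R B)}.indicator (NN m n i κ R η)) ?_
  · refine key.trans ?_
    rw [setLIntegral_indicator (measurableSet_Bad _ _ _ _ _ _), Set.inter_eq_left.2 (fun b hb => hb.1)]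
    calc _ ≤ ENNReal.ofReal C' * ENNReal.ofReal (ε / C' * η ^ (d * i)) := by gcongr; exact hV y hy hyy
      _ = _ := by
        rw [← ENNReal.ofReal_mul hC'.le]; congr 1; field_simp
  · intro q hq B hB γ hF
    by_cases hG : Good e i (c/2) η T (MB m n R B)
    · rw [Set.indicator_of_notMem (by simpa using hG)]; exact zero_le
    rw [Set.indicator_of_mem (by simpa using hG), NN_eq]
    set S := (WW m n i κ (η * uR n R)).filter fun w => B ∈ CC (η * uR n R) (th m n R) w with hS
    rcases S.eq_empty_or_nonempty with hSe | ⟨w0, hw0⟩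
    · rw [hSe]; simp
    have hu := uR_pos (n := n) hR0
    have hdet : (MB m n R B).det ≠ 0 := by rw [det_MB hm hn hR0]; simp
    have hbd : ∀ w ∈ S, ∀ a, ‖lv (MB m n R B) (w a)‖ ≤ 2 * d * η := by
      intro w hw a
      rw [Finset.mem_filter] at hw
      have := norm_of_cond hκ hR0 hηpos (WW_top hw.1) hw.2 a
      rw [hdmn]; push_cast; exact this
    have hSV : SV e (MB m n R B) i (2 * d * η) := by
      rw [sv_iff e _ hdet]
      exact ⟨w0, li_of_top hm hi hκ (by positivity : 0 < η * uR n R) (WW_top (Finset.mem_filter.1 hw0).1), hbd w0 hw0⟩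
    set b' := bb e (q * (MB m n R B * rm γ)) with hb'
    have hrn : ∀ k, rr b' k ≤ 2 * rr (bb e (MB m n R B * rm γ)) k := fun k => rr_nice e hq _ k
    have hbad : cols e (mf (q * (MB m n R B * rm γ))) ∈ Bad d i (A * η) c η T := by
      refine ⟨hF, ?_, ?_⟩
      · intro k hk
        have h2 : SV e (q * (MB m n R B * rm γ)) i (2 * (2 * d * η)) :=
          sv_mul e q _ hq.det_ne (by norm_num) hq.le ((sv_rm e _ γ i _).2 hSV)
        obtain ⟨v, hv1, hv2, hv3⟩ := h2
        have := hF.1.short v hv1 hv2 hv3 hk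
        refine this.trans_eq ?_
        rw [hA]; ring
      · rintro ⟨h1, h2⟩
        refine hG ⟨γ, fun k hk => ?_, fun k hk hk' => ?_⟩
        · have h3 : c * η ≤ rr b' k := h1 k hk
          linarith [hrn k]
        · have h3 : c * T ≤ rr b' k := h2 k hk hk'
          linarith [hrn k]
    rw [Set.indicator_of_mem hbad]
    apply ENNReal.ofReal_le_ofReal
    refine (card_tuple e _ hdet γ (by positivity) S hbd).trans ?_
    have hb'' : ext0 (cols e (mf (q * (MB m n R B * rm γ)))) = b' := rfl
    rw [hb'']
    have hpos : ∀ k : Fin d, 0 < rr (bb e (MB m n R B * rm γ)) k := fun k => rr_pos_all e _ (det_rm_ne _ hdet γ) k k.2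
    refine pow_le_pow_left₀ (Finset.prod_nonneg fun k _ => ?_) (Finset.prod_le_prod (fun k _ => ?_) fun k _ => ?_) i
    · have := hpos k; positivity
    · have := hpos k; positivity
    · have h1 := hpos k
      have h2 := hrn k
      have h3 : 0 < rr b' k := hF.1.pos k k.2
      have h4 : (2:ℝ) * (2 * d * η) ≤ A * η := by
        rw [hA]
        have : (1:ℝ) ≤ 2 ^ d := one_le_pow₀ (by norm_num)
        have h5 : (0:ℝ) ≤ d * η := by positivity
        nlinarith
      gcongr 1 + ?_
      rw [div_le_div_iff₀ h1 h3]
      have h6 : (0:ℝ) ≤ d * η := by positivity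
      nlinarith

end Good
end KM

open MeasureTheory
open scoped ENNReal
set_option linter.unusedSectionVars false
namespace KM
open InnerProductSpace

section Low
variable {m n i d : ℕ}

def GG (e : Fin d ≃ Fin n ⊕ Fin m) (i : ℕ) (κ c R y : ℝ) : Set (Fin m → Fin n → ℝ) :=
  cube m n 1 ∩ ({B | Good e i c (y^(d-i)) ((y^i)⁻¹) (MB m n R B)} ∩
    ⋃ w ∈ WW m n i κ (y^(d-i) * uR n R), CC (y^(d-i) * uR n R) (th m n R) w)

lemma measurableSet_GG (e : Fin d ≃ Fin n ⊕ Fin m) (i : ℕ) (κ c R y : ℝ) : MeasurableSet (GG e i κ c R y) :=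
  (measurableSet_cube 1).inter ((measurableSet_Good e i c _ _ R).inter
    (Finset.measurableSet_biUnion _ fun w _ => measurableSet_CC _ _ w))

lemma dmn (e : Fin d ≃ Fin n ⊕ Fin m) : d = m + n := by
  have := Fintype.card_congr e; simp at this; omega

lemma GG_SV (e : Fin d ≃ Fin n ⊕ Fin m) (hm : 1 ≤ m) (hn : 1 ≤ n) (hi : i ≤ n) {κ : ℝ} (hκ : KapOK m n κ) {c R y : ℝ} (hR : 0 < R) (hy : 0 < y)
    {B : Fin m → Fin n → ℝ} (hB : B ∈ GG e i κ c R y) : SV e (MB m n R B) i (2 * d * y^(d-i)) := by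
  obtain ⟨_, _, h⟩ := hB
  simp only [Set.mem_iUnion] at h
  obtain ⟨w, hw, hw2⟩ := h
  have hu := uR_pos (n := n) hR
  rw [sv_iff e _ (by rw [det_MB hm hn hR]; simp)]
  refine ⟨w, li_of_top hm hi hκ (by positivity : 0 < y^(d-i) * uR n R) (WW_top hw), fun a => ?_⟩
  have := norm_of_cond hκ hR (by positivity) (WW_top hw) hw2 a
  have hd := dmn e
  have hd' : (d:ℝ) = m + n := by exact_mod_cast hd
  rw [hd']; exact this

theorem lowerG (e : Fin d ≃ Fin n ⊕ Fin m) (hm : 1 ≤ m) (hn : 1 ≤ n) (hi1 : 1 ≤ i) (hi : i ≤ n) {κ : ℝ} (hκ : KapOK m n κ) :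
    ∃ c > (0:ℝ), ∃ y0 > (0:ℝ), y0 ≤ 1 ∧ ∃ c1 > (0:ℝ), ∃ K0 > (0:ℝ), ∀ R : ℝ, 1 ≤ R → ∀ y : ℝ, 0 < y → y ≤ y0 → K0 ≤ y^(d-i) * uR n R →
    ENNReal.ofReal (c1 * (y^(d-i)) ^ (d * i)) ≤ volume (GG e i κ c R y) := by
  classical
  have hd := dmn e
  obtain ⟨c0, hc0, K0, hK0, hlow⟩ := lowerN (i := i) hm hn hi hκ
  obtain ⟨c, hc, y0, hy0, hE⟩ := est2 e hm hn hi1 hi hκ (c0/2) (by positivity)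
  set K : ℝ := ((1 + 4 * d / c) ^ d) ^ i with hK
  have hKpos : 0 < K := by positivity
  refine ⟨c, hc, min y0 1, by positivity, min_le_right _ _, c0 / 2 / K, by positivity, K0, hK0, fun R hR y hy hyy hKy => ?_⟩
  have hR0 : 0 < R := by linarith
  have hy1 : y ≤ 1 := hyy.trans (min_le_right _ _)
  have hE' := hE R hR y hy (hyy.trans (min_le_left _ _))
  set η := y^(d-i) with hη
  set T := (y^i)⁻¹ with hT
  have hηpos : 0 < η := by positivity
  have hη1 : η ≤ 1 := pow_le_one₀ hy.le hy1
  have hT1 : 1 ≤ T := (one_le_inv₀ (by positivity)).2 (pow_le_one₀ hy.le hy1)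
  have hl := hlow R hR η hηpos hη1 hKy
  rw [← hd] at hl
  change _ ≤ ∫⁻ B in cube m n 1, NN m n i κ R η B at hl
  set G := {B | Good e i c η T (MB m n R B)} with hG
  have hGm : MeasurableSet G := measurableSet_Good e i c _ _ R
  have hsplit : ∫⁻ B in cube m n 1, NN m n i κ R η B =
      (∫⁻ B in cube m n 1, G.indicator (NN m n i κ R η) B) + ∫⁻ B in cube m n 1, Gᶜ.indicator (NN m n i κ R η) B := by
    rw [← lintegral_add_left ((measurable_NN κ R η).indicator hGm)]
    congr 1
    funext B
    exact (congrFun (Set.indicator_self_add_compl G (NN m n i κ R η)) B).symm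
  have hgood : ∫⁻ B in cube m n 1, G.indicator (NN m n i κ R η) B ≤ ENNReal.ofReal K * volume (GG e i κ c R y) := by
    have hpt : ∀ B ∈ cube m n 1, G.indicator (NN m n i κ R η) B ≤ ENNReal.ofReal K * (GG e i κ c R y).indicator 1 B := by
      intro B hB
      by_cases hBG : B ∈ G
      · rw [Set.indicator_of_mem hBG, NN_eq]
        set S := (WW m n i κ (η * uR n R)).filter fun w => B ∈ CC (η * uR n R) (th m n R) w with hS
        rcases S.eq_empty_or_nonempty with hSe | ⟨w0, hw0⟩
        · rw [hSe]; simp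
        have hw0' := Finset.mem_filter.1 hw0
        have hBGG : B ∈ GG e i κ c R y := by
          refine ⟨hB, hBG, ?_⟩
          simp only [Set.mem_iUnion]
          exact ⟨w0, hw0'.1, hw0'.2⟩
        rw [Set.indicator_of_mem hBGG, Pi.one_apply, mul_one]
        apply ENNReal.ofReal_le_ofReal
        have hdet : (MB m n R B).det ≠ 0 := by rw [det_MB hm hn hR0]; simp
        have hbd : ∀ w ∈ S, ∀ a, ‖lv (MB m n R B) (w a)‖ ≤ 2 * d * η := by
          intro w hw a
          rw [Finset.mem_filter] at hw
          have := norm_of_cond hκ hR0 hηpos (WW_top hw.1) hw.2 a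
          have hd' : (d:ℝ) = m + n := by exact_mod_cast hd
          rw [hd']; exact this
        have hTpos : 0 < T := by linarith
        refine (Good.card_le hc hηpos hTpos (by omega : i ≤ d) hdet hBG (by positivity) S hbd).trans ?_
        rw [hK]
        refine pow_le_pow_left₀ (by positivity) ?_ i
        have e1 : 1 + 2 * (2 * d * η) / (c * η) = 1 + 4 * d / c := by field_simp; ring
        have e2 : 1 + 2 * (2 * d * η) / (c * T) ≤ 1 + 4 * d / c := by
          rw [← e1]; gcongr; linarith
        calc _ ≤ (1 + 4 * d / c) ^ i * (1 + 4 * d / c) ^ (d - i) := by rw [e1]; gcongr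
          _ = _ := by rw [← pow_add]; congr 1; omega
      · rw [Set.indicator_of_notMem hBG]; exact zero_le
    refine (setLIntegral_mono' (measurableSet_cube 1) hpt).trans ?_
    rw [lintegral_const_mul' _ _ ENNReal.ofReal_ne_top, lintegral_indicator_one (measurableSet_GG e i κ c R y)]
    gcongr
    exact Measure.restrict_le_self
  rw [hsplit] at hl
  have hfin := hl.trans (add_le_add hgood hE')
  have e1 : ENNReal.ofReal (c0 * η ^ (d*i)) = ENNReal.ofReal (c0/2 * η ^ (d*i)) + ENNReal.ofReal (c0/2 * η ^ (d*i)) := by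
    rw [← ENNReal.ofReal_add (by positivity) (by positivity)]; congr 1; ring
  rw [e1] at hfin
  have h3 := (ENNReal.add_le_add_iff_right ENNReal.ofReal_ne_top).1 hfin
  have e2 : ENNReal.ofReal (c0 / 2 / K * η ^ (d*i)) = ENNReal.ofReal (c0/2 * η ^ (d*i)) / ENNReal.ofReal K := by
    rw [← ENNReal.ofReal_div_of_pos hKpos]; congr 1; field_simp
  rw [e2]
  refine ENNReal.div_le_of_le_mul ?_
  exact h3.trans_eq (mul_comm _ _)

end Low
end KM

open MeasureTheory
open scoped ENNReal
set_option linter.unusedSectionVars false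
namespace KM
open InnerProductSpace

section Pair
variable {m n i d : ℕ}

lemma th_pos {R : ℝ} (hR : 0 < R) : 0 < th m n R := by
  have := uR_pos (n := n) hR
  have := uR_pos (n := m) hR
  unfold th; positivity

lemma th_le_one {R : ℝ} (hR : 1 ≤ R) : th m n R ≤ 1 := by
  have := one_le_uR (n := n) hR
  have := one_le_uR (n := m) hR
  unfold th
  exact inv_le_one_of_one_le₀ (by nlinarith)

lemma perturb {R : ℝ} (hR : 0 < R) {B B' : Fin m → Fin n → ℝ} (h : ∀ r k, |B r k - B' r k| ≤ th m n R) (w : Fin n ⊕ Fin m → ℤ) :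
    ‖lv (MB m n R B) w‖ ≤ (m + n) * (1 + n) * ‖lv (MB m n R B') w‖ := by
  set x := lv (MB m n R B') w with hx
  have hu := uR_pos (n := n) hR
  have hv := uR_pos (n := m) hR
  refine (norm_le_of_coord (a := (1 + n) * ‖x‖) _ (by positivity) fun s => ?_).trans_eq ?_
  · rcases s with k | r
    · have h1 : lv (MB m n R B) w (Sum.inl k) = x (Sum.inl k) := by rw [hx, lv_inl, lv_inl]
      rw [h1]
      refine (abs_coord_le x _).trans ?_
      have : (0:ℝ) ≤ n := by positivity
      nlinarith [norm_nonneg x]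
    · have hq : ∀ k, |(w (Sum.inl k) : ℝ)| ≤ uR n R * ‖x‖ := by
        intro k
        have h2 : x (Sum.inl k) = (uR n R)⁻¹ * w (Sum.inl k) := by rw [hx, lv_inl, uR_inv hR]
        have h3 := abs_coord_le x (Sum.inl k)
        rw [h2, abs_mul, abs_of_pos (inv_pos.2 hu), inv_mul_le_iff₀ hu] at h3
        exact h3
      have h1 : lv (MB m n R B) w (Sum.inr r) = x (Sum.inr r) + uR m R * ∑ k, (B r k - B' r k) * w (Sum.inl k) := by
        rw [hx, lv_inr, lv_inr]
        simp only [sub_mul, Finset.sum_sub_distrib]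
        change uR m R * _ = uR m R * _ + _
        ring
      have h4 : |∑ k, (B r k - B' r k) * (w (Sum.inl k) : ℝ)| ≤ ∑ _k : Fin n, th m n R * (uR n R * ‖x‖) := by
        refine (Finset.abs_sum_le_sum_abs _ _).trans (Finset.sum_le_sum fun k _ => ?_)
        rw [abs_mul]
        exact mul_le_mul (h r k) (hq k) (abs_nonneg _) (th_pos hR).le
      rw [Finset.sum_const, Finset.card_univ, Fintype.card_fin, nsmul_eq_mul] at h4
      rw [h1]
      refine (abs_add_le _ _).trans ?_
      rw [abs_mul, abs_of_pos hv]
      have h5 : uR m R * (n * (th m n R * (uR n R * ‖x‖))) = n * ‖x‖ := by unfold th; field_simp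
      have h6 := mul_le_mul_of_nonneg_left h4 hv.le
      rw [h5] at h6
      linarith [abs_coord_le x (Sum.inr r)]
  · simp; ring

/-- numeric lemma -/
lemma num_pair (hid : i ≤ d) {y η η' T ω g : ℝ} (hy : 0 < y) (hy1 : y ≤ 1) (hη : η = y^(d-i)) (hT : T = (y^i)⁻¹) (hη' : 0 < η') (hle : η' ≤ η)
    (hω : 1 ≤ ω) (hg : 0 ≤ g) :
    (ω ^ (i*d))⁻¹ * ((1 + g * (η' * ω) / η)^i * (1 + g * (η' * ω) / T)^(d-i))^i ≤
      (1+g)^(d*i) * ((ω^(i*(d-i)))⁻¹ + η'^(d*i)) := by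
  have hηp : 0 < η := by rw [hη]; positivity
  have hTp : 0 < T := by rw [hT]; positivity
  have hη1 : η ≤ 1 := by rw [hη]; exact pow_le_one₀ hy.le hy1
  have hT1 : 1 ≤ T := by rw [hT]; exact (one_le_inv₀ (by positivity)).2 (pow_le_one₀ hy.le hy1)
  have hω0 : 0 < ω := by linarith
  have hsp : ∀ x : ℝ, x ^ d = x ^ i * x ^ (d - i) := fun x => by rw [← pow_add]; congr 1; omega
  rcases le_or_gt (η' * ω) T with hD | hD
  · have h1 : 1 + g * (η' * ω) / T ≤ 1 + g := by
      rw [mul_div_assoc]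
      have : η' * ω / T ≤ 1 := (div_le_one hTp).2 hD
      nlinarith
    have h2 : 1 + g * (η' * ω) / η ≤ (1 + g) * ω := by
      have : g * (η' * ω) / η ≤ g * ω := by
        rw [div_le_iff₀ hηp]
        have : η' * ω ≤ ω * η := by nlinarith
        nlinarith
      nlinarith
    calc _ ≤ (ω ^ (i*d))⁻¹ * (((1+g)*ω)^i * (1+g)^(d-i))^i := by gcongr
      _ = (1+g)^(d*i) * (ω^(i*(d-i)))⁻¹ := by
        have : i * d = i * i + i * (d - i) := by rw [← mul_add]; congr 1; omega
        rw [this, pow_add, mul_pow (1+g) ω, pow_mul (1+g), hsp (1+g), mul_pow _ _ i, mul_pow _ _ i, mul_pow _ _ i, pow_mul ω i i]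
        field_simp
      _ ≤ _ := by
        gcongr
        have : 0 < η'^(d*i) := by positivity
        linarith
  · have h0 : ∀ S, 0 < S → S ≤ T → 1 + g * (η' * ω) / S ≤ (1+g) * ((η' * ω) / S) := by
      intro S hS hST
      have : 1 ≤ η' * ω / S := (one_le_div hS).2 (by linarith)
      rw [mul_div_assoc]; linarith
    have h1 := h0 T hTp le_rfl
    have h2 := h0 η hηp (by linarith)
    have hηT : η^i * T^(d-i) = 1 := by
      rw [hη, hT, inv_pow, ← pow_mul, ← pow_mul, mul_comm (d-i) i]
      exact mul_inv_cancel₀ (pow_ne_zero _ hy.ne')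
    calc _ ≤ (ω ^ (i*d))⁻¹ * (((1+g) * ((η' * ω) / η))^i * ((1+g) * ((η' * ω) / T))^(d-i))^i := by gcongr
      _ = (ω ^ (i*d))⁻¹ * ((1+g)^d * (η' * ω)^d * (η^i * T^(d-i))⁻¹)^i := by
        congr 2
        rw [hsp (1+g), hsp (η' * ω)]
        simp only [mul_pow, div_pow]
        field_simp
      _ = (1+g)^(d*i) * η'^(d*i) := by
        rw [hηT, inv_one, mul_one, mul_pow _ _ i, mul_pow, mul_pow _ _ i, mul_comm i d]
        simp only [← pow_mul]
        field_simp
      _ ≤ _ := by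
        gcongr
        have : 0 < (ω^(i*(d-i)))⁻¹ := by positivity
        linarith

end Pair
end KM

open MeasureTheory
open scoped ENNReal
set_option linter.unusedSectionVars false
namespace KM
open InnerProductSpace

section Pair
variable {m n i d : ℕ}

lemma fub (A : Set (Fin m → Fin n → ℝ)) (hA : MeasurableSet A) (r : ℝ) :
    ∫⁻ B1 : Fin m → Fin n → ℝ, volume (A ∩ nbx B1 r) = ENNReal.ofReal (2 * r) ^ (n * m) * volume A := by
  set P : Set ((Fin m → Fin n → ℝ) × (Fin m → Fin n → ℝ)) := {p | p.2 ∈ A ∧ ∀ i j, |p.2 i j - p.1 i j| ≤ r} with hP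
  have hPm : MeasurableSet P := by
    have h1 : P = (Prod.snd ⁻¹' A) ∩ ⋂ i, ⋂ j, {p : (Fin m → Fin n → ℝ) × (Fin m → Fin n → ℝ) | |p.2 i j - p.1 i j| ≤ r} := by
      ext p; simp [hP]
    rw [h1]
    refine (measurable_snd hA).inter (MeasurableSet.iInter fun i => MeasurableSet.iInter fun j => measurableSet_le ?_ measurable_const)
    have : Continuous fun p : (Fin m → Fin n → ℝ) × (Fin m → Fin n → ℝ) => |p.2 i j - p.1 i j| := by fun_prop
    exact this.measurable
  have e1 := Measure.prod_apply (μ := (volume : Measure (Fin m → Fin n → ℝ))) (ν := (volume : Measure (Fin m → Fin n → ℝ))) hPm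
  have e2 := Measure.prod_apply_symm (μ := (volume : Measure (Fin m → Fin n → ℝ))) (ν := (volume : Measure (Fin m → Fin n → ℝ))) hPm
  have e3 : ∀ B1 : Fin m → Fin n → ℝ, Prod.mk B1 ⁻¹' P = A ∩ nbx B1 r := fun B1 => by
    ext x; simp [hP, nbx]
  have e4 : ∀ x : Fin m → Fin n → ℝ, volume ((fun B1 : Fin m → Fin n → ℝ => (B1, x)) ⁻¹' P) = A.indicator (fun _ => ENNReal.ofReal (2 * r) ^ (n * m)) x := fun x => by
    by_cases hx : x ∈ A
    · have : (fun B1 : Fin m → Fin n → ℝ => (B1, x)) ⁻¹' P = nbx x r := by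
        ext y; simp [hP, nbx, hx, abs_sub_comm]
      rw [this, volume_nbx, Set.indicator_of_mem hx]; simp
    · have : (fun B1 : Fin m → Fin n → ℝ => (B1, x)) ⁻¹' P = ∅ := by
        ext y; simp [hP, hx]
      rw [this, Set.indicator_of_notMem hx]; simp
  simp only [e3] at e1
  simp only [e4] at e2
  rw [← e1, e2, lintegral_indicator hA, lintegral_const]
  simp

lemma uR_mono {n : ℕ} {R R' : ℝ} (hR : 0 < R) (h : R ≤ R') : uR n R ≤ uR n R' := Real.rpow_le_rpow hR.le h (by positivity)

lemma norm_cross {κ : ℝ} (hκ : KapOK m n κ) {R R' η : ℝ} (hR : 0 < R) (hRR : R ≤ R') (hη : 0 < η)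
    {w : Fin i → Fin n ⊕ Fin m → ℤ} (h : TopC (η * uR n R') κ w) {B : Fin m → Fin n → ℝ} (hB : B ∈ CC (η * uR n R') (th m n R') w) (a : Fin i) :
    ‖lv (MB m n R B) (w a)‖ ≤ 2 * (m + n) * (η * (uR n R' / uR n R)) := by
  have hR' : 0 < R' := by linarith
  have hu := uR_pos (n := n) hR
  have hv := uR_pos (n := m) hR
  have hu' := uR_pos (n := n) hR'
  have hv' := uR_pos (n := m) hR'
  have hω : 1 ≤ uR n R' / uR n R := (one_le_div hu).2 (uR_mono hR hRR)
  refine (norm_le_of_coord (a := 2 * (η * (uR n R' / uR n R))) _ (by positivity) fun s => ?_).trans_eq ?_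
  · rcases s with k | r
    · rw [lv_inl, uR_inv hR, abs_mul, abs_of_pos (inv_pos.2 hu), inv_mul_le_iff₀ hu]
      have e : uR n R * (2 * (η * (uR n R' / uR n R))) = 2 * (η * uR n R') := by field_simp
      rw [e]
      have h1 := abs_le.1 (h a k)
      have h2 : (0:ℝ) ≤ η * uR n R' * (if (k:ℕ) = a then 1 else 0) := by split_ifs <;> positivity
      have h3 : η * uR n R' * (if (k:ℕ) = a then 1 else 0) ≤ η * uR n R' := by split_ifs <;> simp; positivity
      have hp : 0 < η * uR n R' := by positivity
      have h4 : κ * (η * uR n R') ≤ η * uR n R' := by nlinarith [hκ.2.1]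
      rw [abs_le]; constructor <;> nlinarith [h1.1, h1.2]
    · rw [lv_inr]
      change |uR m R * _| ≤ _
      rw [abs_mul, abs_of_pos hv]
      have h1 := hB a r
      have h2 : uR m R' * (th m n R' * (η * uR n R')) = η := by unfold th; field_simp
      calc _ ≤ uR m R' * (th m n R' * (η * uR n R')) :=
            mul_le_mul (uR_mono hR hRR) h1 (abs_nonneg _) hv'.le
        _ ≤ _ := by rw [h2]; nlinarith
  · simp; ring

lemma th_ratio (hm : 1 ≤ m) (hn : 1 ≤ n) (hi : i ≤ n) {R R' : ℝ} (hR : 0 < R) (hR' : 0 < R') :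
    2 * ((2 * th m n R')^i * (2 * th m n R)^(n-i))^m = 2 * 2^(n*m) * (th m n R)^(n*m) * ((uR n R' / uR n R)^(i*(m+n)))⁻¹ := by
  have h1 := uR_pow hn hR
  have h2 := uR_pow hm hR
  have h1' := uR_pow hn hR'
  have h2' := uR_pow hm hR'
  have hu := uR_pos (n := n) hR
  have hv := uR_pos (n := m) hR
  have hu' := uR_pos (n := n) hR'
  have hv' := uR_pos (n := m) hR'
  have e1 : (uR n R' / uR n R)^n = (uR m R' / uR m R)^m := by rw [div_pow, div_pow, h1, h2, h1', h2']
  have e2 : th m n R' = th m n R * (uR n R' / uR n R)⁻¹ * (uR m R' / uR m R)⁻¹ := by unfold th; field_simp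
  have e3 : (th m n R')^(i*m) = (th m n R)^(i*m) * ((uR n R' / uR n R)^(i*(m+n)))⁻¹ := by
    rw [e2, mul_pow, mul_pow, mul_assoc]
    congr 1
    rw [mul_add, pow_add, inv_pow, inv_pow, mul_inv, mul_comm i m, mul_comm i n, pow_mul (uR m R' / uR m R), ← e1, ← pow_mul]
  rw [mul_pow, ← pow_mul, ← pow_mul, mul_pow, mul_pow, e3]
  have e4 : n * m = i * m + (n-i)*m := by rw [← add_mul]; congr 1; omega
  rw [e4, pow_add, pow_add]; ring
end Pair
end KM

open MeasureTheory
open scoped ENNReal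
set_option linter.unusedSectionVars false
namespace KM
open InnerProductSpace

section Pair
variable {m n i d : ℕ}

lemma loc (e : Fin d ≃ Fin n ⊕ Fin m) (hm : 1 ≤ m) (hn : 1 ≤ n) (hi : i ≤ n) {κ c : ℝ} (hκ : KapOK m n κ) (hc : 0 < c)
    {R R' y y' : ℝ} (hR : 1 ≤ R) (hRR : R ≤ R') (hy' : 0 < y') (hyy : y' ≤ y) (hy1 : y ≤ 1)
    {B0 : Fin m → Fin n → ℝ} (hB0 : B0 ∈ GG e i κ c R y) :
    volume (GG e i κ c R' y' ∩ nbx B0 (th m n R)) ≤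
      ENNReal.ofReal (2 * 2^(n*m) * (1 + 2 * ((m+n)*(1+n)*(2*(m+n))) / c)^(d*i) * ((th m n R)^(n*m) *
        (((uR n R' / uR n R)^(i*(d-i)))⁻¹ + (y'^(d-i))^(d*i)))) := by
  classical
  have hd := dmn e
  have hR0 : 0 < R := by linarith
  have hR0' : 0 < R' := by linarith
  have hy : 0 < y := by linarith
  set η := y^(d-i) with hη
  set T := (y^i)⁻¹ with hT
  set η' := y'^(d-i) with hη'
  set ω := uR n R' / uR n R with hω
  set θ := th m n R with hθ
  set K : ℝ := (m+n)*(1+n)*(2*(m+n)) with hK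
  have hη'p : 0 < η' := by positivity
  have hle : η' ≤ η := pow_le_pow_left₀ hy'.le hyy _
  have hu := uR_pos (n := n) hR0
  have hu' := uR_pos (n := n) hR0'
  have hω1 : 1 ≤ ω := (one_le_div hu).2 (uR_mono hR0 hRR)
  have hθp : 0 < θ := th_pos hR0
  set D' := η' * uR n R' with hD'
  have hD'p : 0 < D' := by positivity
  set S := (WW m n i κ D').filter fun w => ∃ B ∈ CC D' (th m n R') w, ∀ r k, |B r k - B0 r k| ≤ θ with hS
  have hsub : GG e i κ c R' y' ∩ nbx B0 θ ⊆ ⋃ w ∈ S, CS D' (th m n R') w θ B0 := by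
    rintro B ⟨⟨_, _, hB⟩, hB2⟩
    simp only [Set.mem_iUnion] at hB ⊢
    obtain ⟨w, hw, hw2⟩ := hB
    exact ⟨w, Finset.mem_filter.2 ⟨hw, B, hw2, hB2⟩, hw2, fun a r _ => hB2 r a⟩
  have hnorm : ∀ w ∈ S, ∀ a, ‖lv (MB m n R B0) (w a)‖ ≤ K * (η' * ω) := by
    intro w hw a
    obtain ⟨hw, B, hB, hB2⟩ := Finset.mem_filter.1 hw
    have h1 := norm_cross hκ hR0 hRR hη'p (WW_top hw) hB a
    have h2 := perturb hR0 (B := B0) (B' := B) (fun r k => by rw [abs_sub_comm]; exact hB2 r k) (w a)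
    refine h2.trans ?_
    calc _ ≤ ((m:ℝ)+n)*(1+n) * (2 * (m + n) * (η' * ω)) := by gcongr
      _ = _ := by rw [hK]; ring
  have hcard := Good.card_le (e := e) hc (by positivity : 0 < η) (by positivity : 0 < T) (by omega) (by rw [det_MB hm hn hR0]; simp) hB0.2.1
    (by positivity : 0 ≤ K * (η' * ω)) S hnorm
  have hnum := num_pair (d := d) (i := i) (g := 2 * K / c) (by omega) hy hy1 hη hT hη'p hle hω1 (by positivity)
  have e1 : 2 * (K * (η' * ω)) / (c * η) = 2 * K / c * (η' * ω) / η := by field_simp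
  have e2 : 2 * (K * (η' * ω)) / (c * T) = 2 * K / c * (η' * ω) / T := by field_simp
  rw [e1, e2] at hcard
  have hrat := th_ratio (i := i) hm hn hi hR0 hR0'
  rw [← hd, ← hω, ← hθ] at hrat
  have hvol : ∀ w ∈ S, volume (CS D' (th m n R') w θ B0) ≤ ENNReal.ofReal (2 * 2^(n*m) * θ^(n*m) * (ω^(i*d))⁻¹) := by
    intro w hw
    rw [← hrat]
    exact (vol_CS hm hi hκ hD'p (th_pos hR0').le hθp.le (WW_top (Finset.mem_filter.1 hw).1) B0).2
  refine (measure_mono hsub).trans ((measure_biUnion_finset_le _ _).trans ((Finset.sum_le_sum hvol).trans ?_))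
  rw [Finset.sum_const, nsmul_eq_mul, ← ENNReal.ofReal_natCast, ← ENNReal.ofReal_mul (by positivity)]
  refine ENNReal.ofReal_le_ofReal ?_
  calc _ ≤ (((1 + 2 * K / c * (η' * ω) / η) ^ i * (1 + 2 * K / c * (η' * ω) / T) ^ (d - i)) ^ i) * (2 * 2^(n*m) * θ^(n*m) * (ω^(i*d))⁻¹) := by
        gcongr
    _ = 2 * 2^(n*m) * θ^(n*m) * ((ω^(i*d))⁻¹ * (((1 + 2 * K / c * (η' * ω) / η) ^ i * (1 + 2 * K / c * (η' * ω) / T) ^ (d - i)) ^ i)) := by ring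
    _ ≤ 2 * 2^(n*m) * θ^(n*m) * ((1 + 2 * K / c)^(d*i) * ((ω^(i*(d-i)))⁻¹ + η'^(d*i))) := by
        have : 0 ≤ 2 * 2^(n*m) * θ^(n*m) := by positivity
        exact mul_le_mul_of_nonneg_left hnum this
    _ = _ := by ring

theorem pairG (e : Fin d ≃ Fin n ⊕ Fin m) (hm : 1 ≤ m) (hn : 1 ≤ n) (hi1 : 1 ≤ i) (hi : i ≤ n) {κ c : ℝ} (hκ : KapOK m n κ) (hc : 0 < c) :
    ∃ C > (0:ℝ), ∀ R R' y y' : ℝ, 1 ≤ R → R ≤ R' → 0 < y' → y' ≤ y → y ≤ 1 →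
      volume (GG e i κ c R y ∩ GG e i κ c R' y') ≤
      ENNReal.ofReal (C * ((y^(d-i))^(d*i) * (((uR n R' / uR n R)^(i*(d-i)))⁻¹ + (y'^(d-i))^(d*i)))) := by
  have hd := dmn e
  obtain ⟨C1, hC1, h1⟩ := est1' e hm hn 2 (by norm_num) i hi1 (by omega)
  set L : ℝ := 2 * 2^(n*m) * (1 + 2 * ((m+n)*(1+n)*(2*(m+n))) / c)^(d*i) with hL
  set K2 : ℝ := (m+n)*(1+n)*(2*d) with hK2
  have hdp : (0:ℝ) < d := by exact_mod_cast (by omega : 0 < d)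
  have hK2p : 0 < K2 := by
    have : (0:ℝ) < m := by exact_mod_cast hm
    positivity
  have hLp : 0 < L := by positivity
  refine ⟨L * C1 * K2^(d*i), by positivity, fun R R' y y' hR hRR hy' hyy hy1 => ?_⟩
  have hR0 : 0 < R := by linarith
  have hy : 0 < y := by linarith
  set θ := th m n R with hθ
  have hθp : 0 < θ := th_pos hR0
  have hθ1 : θ ≤ 1 := th_le_one hR
  set Q : ℝ := (((uR n R' / uR n R)^(i*(d-i)))⁻¹ + (y'^(d-i))^(d*i)) with hQ
  have hQp : 0 < Q := by
    have := uR_pos (n := n) hR0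
    have := uR_pos (n := n) (by linarith : 0 < R')
    positivity
  set A := GG e i κ c R y ∩ GG e i κ c R' y' with hA
  have hAm : MeasurableSet A := (measurableSet_GG e i κ c R y).inter (measurableSet_GG e i κ c R' y')
  set E := cube m n 2 ∩ {B | SV e (MB m n R B) i (K2 * y^(d-i))} with hE
  have hEm : MeasurableSet E := (measurableSet_cube 2).inter (measurableSet_SV e hm hn hR0 i _)
  have key : ∀ B1 : Fin m → Fin n → ℝ, volume (A ∩ nbx B1 (θ/2)) ≤ E.indicator (fun _ => ENNReal.ofReal (L * (θ^(n*m) * Q))) B1 := by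
    intro B1
    rcases Set.eq_empty_or_nonempty (A ∩ nbx B1 (θ/2)) with h0 | ⟨B0, hB0, hB01⟩
    · rw [h0]; simp
    have hdiff : ∀ r k, |B1 r k - B0 r k| ≤ θ := fun r k => by
      rw [abs_sub_comm]; have := hB01 r k; linarith
    have hmem : B1 ∈ E := by
      refine ⟨fun r k => ?_, ?_⟩
      · have h2 := hB0.1.1 r k
        have h3 := hdiff r k
        have h4 : B1 r k = (B1 r k - B0 r k) + B0 r k := by ring
        rw [h4]
        refine (abs_add_le _ _).trans (by linarith)
      · have h2 := GG_SV e hm hn hi hκ hR0 hy hB0.1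
        have hdet : ∀ B, (MB m n R B).det ≠ 0 := fun B => by rw [det_MB hm hn hR0]; simp
        rw [sv_iff e _ (hdet _)] at h2
        change SV e (MB m n R B1) i _
        rw [sv_iff e _ (hdet _)]
        obtain ⟨w, hw, hw2⟩ := h2
        refine ⟨w, hw, fun a => (perturb hR0 hdiff (w a)).trans ?_⟩
        calc _ ≤ ((m:ℝ)+n)*(1+n) * (2 * d * y^(d-i)) := by gcongr; exact hw2 a
          _ = _ := by rw [hK2]; ring
    rw [Set.indicator_of_mem hmem]
    refine le_trans (measure_mono ?_) (loc e hm hn hi hκ hc hR hRR hy' hyy hy1 hB0.1)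
    rintro B ⟨⟨_, hB⟩, hB2⟩
    refine ⟨hB, fun r k => ?_⟩
    have h2 := hB2 r k
    have h3 := hB01 r k
    rw [abs_le] at *
    constructor <;> linarith [h2.1, h2.2, h3.1, h3.2]
  have hf := fub A hAm (θ/2)
  have hf2 := lintegral_mono key (μ := volume)
  rw [hf, lintegral_indicator hEm, lintegral_const, Measure.restrict_apply_univ] at hf2
  have h3 := h1 R hR (K2 * y^(d-i)) (by positivity)
  have h4 := hf2.trans (mul_le_mul_right h3 _)
  rw [← ENNReal.ofReal_mul (by positivity), ← ENNReal.ofReal_pow (by positivity)] at h4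
  have e1 : 2 * (θ/2) = θ := by ring
  rw [e1] at h4
  have e2 : L * (θ^(n*m) * Q) * (C1 * (K2 * y^(d-i))^(d*i)) = θ^(n*m) * (L * C1 * K2^(d*i) * ((y^(d-i))^(d*i) * Q)) := by
    rw [mul_pow]; ring
  rw [e2, ENNReal.ofReal_mul (by positivity)] at h4
  have hpos : ENNReal.ofReal (θ^(n*m)) ≠ 0 := by
    simp only [ne_eq, ENNReal.ofReal_eq_zero, not_le]; positivity
  exact (ENNReal.mul_le_mul_iff_right hpos ENNReal.ofReal_ne_top).1 h4
end Pair
end KM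

open MeasureTheory
open scoped ENNReal
set_option linter.unusedSectionVars false
namespace KM

section KS

lemma geo_le {ρ : ℝ} (h0 : 0 ≤ ρ) (h1 : ρ < 1) (L M l : ℕ) :
    ∑ l' ∈ (Finset.Ico L M).filter (fun l' => l ≤ l'), ρ^(l'-l) ≤ (1-ρ)⁻¹ := by
  calc _ ≤ ∑ l' ∈ Finset.Ico l M, ρ^(l'-l) := by
        refine Finset.sum_le_sum_of_subset_of_nonneg ?_ fun _ _ _ => by positivity
        intro x hx
        simp only [Finset.mem_filter, Finset.mem_Ico] at hx ⊢
        omega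
    _ = ∑ k ∈ Finset.range (M - l), ρ^k := by
        rw [Finset.sum_Ico_eq_sum_range]
        exact Finset.sum_congr rfl fun k _ => by congr 1; omega
    _ ≤ ∑' k, ρ^k := (summable_geometric_of_lt_one h0 h1).sum_le_tsum _ fun _ _ => by positivity
    _ = _ := tsum_geometric_of_lt_one h0 h1

lemma dsum {p : ℕ → ℕ → ℝ} {a : ℕ → ℝ} {C ρ : ℝ} (hC : 0 ≤ C) (ha : ∀ l, 0 ≤ a l) (h0 : 0 ≤ ρ) (h1 : ρ < 1) (hsymm : ∀ l l', p l l' = p l' l)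
    (hp : ∀ l l', l ≤ l' → p l l' ≤ C * (a l * (ρ^(l'-l) + a l'))) (L M : ℕ) :
    ∑ l ∈ Finset.Ico L M, ∑ l' ∈ Finset.Ico L M, p l l' ≤
      2 * (C * ((∑ l ∈ Finset.Ico L M, a l) * ((1-ρ)⁻¹ + ∑ l ∈ Finset.Ico L M, a l))) := by
  set I := Finset.Ico L M with hI
  set q : ℕ → ℕ → ℝ := fun l l' => if l ≤ l' then C * (a l * (ρ^(l'-l) + a l')) else 0 with hq
  have hqn : ∀ l l', 0 ≤ q l l' := fun l l' => by
    simp only [hq]; split_ifs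
    · have := ha l; have := ha l'; positivity
    · exact le_rfl
  have hpq : ∀ l l', p l l' ≤ q l l' + q l' l := by
    intro l l'
    rcases le_total l l' with h | h
    · have := hp l l' h
      have e : q l l' = C * (a l * (ρ^(l'-l) + a l')) := if_pos h
      linarith [hqn l' l]
    · have := hp l' l h
      have e : q l' l = C * (a l' * (ρ^(l-l') + a l)) := if_pos h
      rw [hsymm]; linarith [hqn l l']
  have hone : ∑ l ∈ I, ∑ l' ∈ I, q l l' ≤ C * ((∑ l ∈ I, a l) * ((1-ρ)⁻¹ + ∑ l ∈ I, a l)) := by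
    rw [Finset.sum_mul, Finset.mul_sum]
    refine Finset.sum_le_sum fun l _ => ?_
    simp only [hq]
    rw [← Finset.sum_filter, ← Finset.mul_sum, ← Finset.mul_sum, Finset.sum_add_distrib]
    have g1 := geo_le h0 h1 L M l
    have g2 : ∑ l' ∈ I.filter (fun l' => l ≤ l'), a l' ≤ ∑ l' ∈ I, a l' :=
      Finset.sum_le_sum_of_subset_of_nonneg (Finset.filter_subset _ _) fun _ _ _ => ha _
    have := ha l
    gcongr
  calc _ ≤ ∑ l ∈ I, ∑ l' ∈ I, (q l l' + q l' l) := Finset.sum_le_sum fun l _ => Finset.sum_le_sum fun l' _ => hpq l l'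
    _ = ∑ l ∈ I, ∑ l' ∈ I, q l l' + ∑ l ∈ I, ∑ l' ∈ I, q l' l := by simp only [Finset.sum_add_distrib]
    _ = 2 * ∑ l ∈ I, ∑ l' ∈ I, q l l' := by rw [Finset.sum_comm (f := fun l l' => q l' l)]; ring
    _ ≤ _ := by linarith

theorem kochen_stone {X : Type*} [MeasurableSpace X] (μ : Measure X) (Q : Set X) (hQ : μ Q ≠ ∞) (G : ℕ → Set X)
    (hG : ∀ l, MeasurableSet (G l)) (hGQ : ∀ l, G l ⊆ Q) (a : ℕ → ℝ) (ha : ∀ l, 0 ≤ a l) (c1 C ρ : ℝ) (hc1 : 0 < c1) (hC : 0 < C)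
    (h0 : 0 ≤ ρ) (h1 : ρ < 1) (hlow : ∀ l, ENNReal.ofReal (c1 * a l) ≤ μ (G l))
    (hup : ∀ l l', l ≤ l' → μ (G l ∩ G l') ≤ ENNReal.ofReal (C * (a l * (ρ^(l'-l) + a l'))))
    (hS : ¬ Summable a) : ¬ ∀ᵐ x ∂μ, ∀ᶠ l in Filter.atTop, x ∉ G l := by
  intro hae
  set U : ℕ → Set X := fun L => ⋃ l, ⋃ (_ : L ≤ l), G l with hU
  have hUm : ∀ L, MeasurableSet (U L) := fun L => MeasurableSet.iUnion fun l => MeasurableSet.iUnion fun _ => hG l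
  have hUQ : ∀ L, U L ⊆ Q := fun L => Set.iUnion_subset fun l => Set.iUnion_subset fun _ => hGQ l
  have hUf : ∀ L, μ (U L) ≠ ∞ := fun L => ne_top_of_le_ne_top hQ (measure_mono (hUQ L))
  have hGf : ∀ l, μ (G l) ≠ ∞ := fun L => ne_top_of_le_ne_top hQ (measure_mono (hGQ L))
  have hanti : Antitone U := by
    intro L L' h x hx
    simp only [hU, Set.mem_iUnion] at hx ⊢
    obtain ⟨l, hl, hx⟩ := hx
    exact ⟨l, h.trans hl, hx⟩
  have hnull : μ (⋂ L, U L) = 0 := by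
    refine measure_mono_null ?_ hae
    intro x hx
    simp only [Set.mem_compl_iff]
    intro hx2
    obtain ⟨N, hN⟩ := Filter.eventually_atTop.1 hx2
    have := Set.mem_iInter.1 hx N
    simp only [hU, Set.mem_iUnion] at this
    obtain ⟨l, hl, hx⟩ := this
    exact hN l hl hx
  have htend := tendsto_measure_iInter_atTop (μ := μ) (fun L => (hUm L).nullMeasurableSet) hanti ⟨0, hUf 0⟩
  rw [hnull] at htend
  set C' : ℝ := 2 * C * ((1-ρ)⁻¹ + 1) with hC'
  have hρ1 : 0 < (1-ρ)⁻¹ := inv_pos.2 (by linarith)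
  have hC'p : 0 < C' := by positivity
  have hlb : ∀ L, c1^2/C' ≤ (μ (U L)).toReal := by
    intro L
    have hsum : Filter.Tendsto (fun M => ∑ l ∈ Finset.range M, a l) Filter.atTop Filter.atTop :=
      (not_summable_iff_tendsto_nat_atTop_of_nonneg ha).1 hS
    obtain ⟨M, hM, hLM⟩ := ((hsum.eventually_ge_atTop (1 + ∑ l ∈ Finset.range L, a l)).and (Filter.eventually_ge_atTop L)).exists
    set S := ∑ l ∈ Finset.Ico L M, a l with hSd
    have hS1 : 1 ≤ S := by
      have := Finset.sum_range_add_sum_Ico a hLM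
      linarith
    set W : X → ℝ := fun x => ∑ l ∈ Finset.Ico L M, (G l).indicator (fun _ => (1:ℝ)) x with hW
    have hi1 : ∀ s : Set X, MeasurableSet s → s ⊆ Q → Integrable (s.indicator (fun _ => (1:ℝ))) μ := fun s hs hsQ =>
      (integrable_indicator_iff hs).2 (integrableOn_const (ne_top_of_le_ne_top hQ (measure_mono hsQ)))
    have hv : ∀ s : Set X, MeasurableSet s → ∫ x, s.indicator (fun _ => (1:ℝ)) x ∂μ = μ.real s := fun s hs => by
      rw [integral_indicator hs]; simp
    have hsq : ∀ x, W x ^ 2 = ∑ l ∈ Finset.Ico L M, ∑ l' ∈ Finset.Ico L M, (G l ∩ G l').indicator (fun _ => (1:ℝ)) x := by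
      intro x
      simp only [hW]
      rw [sq, Finset.sum_mul_sum]
      refine Finset.sum_congr rfl fun l _ => Finset.sum_congr rfl fun l' _ => ?_
      by_cases h : x ∈ G l <;> by_cases h' : x ∈ G l' <;> simp [h, h']
    have hWi : ∫ x, W x ∂μ = ∑ l ∈ Finset.Ico L M, μ.real (G l) := by
      simp only [hW]
      rw [integral_finsetSum _ fun l _ => hi1 _ (hG l) (hGQ l)]
      exact Finset.sum_congr rfl fun l _ => hv _ (hG l)
    have hii : ∀ l l', Integrable ((G l ∩ G l').indicator (fun _ => (1:ℝ))) μ := fun l l' =>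
      hi1 _ ((hG l).inter (hG l')) (Set.inter_subset_left.trans (hGQ l))
    have hW2 : ∫ x, W x ^ 2 ∂μ = ∑ l ∈ Finset.Ico L M, ∑ l' ∈ Finset.Ico L M, μ.real (G l ∩ G l') := by
      simp only [hsq]
      rw [integral_finsetSum _ fun l _ => integrable_finsetSum _ fun l' _ => hii l l']
      refine Finset.sum_congr rfl fun l _ => ?_
      rw [integral_finsetSum _ fun l' _ => hii l l']
      exact Finset.sum_congr rfl fun l' _ => hv _ ((hG l).inter (hG l'))
    have hWint : Integrable W μ := integrable_finsetSum _ fun l _ => hi1 _ (hG l) (hGQ l)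
    have hW2int : Integrable (fun x => W x ^ 2) μ := by
      simp only [hsq]
      exact integrable_finsetSum _ fun l _ => integrable_finsetSum _ fun l' _ => hii l l'
    set t := c1 / (C' * S) with ht
    have htp : 0 < t := by positivity
    have hpt : ∀ x, 2 * W x ≤ t * W x ^ 2 + t⁻¹ * (U L).indicator (fun _ => (1:ℝ)) x := by
      intro x
      by_cases hx : x ∈ U L
      · rw [Set.indicator_of_mem hx]
        have : 0 ≤ t * (W x - t⁻¹)^2 := by positivity
        have e : t * (W x - t⁻¹)^2 = t * W x ^ 2 - 2 * W x + t⁻¹ := by field_simp; ring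
        linarith
      · rw [Set.indicator_of_notMem hx]
        have : W x = 0 := by
          simp only [hW]
          refine Finset.sum_eq_zero fun l hl => Set.indicator_of_notMem (fun h => hx ?_) _
          exact Set.mem_iUnion.2 ⟨l, Set.mem_iUnion.2 ⟨(Finset.mem_Ico.1 hl).1, h⟩⟩
        rw [this]; simp
    have hintg := integral_mono (μ := μ) (hWint.const_mul 2) ((hW2int.const_mul t).add ((hi1 _ (hUm L) (hUQ L)).const_mul t⁻¹)) hpt
    have e3 := integral_add (μ := μ) (hW2int.const_mul t) ((hi1 _ (hUm L) (hUQ L)).const_mul t⁻¹)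
    simp only [Pi.add_apply] at hintg
    rw [e3, integral_const_mul, integral_const_mul, integral_const_mul, hv _ (hUm L), hWi, hW2] at hintg
    have hl1 : c1 * S ≤ ∑ l ∈ Finset.Ico L M, μ.real (G l) := by
      rw [hSd, Finset.mul_sum]
      refine Finset.sum_le_sum fun l _ => ?_
      exact (ENNReal.ofReal_le_iff_le_toReal (hGf l)).1 (hlow l)
    have hu1 := dsum (p := fun l l' => μ.real (G l ∩ G l')) hC.le ha h0 h1 (fun l l' => by rw [Set.inter_comm])
      (fun l l' h => by
        have hn : 0 ≤ C * (a l * (ρ^(l'-l) + a l')) := by have := ha l; have := ha l'; positivity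
        exact ENNReal.toReal_le_of_le_ofReal hn (hup l l' h)) L M
    rw [← hSd] at hu1
    have hu2 : 2 * (C * (S * ((1-ρ)⁻¹ + S))) ≤ C' * S^2 := by
      have : S * ((1-ρ)⁻¹ + S) ≤ ((1-ρ)⁻¹ + 1) * S^2 := by nlinarith [mul_nonneg hρ1.le (by nlinarith : 0 ≤ S^2 - S)]
      rw [hC']; nlinarith
    have hA : t * (∑ l ∈ Finset.Ico L M, ∑ l' ∈ Finset.Ico L M, μ.real (G l ∩ G l')) ≤ c1 * S := by
      calc _ ≤ t * (C' * S^2) := mul_le_mul_of_nonneg_left (hu1.trans hu2) htp.le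
        _ = c1 * S := by rw [ht]; field_simp
    have hfin : c1 * S ≤ t⁻¹ * μ.real (U L) := by linarith
    have e5 : t⁻¹ * μ.real (U L) = C' / c1 * S * μ.real (U L) := by rw [ht, inv_div]; ring
    rw [e5] at hfin
    change _ ≤ μ.real (U L)
    rw [div_le_iff₀ hC'p]
    have h6 : c1 ≤ C' / c1 * μ.real (U L) := by
      have : 0 < S := by linarith
      have h7 : c1 * S ≤ (C' / c1 * μ.real (U L)) * S := by linarith
      exact le_of_mul_le_mul_right h7 this
    have h8 := mul_le_mul_of_nonneg_left h6 hc1.le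
    have e9 : c1 * (C' / c1 * μ.real (U L)) = μ.real (U L) * C' := by field_simp
    nlinarith
  have ht2 := (ENNReal.tendsto_toReal (ENNReal.zero_ne_top)).comp htend
  have : c1^2/C' ≤ 0 := by
    have := ge_of_tendsto' ht2 hlb
    simpa using this
  have : 0 < c1^2/C' := by positivity
  linarith
end KS
end KM

open MeasureTheory
open scoped ENNReal
set_option linter.unusedSectionVars false
namespace KM
open InnerProductSpace

section DivD
variable {m n i d : ℕ}

lemma uR_exp (n l : ℕ) : uR n (Real.exp l) = Real.exp (l / n) := by
  unfold uR
  rw [← Real.exp_mul]; congr 1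

lemma uR_exp_ratio (n k l l' : ℕ) (h : l ≤ l') : ((uR n (Real.exp l') / uR n (Real.exp l))^k)⁻¹ = (Real.exp (-(k/n)))^(l'-l) := by
  rw [uR_exp, uR_exp, ← Real.exp_sub, ← Real.exp_nat_mul, ← Real.exp_neg, ← Real.exp_nat_mul, Nat.cast_sub h]
  congr 1; ring

theorem divD (e : Fin d ≃ Fin n ⊕ Fin m) (hm : 1 ≤ m) (hn : 1 ≤ n) (hi1 : 1 ≤ i) (hi : i ≤ n) :
    ∃ c > (0:ℝ), ∀ y : ℕ → ℝ, Antitone y → (∀ l, 0 < y l) → Filter.Tendsto y Filter.atTop (nhds 0) →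
      ¬ Summable (fun l => (y l^(d-i))^(d*i)) →
      ¬ ∀ᵐ B : Fin m → Fin n → ℝ ∂volume, ∀ᶠ l : ℕ in Filter.atTop,
        ¬ (SV e (MB m n (Real.exp l) B) i (2*d*y l^(d-i)) ∧
          ∀ r < c * (y l^i)⁻¹, ¬ SV e (MB m n (Real.exp l) B) (i+1) r) := by
  classical
  have hd := dmn e
  obtain ⟨κ, hκ⟩ := exists_kappa m n
  obtain ⟨c, hc, y0, hy0, hy01, c1, hc1, K0, hK0, hlow⟩ := lowerG e hm hn hi1 hi hκ
  obtain ⟨C, hC, hpair⟩ := pairG e hm hn hi1 hi hκ hc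
  refine ⟨c, hc, fun y hanti hpos htend hns hae => ?_⟩
  set adm : ℕ → Prop := fun l => y l ≤ y0 ∧ K0 ≤ y l^(d-i) * uR n (Real.exp l) with hadm
  set a : ℕ → ℝ := fun l => if adm l then (y l^(d-i))^(d*i) else 0 with ha
  set G : ℕ → Set (Fin m → Fin n → ℝ) := fun l => if adm l then GG e i κ c (Real.exp l) (y l) else ∅ with hG
  have hR : ∀ l : ℕ, 1 ≤ Real.exp l := fun l => Real.one_le_exp (by positivity)
  have hcube : volume (cube m n 1) ≠ ∞ := by
    have : cube m n 1 = nbx 0 1 := by ext B; simp [cube, nbx]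
    rw [this, volume_nbx]
    exact ENNReal.pow_ne_top ENNReal.ofReal_ne_top
  have hnp : (0:ℝ) < n := by exact_mod_cast hn
  have hexp : 0 < ((i*(d-i) : ℕ) : ℝ) / n := by
    have : 0 < i * (d-i) := Nat.mul_pos hi1 (by omega)
    have : (0:ℝ) < ((i*(d-i) : ℕ) : ℝ) := by exact_mod_cast this
    positivity
  refine kochen_stone volume (cube m n 1) hcube G ?_ ?_ a ?_ c1 C (Real.exp (-(((i*(d-i) : ℕ) : ℝ)/n))) hc1 hC (Real.exp_pos _).le
    (Real.exp_lt_one_iff.2 (by linarith)) ?_ ?_ ?_ ?_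
  · intro l; simp only [hG]; split_ifs
    · exact measurableSet_GG _ _ _ _ _ _
    · exact MeasurableSet.empty
  · intro l; simp only [hG]; split_ifs
    · exact Set.inter_subset_left
    · exact Set.empty_subset _
  · intro l; simp only [ha]; have := hpos l; split_ifs <;> positivity
  · intro l; simp only [ha, hG]; split_ifs with h
    · exact hlow _ (hR l) _ (hpos l) h.1 h.2
    · simp
  · intro l l' hll
    by_cases h : adm l
    · by_cases h' : adm l'
      · simp only [ha, hG, if_pos h, if_pos h']
        rw [← uR_exp_ratio _ _ _ _ hll]
        exact hpair _ _ _ _ (hR l) (Real.exp_le_exp.2 (by exact_mod_cast hll)) (hpos l') (hanti hll) (h.1.trans hy01)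
      · simp [hG, h']
    · simp [hG, h]
  · intro hs
    apply hns
    set q : ℝ := Real.exp (-(((d*i : ℕ) : ℝ)/n)) with hq
    have hdi : (0:ℝ) < ((d*i : ℕ) : ℝ) := by exact_mod_cast Nat.mul_pos (by omega) hi1
    have hq1 : q < 1 := Real.exp_lt_one_iff.2 (neg_lt_zero.2 (by positivity))
    have hgeo : Summable fun l : ℕ => K0^(d*i) * q^l := (summable_geometric_of_lt_one (Real.exp_pos _).le hq1).mul_left _
    refine Summable.of_norm_bounded_eventually_nat (hs.add hgeo) ?_
    have hev : ∀ᶠ l in Filter.atTop, y l < y0 := htend.eventually_lt_const hy0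
    filter_upwards [hev] with l hl
    have hyl := hpos l
    have hqp : 0 < q := Real.exp_pos _
    rw [Real.norm_of_nonneg (by positivity)]
    by_cases h : adm l
    · simp only [ha, if_pos h]
      have : 0 ≤ K0^(d*i) * q^l := by positivity
      linarith
    · simp only [ha, if_neg h, zero_add]
      have h2 : y l^(d-i) * uR n (Real.exp l) < K0 := by
        by_contra h3; exact h ⟨hl.le, not_lt.1 h3⟩
      rw [uR_exp] at h2
      have h3 : y l^(d-i) ≤ K0 * Real.exp (-(l/n)) := by
        rw [Real.exp_neg, ← div_eq_mul_inv, le_div_iff₀ (Real.exp_pos _)]; exact h2.le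
      calc _ ≤ (K0 * Real.exp (-(l/n)))^(d*i) := by gcongr
        _ = _ := by
          rw [mul_pow, hq, ← Real.exp_nat_mul, ← Real.exp_nat_mul]; congr 2; ring
  · filter_upwards [hae] with B hB
    filter_upwards [hB] with l hl hBl
    simp only [hG] at hBl
    split_ifs at hBl with h
    · exact hl ⟨GG_SV e hm hn hi hκ (Real.exp_pos _) (hpos l) hBl, fun r hr => Good.not_SV hBl.2.1 hr⟩
    · exact hBl
end DivD
end KM

open MeasureTheory
open scoped ENNReal
set_option linter.unusedSectionVars false
namespace KM
open InnerProductSpace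

section Fin1
variable {m n i d k : ℕ}

lemma root_pow {x : ℝ} (hx : 0 ≤ x) {p : ℕ} (hp : 1 ≤ p) : (x ^ ((p:ℝ)⁻¹))^p = x := Real.rpow_inv_natCast_pow hx (by omega)

lemma yseq (c : ℝ) (hc : 0 < c) (α : ℝ) (hα : 0 < α) (p : ℕ) (hp : 1 ≤ p) (g : ℕ → ℝ) (hg : ∀ l, 0 < g l) (hmono : Monotone g)
    (htend : Filter.Tendsto g Filter.atTop Filter.atTop) :
    ∃ y : ℕ → ℝ, Antitone y ∧ (∀ l, 0 < y l) ∧ Filter.Tendsto y Filter.atTop (nhds 0) ∧ ∀ l, y l ^ p = c * (g l ^ α)⁻¹ := by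
  have hgp : ∀ l, 0 < c * (g l ^ α)⁻¹ := fun l => mul_pos hc (inv_pos.2 (Real.rpow_pos_of_pos (hg l) _))
  have hpp : (0:ℝ) < (p:ℝ)⁻¹ := inv_pos.2 (by exact_mod_cast hp)
  refine ⟨fun l => (c * (g l ^ α)⁻¹) ^ ((p:ℝ)⁻¹), ?_, fun l => Real.rpow_pos_of_pos (hgp l) _, ?_, fun l => root_pow (hgp l).le hp⟩
  · intro l l' h
    refine Real.rpow_le_rpow (hgp _).le ?_ hpp.le
    refine mul_le_mul_of_nonneg_left ?_ hc.le
    refine inv_anti₀ (Real.rpow_pos_of_pos (hg l) _) (Real.rpow_le_rpow (hg l).le (hmono h) hα.le)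
  · have h1 : Filter.Tendsto (fun l => c * (g l ^ α)⁻¹) Filter.atTop (nhds 0) := by
      have := (((tendsto_rpow_atTop hα).comp htend).inv_tendsto_atTop).const_mul c
      simpa using this
    have h2 := h1.rpow_const (p := (p:ℝ)⁻¹) (Or.inr hpp.le)
    rwa [Real.zero_rpow hpp.ne'] at h2

lemma not_summable_pow {c : ℝ} (hc : 0 < c) {g : ℕ → ℝ} (hg : ∀ l, 0 < g l) (hns : ¬ Summable fun l => 1 / g l) {q : ℕ} (hq : 1 ≤ q) :
    ¬ Summable fun l => (c * (g l ^ ((q:ℝ)⁻¹))⁻¹) ^ q := by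
  intro h
  apply hns
  have h2 := h.mul_left ((c^q)⁻¹)
  refine h2.congr fun l => ?_
  rw [mul_pow, inv_pow, root_pow (hg l).le hq]
  field_simp

theorem caseA (e : Fin d ≃ Fin n ⊕ Fin m) (hm : 1 ≤ m) (hn : 1 ≤ n) (hi1 : 1 ≤ i) (hi : i ≤ n)
    (g : ℕ → ℝ) (hg : ∀ l, 0 < g l) (hmono : Monotone g)
    (htend : Filter.Tendsto g Filter.atTop Filter.atTop) (hns : ¬ Summable fun l => 1 / g l) :
    ¬ ∀ᵐ B : Fin m → Fin n → ℝ ∂volume, ∀ᶠ l : ℕ in Filter.atTop,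
        ¬ (∀ r < g l ^ (((d * (d-i) : ℕ) : ℝ)⁻¹), ¬ SV e (MB m n (Real.exp l) B) (i+1) r) := by
  have hd := dmn e
  obtain ⟨c, hc, h⟩ := divD e hm hn hi1 hi
  have hq : 1 ≤ d * (d-i) := Nat.mul_pos (by omega) (by omega)
  obtain ⟨y, hy1, hy2, hy3, hy4⟩ := yseq c hc (((d * (d-i) : ℕ) : ℝ)⁻¹) (inv_pos.2 (by exact_mod_cast hq)) i hi1 g hg hmono htend
  intro hae
  refine h y hy1 hy2 hy3 ?_ ?_
  · have := not_summable_pow hc hg hns hq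
    convert this using 3 with l
    rw [← hy4, ← pow_mul, ← pow_mul]; congr 1; ring
  · filter_upwards [hae] with B hB
    filter_upwards [hB] with l hl hl2
    apply hl
    intro r hr
    refine hl2.2 r ?_
    rw [hy4, mul_inv, inv_inv, ← mul_assoc, mul_inv_cancel₀ hc.ne', one_mul]; exact hr

lemma pairing (R : ℝ) (hR : 0 < R) (B : Fin m → Fin n → ℝ) (w : Fin n ⊕ Fin m → ℤ) (w' : Fin m ⊕ Fin n → ℤ) :
    (∑ k, lv (MB m n R B) w (Sum.inl k) * lv (MB n m R fun k r => -B r k) w' (Sum.inr k)) +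
    (∑ r, lv (MB m n R B) w (Sum.inr r) * lv (MB n m R fun k r => -B r k) w' (Sum.inl r)) =
    ((∑ k, w (Sum.inl k) * w' (Sum.inr k) + ∑ r, w (Sum.inr r) * w' (Sum.inl r) : ℤ) : ℝ) := by
  simp only [lv_inl, lv_inr]
  have hu : R ^ (-(n:ℝ)⁻¹) * R ^ ((n:ℝ)⁻¹) = 1 := by rw [← Real.rpow_add hR]; simp
  have hv : R ^ (-(m:ℝ)⁻¹) * R ^ ((m:ℝ)⁻¹) = 1 := by rw [← Real.rpow_add hR]; simp
  have e1 : ∀ k : Fin n, R ^ (-(n:ℝ)⁻¹) * (w (Sum.inl k) : ℝ) * (R ^ ((n:ℝ)⁻¹) * (∑ r, -B r k * (w' (Sum.inl r) : ℝ) + w' (Sum.inr k))) =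
      (w (Sum.inl k) : ℝ) * w' (Sum.inr k) - ∑ r, B r k * w' (Sum.inl r) * w (Sum.inl k) := by
    intro k
    calc _ = (R ^ (-(n:ℝ)⁻¹) * R ^ ((n:ℝ)⁻¹)) * ((w (Sum.inl k) : ℝ) * (∑ r, -B r k * (w' (Sum.inl r) : ℝ) + w' (Sum.inr k))) := by ring
      _ = _ := by
        rw [hu, one_mul, mul_add, Finset.mul_sum, sub_eq_add_neg, ← Finset.sum_neg_distrib, add_comm]
        congr 1
        exact Finset.sum_congr rfl fun r _ => by ring
  have e2 : ∀ r : Fin m, R ^ ((m:ℝ)⁻¹) * (∑ k, B r k * (w (Sum.inl k) : ℝ) + w (Sum.inr r)) * (R ^ (-(m:ℝ)⁻¹) * (w' (Sum.inl r) : ℝ)) =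
      (w (Sum.inr r) : ℝ) * w' (Sum.inl r) + ∑ k, B r k * w' (Sum.inl r) * w (Sum.inl k) := by
    intro r
    calc _ = (R ^ (-(m:ℝ)⁻¹) * R ^ ((m:ℝ)⁻¹)) * ((∑ k, B r k * (w (Sum.inl k) : ℝ) + w (Sum.inr r)) * (w' (Sum.inl r) : ℝ)) := by ring
      _ = _ := by
        rw [hv, one_mul, add_mul, Finset.sum_mul, add_comm]
        congr 1
        exact Finset.sum_congr rfl fun r _ => by ring
  rw [Finset.sum_congr rfl fun k _ => e1 k, Finset.sum_congr rfl fun r _ => e2 r, Finset.sum_sub_distrib, Finset.sum_add_distrib,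
    Finset.sum_comm (f := fun (k : Fin n) (r : Fin m) => B r k * (w' (Sum.inl r) : ℝ) * (w (Sum.inl k) : ℝ))]
  push_cast; ring

lemma dual (e : Fin d ≃ Fin n ⊕ Fin m) (e' : Fin d ≃ Fin m ⊕ Fin n) (R : ℝ) (hR : 0 < R) (B : Fin m → Fin n → ℝ) {j : ℕ} (hjk : d < j + k)
    {ρ ρ' : ℝ} (hρ : 0 ≤ ρ) (hρρ : ρ * ρ' < 1) (h' : SV e' (MB n m R fun k r => -B r k) k ρ') : ¬ SV e (MB m n R B) j ρ := by
  rintro ⟨v, hv1, hv2, hv3⟩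
  obtain ⟨v', hv1', hv2', hv3'⟩ := h'
  set φ := LinearIsometryEquiv.piLpCongrLeft 2 ℝ ℝ (Equiv.sumComm (Fin m) (Fin n)) with hφ
  have hzero : ∀ a b, inner ℝ (v a) (φ (v' b)) = 0 := by
    intro a b
    obtain ⟨z, hz⟩ := (mem_lat_bb e _ _).1 (hv1 a)
    obtain ⟨z', hz'⟩ := (mem_lat_bb e' _ _).1 (hv1' b)
    have h1 : inner ℝ (v a) (φ (v' b)) = ((∑ k, z (Sum.inl k) * z' (Sum.inr k) + ∑ r, z (Sum.inr r) * z' (Sum.inl r) : ℤ) : ℝ) := by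
      rw [← pairing R hR B z z', hz, hz', PiLp.inner_apply, Fintype.sum_sum_type]
      congr 1 <;>
      · refine Finset.sum_congr rfl fun k _ => ?_
        simp [hφ, LinearIsometryEquiv.piLpCongrLeft_apply, Equiv.piCongrLeft', mul_comm]
    have h2 := abs_real_inner_le_norm (v a) (φ (v' b))
    rw [LinearIsometryEquiv.norm_map] at h2
    have h3 : ‖v a‖ * ‖v' b‖ < 1 := lt_of_le_of_lt (mul_le_mul (hv3 a) (hv3' b) (norm_nonneg _) hρ) hρρ
    have h4 := lt_of_le_of_lt h2 h3
    rw [h1] at h4 ⊢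
    have h5 : |∑ k, z (Sum.inl k) * z' (Sum.inr k) + ∑ r, z (Sum.inr r) * z' (Sum.inl r)| < 1 := by exact_mod_cast h4
    rw [Int.abs_lt_one_iff.1 h5]; simp
  set V := Submodule.span ℝ (Set.range v)
  set V' := Submodule.span ℝ (Set.range fun b => φ (v' b))
  have hV : Module.finrank ℝ V = j := by rw [finrank_span_eq_card hv2]; simp
  have hli : LinearIndependent ℝ fun b => φ (v' b) := hv2'.map' φ.toLinearEquiv.toLinearMap (LinearEquiv.ker _)
  have hV' : Module.finrank ℝ V' = k := by rw [finrank_span_eq_card hli]; simp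
  have hle : V' ≤ Vᗮ := by
    refine Submodule.span_le.2 ?_
    rintro _ ⟨b, rfl⟩
    change φ (v' b) ∈ Vᗮ
    rw [Submodule.mem_orthogonal]
    intro u hu
    induction hu using Submodule.span_induction with
    | mem x hx => obtain ⟨a, rfl⟩ := hx; exact hzero a b
    | zero => simp
    | add x y _ _ hx hy => rw [inner_add_left, hx, hy, add_zero]
    | smul c x _ hx => rw [inner_smul_left, hx, mul_zero]
  have h1 : Module.finrank ℝ V' ≤ Module.finrank ℝ Vᗮ := Submodule.finrank_mono hle
  have h2 : Module.finrank ℝ V + Module.finrank ℝ Vᗮ = Module.finrank ℝ (EuclideanSpace ℝ (Fin n ⊕ Fin m)) :=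
    Submodule.finrank_add_finrank_orthogonal V
  rw [finrank_E e] at h2
  omega

theorem caseB (e : Fin d ≃ Fin n ⊕ Fin m) (hm : 1 ≤ m) (hn : 1 ≤ n) (hi1 : n ≤ i) (hi : i < d)
    (g : ℕ → ℝ) (hg : ∀ l, 0 < g l) (hmono : Monotone g)
    (htend : Filter.Tendsto g Filter.atTop Filter.atTop) (hns : ¬ Summable fun l => 1 / g l) :
    ¬ ∀ᵐ B : Fin m → Fin n → ℝ ∂volume, ∀ᶠ l : ℕ in Filter.atTop,
        ¬ (∀ r < g l ^ (((d * (d-i) : ℕ) : ℝ)⁻¹), ¬ SV e (MB m n (Real.exp l) B) (i+1) r) := by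
  have hd := dmn e
  set e' : Fin d ≃ Fin m ⊕ Fin n := e.trans (Equiv.sumComm _ _) with he'
  obtain ⟨c, hc, h⟩ := divD (i := d - i) e' hn hm (by omega) (by omega)
  have hq : 1 ≤ d * (d-i) := Nat.mul_pos (by omega) (by omega)
  have hdp : (0:ℝ) < d := by exact_mod_cast (by omega : 0 < d)
  have hcp : 0 < ((2:ℝ)*d)⁻¹ := by positivity
  obtain ⟨y, hy1, hy2, hy3, hy4⟩ := yseq ((2*d)⁻¹) hcp (((d * (d-i) : ℕ) : ℝ)⁻¹) (inv_pos.2 (by exact_mod_cast hq)) (d-(d-i)) (by omega) g hg hmono htend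
  intro hae
  refine h y hy1 hy2 hy3 ?_ ?_
  · have := not_summable_pow hcp hg hns hq
    convert this using 3 with l
    rw [hy4]
  · have hmp : MeasurePreserving (fun (B : Fin n → Fin m → ℝ) => -fun (r : Fin m) (k : Fin n) => B k r) volume volume :=
      (Measure.measurePreserving_neg (volume : Measure (Fin m → Fin n → ℝ))).comp (tr_mp (κ := Fin n) (ν := Fin m))
    have hae' := hmp.quasiMeasurePreserving.ae hae
    filter_upwards [hae'] with B hB
    filter_upwards [hB] with l hl hl2
    apply hl
    intro r hr hsv
    have hgl := Real.rpow_pos_of_pos (hg l) (((d * (d-i) : ℕ) : ℝ)⁻¹)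
    set G := g l ^ (((d * (d-i) : ℕ) : ℝ)⁻¹)
    have h3 := hl2.1
    rw [hy4, ← mul_assoc, mul_inv_cancel₀ (by positivity), one_mul] at h3
    have hsv2 := hsv.mono (le_max_left r 0)
    refine dual (k := d - i) e e' (Real.exp l) (Real.exp_pos _) _ (by omega) (le_max_right _ _) (ρ' := G⁻¹) ?_ ?_ hsv2
    · rw [← div_eq_mul_inv, div_lt_one hgl]; exact max_lt hr hgl
    · convert h3 using 3
      simp
end Fin1
end KM

open MeasureTheory
open scoped ENNReal
set_option linter.unusedSectionVars false
namespace KM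
open InnerProductSpace

section Fin2
variable {m n : ℕ}

lemma exists_g (f : ℝ → ℝ) (hfpos : ∀ x > (0 : ℝ), 0 < f x) (hfmono : MonotoneOn f (Set.Ioi 0))
    (hns : ¬ Summable fun k : ℕ => 1 / f (k + 1)) :
    ∃ g : ℕ → ℝ, (∀ l, 0 < g l) ∧ Monotone g ∧ Filter.Tendsto g Filter.atTop Filter.atTop ∧ (¬ Summable fun l => 1 / g l) ∧
      ∀ᶠ l : ℕ in Filter.atTop, f l ≤ g l := by
  set F : ℕ → ℝ := fun l => f (l + 1) with hF
  have hm : Monotone F := fun l l' h => hfmono (by simp; positivity) (by simp; positivity) (by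
    have : (l:ℝ) ≤ l' := by exact_mod_cast h
    linarith)
  rcases tendsto_atTop_of_monotone hm with h | ⟨K, hK⟩
  · refine ⟨F, fun l => hfpos _ (by positivity), hm, h, hns, ?_⟩
    filter_upwards [Filter.eventually_ge_atTop 1] with l hl
    have : (1:ℝ) ≤ l := by exact_mod_cast hl
    exact hfmono (by simp; linarith) (by simp; linarith) (by linarith)
  · refine ⟨fun l => (l:ℝ) + 1, fun l => by positivity, fun l l' h => ?_, ?_, ?_, ?_⟩
    · have : (l:ℝ) ≤ l' := by exact_mod_cast h
      change (l:ℝ) + 1 ≤ l' + 1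
      linarith
    · exact Filter.tendsto_atTop_add_const_right _ _ tendsto_natCast_atTop_atTop
    · intro h
      refine Real.not_summable_one_div_natCast ((summable_nat_add_iff 1).1 ?_)
      refine h.congr fun l => by push_cast; rfl
    · filter_upwards [Filter.eventually_ge_atTop 1, (tendsto_natCast_atTop_atTop (R := ℝ)).eventually_ge_atTop K] with l hl hl2
      have : (1:ℝ) ≤ l := by exact_mod_cast hl
      have h1 : f l ≤ F l := hfmono (by simp; linarith) (by simp; linarith) (by linarith)
      have h2 := hm.ge_of_tendsto hK l
      linarith

theorem div_dir (hm : 1 ≤ m) (hn : 1 ≤ n)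
    (f : ℝ → ℝ) (hfpos : ∀ x > (0 : ℝ), 0 < f x) (hfmono : MonotoneOn f (Set.Ioi 0))
    (j : ℕ) (hj1 : 2 ≤ j) (hj2 : j ≤ m + n)
    (hae : ∀ᵐ B : Fin m → Fin n → ℝ ∂volume, ∃ R₀ > (0 : ℝ), ∀ R ≥ R₀,
        succMin (colLattice (AQ m n R * UB B)) j
          < f (Real.log R) ^ ((((m + n : ℕ) : ℝ) * ((m + n - j + 1 : ℕ) : ℝ))⁻¹)) :
    Summable fun k : ℕ => 1 / f (k + 1) := by
  by_contra hns
  obtain ⟨g, hg, hmono, htend, hgns, hfg⟩ := exists_g f hfpos hfmono hns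
  obtain ⟨e⟩ := equivE m n
  obtain ⟨i, rfl⟩ : ∃ i, j = i + 1 := ⟨j - 1, by omega⟩
  have hmain : ∀ᵐ B : Fin m → Fin n → ℝ ∂volume, ∀ᶠ l : ℕ in Filter.atTop,
        ¬ (∀ r < g l ^ ((((m+n) * (m+n-i) : ℕ) : ℝ)⁻¹), ¬ SV e (MB m n (Real.exp l) B) (i+1) r) := by
    filter_upwards [hae] with B hB
    obtain ⟨R₀, hR₀, hB⟩ := hB
    have h1 : ∀ᶠ l : ℕ in Filter.atTop, R₀ ≤ Real.exp l :=
      (Real.tendsto_exp_atTop.comp (tendsto_natCast_atTop_atTop (R := ℝ))).eventually_ge_atTop R₀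
    filter_upwards [h1, hfg, Filter.eventually_ge_atTop 1] with l hl hl2 hl3 hno
    have h2 := hB _ hl
    have h3 := le_succMin e (MB m n (Real.exp l) B) (by rw [det_MB hm hn (Real.exp_pos _)]; simp) (i+1) hj2 hno
    rw [Real.log_exp, show m + n - (i+1) + 1 = m + n - i by omega, ← Nat.cast_mul] at h2
    have h4 : f l ^ ((((m+n) * (m+n-i) : ℕ) : ℝ)⁻¹) ≤ g l ^ ((((m+n) * (m+n-i) : ℕ) : ℝ)⁻¹) :=
      Real.rpow_le_rpow (hfpos _ (by have : (1:ℝ) ≤ l := by exact_mod_cast hl3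
                                     change (0:ℝ) < l
                                     linarith)).le hl2 (by positivity)
    exact absurd (lt_of_lt_of_le h2 h4) (not_lt.2 h3)
  rcases le_total i n with h | h
  · exact caseA e hm hn (by omega) h g hg hmono htend hgns hmain
  · exact caseB e hm hn h (by omega) g hg hmono htend hgns hmain
end Fin2
end KM

/-- **Theorem 2.7 (Kleinbock–Margulis), second part.** For increasing `f : ℝ_{>0} → ℝ_{>0}`
and `2 ≤ j ≤ d` (`d = m + n`): `∑ 1/f(k) < ∞` iff for almost every `m×n` real matrix `B`
one has `λ_j(A_R U_B ℤ^d) < (f(log R))^{1/(d(d−j+1))}` for all sufficiently large `R`. -/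
theorem succMin_upper_zero_one_law (m n : ℕ) (hm : 1 ≤ m) (hn : 1 ≤ n)
    (f : ℝ → ℝ) (hfpos : ∀ x > (0 : ℝ), 0 < f x) (hfmono : MonotoneOn f (Set.Ioi 0))
    (j : ℕ) (hj1 : 2 ≤ j) (hj2 : j ≤ m + n) :
    (Summable fun k : ℕ => 1 / f (k + 1)) ↔
      ∀ᵐ B : Fin m → Fin n → ℝ ∂volume, ∃ R₀ > (0 : ℝ), ∀ R ≥ R₀,
        succMin (colLattice (AQ m n R * UB B)) j
          < f (Real.log R) ^ ((((m + n : ℕ) : ℝ) * ((m + n - j + 1 : ℕ) : ℝ))⁻¹) := by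
  exact ⟨KM.conv_dir hm hn f hfpos hfmono j hj1 hj2, KM.div_dir hm hn f hfpos hfmono j hj1 hj2⟩
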